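/- For every ε > 0 there exists a constant C > 0 such that for every real R ≥ 2 and every subset A of ℤ^2 of diameter at most R, the number of asymmetric cyclic quadrilaterals with vertices in A is at most C · R^{4 + 18/29 + ε}. -/

import Mathlib

/-- A point of `ℝ^2` with integer coordinates. -/
def IsIntegerPoint (x : EuclideanSpace ℝ (Fin 2)) : Prop :=
  ∀ i, ∃ m : ℤ, x i = (m : ℝ)

/-- A cyclic quadrilateral: a 4-element subset of `ℝ^2` lying on a common circle. -/
def IsCyclicQuadrilateral (Q : Set (EuclideanSpace ℝ (Fin 2))) : Prop :=
  Q.ncard = 4 ∧ ∃ (c : EuclideanSpace ℝ (Fin 2)) (ρ : ℝ), 0 < ρ ∧ Q ⊆ Metric.sphere c ρ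

/-- `φ` is the reflection of `ℝ^2` across some line: it is an isometry of `ℝ^2` whose
fixed-point set is a line (a one-dimensional affine subspace). -/
def IsLineReflection
    (φ : EuclideanSpace ℝ (Fin 2) ≃ᵃⁱ[ℝ] EuclideanSpace ℝ (Fin 2)) : Prop :=
  ∃ L : AffineSubspace ℝ (EuclideanSpace ℝ (Fin 2)),
    Module.finrank ℝ L.direction = 1 ∧ ∀ x, φ x = x ↔ x ∈ L

/-- A symmetric subset of `ℝ^2`: one mapped to itself by the reflection across some line. -/
def IsSymmetricSet (Q : Set (EuclideanSpace ℝ (Fin 2))) : Prop :=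
  ∃ φ : EuclideanSpace ℝ (Fin 2) ≃ᵃⁱ[ℝ] EuclideanSpace ℝ (Fin 2),
    IsLineReflection φ ∧ φ '' Q = Q


namespace ACQ

/-! ### Finite counting framework -/

/-- `S` is finite with at most `m` elements. -/
def Cnt {α : Type*} (S : Set α) (m : ℝ) : Prop := S.Finite ∧ (S.ncard : ℝ) ≤ m

theorem Cnt.mono {α : Type*} {S T : Set α} {m m' : ℝ} (h : Cnt T m) (hST : S ⊆ T) (hm : m ≤ m') :
    Cnt S m' :=
  ⟨h.1.subset hST, le_trans (by exact_mod_cast Set.ncard_le_ncard hST h.1) (h.2.trans hm)⟩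

theorem Cnt.le {α : Type*} {S : Set α} {m m' : ℝ} (h : Cnt S m) (hm : m ≤ m') : Cnt S m' :=
  h.mono subset_rfl hm

theorem Cnt.subset {α : Type*} {S T : Set α} {m : ℝ} (h : Cnt T m) (hST : S ⊆ T) : Cnt S m :=
  h.mono hST le_rfl

theorem Cnt.nonneg {α : Type*} {S : Set α} {m : ℝ} (h : Cnt S m) : 0 ≤ m :=
  le_trans (Nat.cast_nonneg _) h.2

theorem Cnt.union {α : Type*} {S T : Set α} {m m' : ℝ} (h : Cnt S m) (h' : Cnt T m') :
    Cnt (S ∪ T) (m + m') :=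
  ⟨h.1.union h'.1, by
    have := Set.ncard_union_le S T
    have h2 : ((S ∪ T).ncard : ℝ) ≤ S.ncard + T.ncard := by exact_mod_cast this
    linarith [h.2, h'.2]⟩

theorem Cnt.image {α β : Type*} {S : Set α} {m : ℝ} (h : Cnt S m) (f : α → β) :
    Cnt (f '' S) m :=
  ⟨h.1.image f, le_trans (by exact_mod_cast Set.ncard_image_le h.1) h.2⟩

theorem Cnt.of_injOn {α β : Type*} {S : Set α} {m : ℝ} {f : α → β} (h : Cnt (f '' S) m)
    (hf : Set.InjOn f S) : Cnt S m :=
  ⟨h.1.of_finite_image hf, by rw [← hf.ncard_image]; exact h.2⟩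

theorem cnt_empty {α : Type*} {m : ℝ} (hm : 0 ≤ m) : Cnt (∅ : Set α) m :=
  ⟨Set.finite_empty, by simpa using hm⟩

theorem cnt_subsingleton {α : Type*} {S : Set α} (h : ∀ x ∈ S, ∀ y ∈ S, x = y) : Cnt S 1 := by
  have hs : S.Subsingleton := fun x hx y hy => h x hx y hy
  refine ⟨hs.finite, ?_⟩
  exact_mod_cast (Set.ncard_le_one hs.finite).2 (fun x hx y hy => h x hx y hy)

theorem Cnt.fiber {α β : Type*} {S : Set α} {f : α → β} {t m : ℝ} (h : Cnt (f '' S) t)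
    (hm : 0 ≤ m) (hf : ∀ y ∈ f '' S, Cnt {x | x ∈ S ∧ f x = y} m) : Cnt S (t * m) := by
  classical
  have hS : S = ⋃ y ∈ h.1.toFinset, {x | x ∈ S ∧ f x = y} := by
    ext x
    simp only [Set.mem_iUnion, Set.mem_ofPred_eq, Set.Finite.mem_toFinset, Set.mem_image]
    constructor
    · intro hx; exact ⟨f x, ⟨x, hx, rfl⟩, hx, rfl⟩
    · rintro ⟨y, _, hx, _⟩; exact hx
  have hfin : S.Finite := by
    rw [hS]
    refine Set.Finite.biUnion (Finset.finite_toSet _) (fun y hy => (hf y ?_).1)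
    simpa using hy
  refine ⟨hfin, ?_⟩
  have h1 : S.ncard ≤ ∑ y ∈ h.1.toFinset, {x | x ∈ S ∧ f x = y}.ncard := by
    conv_lhs => rw [hS]
    exact Finset.set_ncard_biUnion_le _ _
  have h2 : (S.ncard : ℝ) ≤ ∑ y ∈ h.1.toFinset, ({x | x ∈ S ∧ f x = y}.ncard : ℝ) := by
    exact_mod_cast h1
  have h3 : ∑ y ∈ h.1.toFinset, ({x | x ∈ S ∧ f x = y}.ncard : ℝ) ≤ ∑ y ∈ h.1.toFinset, m := by
    refine Finset.sum_le_sum (fun y hy => (hf y ?_).2)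
    simpa using hy
  rw [Finset.sum_const, nsmul_eq_mul] at h3
  have h4 : (h.1.toFinset.card : ℝ) ≤ t := by
    rw [← Set.ncard_eq_toFinset_card _ h.1]; exact h.2
  nlinarith

theorem cnt_prod {α β : Type*} {S : Set α} {T : Set β} {s t : ℝ} (hS : Cnt S s) (hT : Cnt T t) :
    Cnt (S ×ˢ T) (s * t) := by
  refine ⟨hS.1.prod hT.1, ?_⟩
  rw [Set.ncard_prod]
  push_cast
  exact mul_le_mul hS.2 hT.2 (Nat.cast_nonneg _) hS.nonneg

theorem cnt_biUnion {ι α : Type*} {I : Set ι} {S : ι → Set α} {t m : ℝ} (hI : Cnt I t)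
    (hm : 0 ≤ m) (hS : ∀ i ∈ I, Cnt (S i) m) : Cnt (⋃ i ∈ I, S i) (t * m) := by
  classical
  have h1 : Cnt {p : ι × α | p.1 ∈ I ∧ p.2 ∈ S p.1} (t * m) := by
    refine Cnt.fiber (f := Prod.fst) (hI.subset ?_) hm ?_
    · rintro _ ⟨p, hp, rfl⟩; exact hp.1
    · rintro i ⟨p, hp, rfl⟩
      refine Cnt.of_injOn (f := Prod.snd) ((hS p.1 hp.1).subset ?_) ?_
      · rintro _ ⟨q, ⟨hq, hqp⟩, rfl⟩; rw [← hqp]; exact hq.2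
      · rintro a ⟨_, ha⟩ b ⟨_, hb⟩ hab; exact Prod.ext (ha.trans hb.symm) hab
  refine (h1.image Prod.snd).subset ?_
  intro x hx
  simp only [Set.mem_iUnion] at hx
  obtain ⟨i, hi, hx⟩ := hx
  exact ⟨(i, x), ⟨hi, hx⟩, rfl⟩

theorem cnt_int_Icc (B : ℝ) (hB : 0 ≤ B) : Cnt {n : ℤ | |(n : ℝ)| ≤ B} (2 * B + 1) := by
  have hsub : {n : ℤ | |(n : ℝ)| ≤ B} ⊆ Set.Icc (-⌊B⌋) ⌊B⌋ := by
    intro n hn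
    have hn' : |(n : ℝ)| ≤ B := hn
    have := abs_le.1 hn'
    constructor
    · have h1 : -n ≤ ⌊B⌋ := Int.le_floor.2 (by push_cast; linarith)
      linarith
    · exact Int.le_floor.2 this.2
  refine Cnt.subset ⟨Set.finite_Icc _ _, ?_⟩ hsub
  have hf : 0 ≤ ⌊B⌋ := Int.floor_nonneg.2 hB
  rw [Set.ncard_eq_toFinset_card' , Set.toFinset_Icc, Int.card_Icc]
  have : (((⌊B⌋ + 1 - -⌊B⌋).toNat : ℤ) : ℝ) = 2 * ⌊B⌋ + 1 := by
    rw [Int.toNat_of_nonneg (by linarith)]; push_cast; ring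
  have h3 : (((⌊B⌋ + 1 - -⌊B⌋).toNat : ℕ) : ℝ) = 2 * ⌊B⌋ + 1 := by exact_mod_cast this
  rw [h3]
  linarith [Int.floor_le B]

/-! ### Gaussian integers -/

abbrev GI := GaussianInt

/-- absolute value of a Gaussian integer -/
noncomputable def nrm (z : GI) : ℝ := ‖GaussianInt.toComplex z‖

theorem nrm_nonneg (z : GI) : 0 ≤ nrm z := norm_nonneg _

theorem nrm_mul (z w : GI) : nrm (z * w) = nrm z * nrm w := by simp [nrm]

theorem nrm_add_le (z w : GI) : nrm (z + w) ≤ nrm z + nrm w := by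
  simpa [nrm] using norm_add_le (GaussianInt.toComplex z) (GaussianInt.toComplex w)

theorem nrm_sub_le (z w : GI) : nrm (z - w) ≤ nrm z + nrm w := by
  simpa [nrm] using norm_sub_le (GaussianInt.toComplex z) (GaussianInt.toComplex w)

theorem nrm_neg (z : GI) : nrm (-z) = nrm z := by simp [nrm]

theorem nrm_star (z : GI) : nrm (star z) = nrm z := by
  simp [nrm, GaussianInt.toComplex_star]

theorem nrm_sq (z : GI) : nrm z ^ 2 = (z.norm : ℝ) := by
  rw [nrm, GaussianInt.intCast_real_norm, Complex.normSq_eq_norm_sq]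

theorem nrm_zero : nrm 0 = 0 := by simp [nrm]

theorem nrm_one : nrm 1 = 1 := by simp [nrm]

theorem nrm_pos {z : GI} (h : z ≠ 0) : 0 < nrm z := by
  simpa [nrm] using h

theorem nrm_eq_zero {z : GI} : nrm z = 0 ↔ z = 0 := by simp [nrm]

theorem one_le_nrm {z : GI} (h : z ≠ 0) : 1 ≤ nrm z := by
  have h1 : (1 : ℤ) ≤ z.norm := GaussianInt.norm_pos.2 h
  have h2 : (1 : ℝ) ≤ nrm z ^ 2 := by rw [nrm_sq]; exact_mod_cast h1
  nlinarith [nrm_nonneg z]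

theorem nrm_int (n : ℤ) : nrm (n : GI) = |(n : ℝ)| := by
  simp [nrm]

theorem nrm_eq_iff {z w : GI} : nrm z = nrm w ↔ z.norm = w.norm := by
  constructor
  · intro h
    have : nrm z ^ 2 = nrm w ^ 2 := by rw [h]
    rw [nrm_sq, nrm_sq] at this
    exact_mod_cast this
  · intro h
    have : nrm z ^ 2 = nrm w ^ 2 := by rw [nrm_sq, nrm_sq, h]
    exact (sq_eq_sq₀ (nrm_nonneg _) (nrm_nonneg _)).1 this

theorem norm_eq (z : GI) : z.norm = z.re * z.re + z.im * z.im := by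
  rw [Zsqrtd.norm_def]; ring

theorem abs_re_le (z : GI) : |(z.re : ℝ)| ≤ nrm z := by
  have := Complex.abs_re_le_norm (GaussianInt.toComplex z)
  simpa [nrm] using this

theorem abs_im_le (z : GI) : |(z.im : ℝ)| ≤ nrm z := by
  have := Complex.abs_im_le_norm (GaussianInt.toComplex z)
  simpa [nrm] using this

theorem cnt_disc (B : ℝ) (hB : 1 ≤ B) : Cnt {z : GI | nrm z ≤ B} (9 * B ^ 2) := by
  have h := cnt_int_Icc B (by linarith)
  refine Cnt.of_injOn (f := fun z : GI => (z.re, z.im)) ((cnt_prod h h).mono ?_ ?_) ?_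
  · rintro _ ⟨z, hz, rfl⟩
    exact ⟨(abs_re_le z).trans hz, (abs_im_le z).trans hz⟩
  · nlinarith
  · intro z _ w _ hzw
    simp only [Prod.mk.injEq] at hzw
    exact Zsqrtd.ext hzw.1 hzw.2

theorem isUnit_iff_norm {z : GI} : IsUnit z ↔ z.norm = 1 := by
  rw [← Zsqrtd.norm_eq_one_iff]
  constructor
  · intro h
    have := GaussianInt.abs_natCast_norm z
    rw [h] at this
    simpa using this.symm
  · intro h; rw [h]; rfl

theorem isUnit_iff_nrm {z : GI} : IsUnit z ↔ nrm z = 1 := by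
  rw [isUnit_iff_norm, ← nrm_one, nrm_eq_iff]; simp [Zsqrtd.norm_one]

theorem isUnit_cases {z : GI} (h : IsUnit z) : z = 1 ∨ z = -1 ∨ z = ⟨0, 1⟩ ∨ z = ⟨0, -1⟩ := by
  rw [isUnit_iff_norm, norm_eq] at h
  obtain ⟨a, b⟩ := z
  simp only at h
  have ha : -1 ≤ a ∧ a ≤ 1 := by constructor <;> nlinarith
  have hb : -1 ≤ b ∧ b ≤ 1 := by constructor <;> nlinarith
  obtain ⟨ha1, ha2⟩ := ha
  obtain ⟨hb1, hb2⟩ := hb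
  interval_cases a <;> interval_cases b <;> simp_all [Zsqrtd.ext_iff]

theorem cnt_units : Cnt {z : GI | IsUnit z} 4 := by
  have : {z : GI | IsUnit z} ⊆ (({1, -1, ⟨0, 1⟩, ⟨0, -1⟩} : Finset GI) : Set GI) := by
    intro z hz
    rcases isUnit_cases hz with h | h | h | h <;> simp [h]
  refine Cnt.subset ⟨Finset.finite_toSet _, ?_⟩ this
  rw [Set.ncard_coe_finset]
  exact_mod_cast Finset.card_le_four

theorem cnt_assoc (z : GI) : Cnt {w : GI | Associated w z} 4 := by
  refine (cnt_units.image (fun e => z * e)).subset ?_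
  intro w hw
  obtain ⟨e, he⟩ := hw.symm
  exact ⟨e, e.isUnit, he⟩

theorem nrm_le_of_dvd {a b : GI} (hb : b ≠ 0) (h : a ∣ b) : nrm a ≤ nrm b := by
  obtain ⟨c, rfl⟩ := h
  rw [nrm_mul]
  have hc : c ≠ 0 := right_ne_zero_of_mul hb
  nlinarith [one_le_nrm hc, nrm_nonneg a]

end ACQ


namespace ACQ
open UniqueFactorizationMonoid

/-! ### The divisor bound -/

theorem sq_two_le_nrm_prime {p : GI} (hp : Prime p) : (2 : ℝ) ≤ nrm p ^ 2 := by
  rw [nrm_sq]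
  have h0 : 0 < p.norm := GaussianInt.norm_pos.2 hp.ne_zero
  have h1 : p.norm ≠ 1 := fun h => hp.not_isUnit (isUnit_iff_norm.2 h)
  have : (2 : ℤ) ≤ p.norm := by omega
  exact_mod_cast this

theorem divisor_bound (δ : ℝ) (hδ : 0 < δ) :
    ∃ C : ℝ, 1 ≤ C ∧ ∀ z : GI, z ≠ 0 → Cnt {d : GI | d ∣ z} (C * nrm z ^ δ) := by
  classical
  let _ : NormalizationMonoid GI :=
    (UniqueFactorizationMonoid.strongNormalizationMonoid (α := GI)).toNormalizationMonoid
  -- minimal growth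
  set q : ℝ := (Real.sqrt 2) ^ δ with hq
  have hs2 : 1 < Real.sqrt 2 := by
    rw [show (1 : ℝ) = Real.sqrt 1 by simp]
    exact Real.sqrt_lt_sqrt (by norm_num) (by norm_num)
  have hq1 : 1 < q := Real.one_lt_rpow hs2 hδ
  set c : ℝ := max 1 (1 / (q - 1)) with hc
  have hc1 : 1 ≤ c := le_max_left _ _
  have hc2 : 1 / (q - 1) ≤ c := le_max_right _ _
  have hc3 : 1 ≤ c * (q - 1) := by
    rw [div_le_iff₀ (by linarith)] at hc2; exact hc2
  set B : ℝ := (2 : ℝ) ^ (1 / δ) with hB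
  have hB1 : 1 ≤ B := Real.one_le_rpow (by norm_num) (by positivity)
  have hfin : {z : GI | nrm z ≤ B}.Finite := (cnt_disc B hB1).1
  set N0 : ℕ := hfin.toFinset.card with hN0
  refine ⟨4 * c ^ N0, ?_, ?_⟩
  · have := one_le_pow₀ hc1 (n := N0); linarith
  intro z hz
  set s := normalizedFactors z with hs
  -- bound the number of divisors
  have hIic : Cnt ((Finset.Iic s : Finset (Multiset GI)) : Set (Multiset GI))
      ((Finset.Iic s).card : ℝ) := ⟨Finset.finite_toSet _, by rw [Set.ncard_coe_finset]⟩
  have h1 : Cnt {d : GI | d ∣ z} (((Finset.Iic s).card : ℝ) * 4) := by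
    refine Cnt.fiber (f := fun d => normalizedFactors d) (hIic.subset ?_) (by norm_num) ?_
    · rintro _ ⟨d, hd, rfl⟩
      have hd' : d ∣ z := hd
      have hd0 : d ≠ 0 := ne_zero_of_dvd_ne_zero hz hd'
      simpa using (dvd_iff_normalizedFactors_le_normalizedFactors hd0 hz).1 hd'
    · rintro _ ⟨d, hd, rfl⟩
      have hd' : d ∣ z := hd
      have hd0 : d ≠ 0 := ne_zero_of_dvd_ne_zero hz hd'
      refine (cnt_assoc d).subset ?_
      rintro e ⟨he, hed⟩
      have he' : e ∣ z := he
      have he0 : e ≠ 0 := ne_zero_of_dvd_ne_zero hz he'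
      exact (associated_iff_normalizedFactors_eq_normalizedFactors he0 hd0).2 hed
  refine h1.le ?_
  rw [Multiset.card_Iic]
  push_cast
  -- the norm
  have h2 : nrm z = ∏ p ∈ s.toFinset, nrm p ^ s.count p := by
    have hass : Associated s.prod z := prod_normalizedFactors hz
    obtain ⟨e, he⟩ := hass
    have he1 : nrm (e : GI) = 1 := isUnit_iff_nrm.1 e.isUnit
    rw [← he, nrm_mul, he1, mul_one, Finset.prod_multiset_count]
    have : ∀ (t : Finset GI) (f : GI → GI), nrm (∏ p ∈ t, f p) = ∏ p ∈ t, nrm (f p) := by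
      intro t f
      simp [nrm]
    rw [this]
    refine Finset.prod_congr rfl (fun p _ => ?_)
    simp [nrm]
  have h3 : nrm z ^ δ = ∏ p ∈ s.toFinset, (nrm p ^ δ) ^ s.count p := by
    rw [h2, ← Real.finsetProd_rpow _ _ (fun p _ => pow_nonneg (nrm_nonneg p) _)]
    refine Finset.prod_congr rfl (fun p _ => ?_)
    rw [← Real.rpow_natCast, ← Real.rpow_natCast, ← Real.rpow_mul (nrm_nonneg p),
      ← Real.rpow_mul (nrm_nonneg p), mul_comm]
  have key : ∀ p ∈ s.toFinset, ((s.count p : ℝ) + 1) ≤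
      (if nrm p ≤ B then c else 1) * (nrm p ^ δ) ^ s.count p := by
    intro p hp
    have hpp : Prime p := prime_of_normalized_factor p (by simpa using hp)
    have hn2 := sq_two_le_nrm_prime hpp
    have hsq : Real.sqrt 2 ≤ nrm p := by
      rw [Real.sqrt_le_left (nrm_nonneg p)]; exact hn2
    have hqp : q ≤ nrm p ^ δ := Real.rpow_le_rpow (Real.sqrt_nonneg 2) hsq hδ.le
    split_ifs with hpB
    · have hb := one_add_mul_le_pow (a := q - 1) (by linarith) (s.count p)
      have hle : (1 + (q - 1)) ^ s.count p ≤ (nrm p ^ δ) ^ s.count p := by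
        apply pow_le_pow_left₀ <;> linarith
      have hcnt : (0 : ℝ) ≤ s.count p := Nat.cast_nonneg _
      calc (s.count p : ℝ) + 1 ≤ c * (1 + s.count p * (q - 1)) := by nlinarith
        _ ≤ c * (nrm p ^ δ) ^ s.count p := by
          apply mul_le_mul_of_nonneg_left (hb.trans hle); linarith
    · push Not at hpB
      have h2δ : (2 : ℝ) ≤ nrm p ^ δ := by
        have : (2 : ℝ) = B ^ δ := by
          rw [hB, ← Real.rpow_mul (by norm_num)]; field_simp; simp
        rw [this]
        exact Real.rpow_le_rpow (by linarith) hpB.le hδ.le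
      have hb := one_add_mul_le_pow (a := (1 : ℝ)) (by linarith) (s.count p)
      have hle : (1 + (1 : ℝ)) ^ s.count p ≤ (nrm p ^ δ) ^ s.count p := by
        apply pow_le_pow_left₀ <;> linarith
      linarith
  have h4 := Finset.prod_le_prod (fun p _ => by positivity) key
  rw [Finset.prod_mul_distrib, ← h3, Finset.prod_ite, Finset.prod_const, Finset.prod_const_one,
    mul_one] at h4
  have h5 : c ^ (s.toFinset.filter (fun p => nrm p ≤ B)).card ≤ c ^ N0 := by
    apply pow_le_pow_right₀ hc1
    apply Finset.card_le_card
    intro p hp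
    simp only [Finset.mem_filter] at hp
    simpa using hp.2
  have h6 : 0 ≤ nrm z ^ δ := Real.rpow_nonneg (nrm_nonneg z) δ
  nlinarith [mul_le_mul_of_nonneg_right h5 h6]

end ACQ


namespace ACQ

/-! ### Counting coprime pairs whose mutual determinants are large -/

theorem floor_abs_le (x r : ℝ) (h : |x| ≤ r) : |((⌊x⌋ : ℤ) : ℝ)| ≤ r + 1 := by
  have h1 := Int.floor_le x
  have h2 := Int.lt_floor_add_one x
  have := abs_le.1 h
  rw [abs_le]; constructor <;> linarith

theorem abs_sub_lt_of_floor {x y : ℝ} (h : ⌊x⌋ = ⌊y⌋) : |x - y| < 1 :=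
  Int.abs_sub_lt_one_of_floor_eq_floor h

theorem slopesG {S : Set (GI × GI)} {X Y I : ℝ} (hX : 0 < X) (hY : 0 ≤ Y) (hI : 0 < I)
    (h1 : ∀ s ∈ S, X ≤ nrm s.1 ∧ nrm s.1 ≤ 2 * X ∧ nrm s.2 ≤ 2 * Y ∧ IsCoprime s.1 s.2)
    (h2 : ∀ s ∈ S, ∀ t ∈ S, s.1 * t.2 - t.1 * s.2 = 0 ∨ I ≤ nrm (s.1 * t.2 - t.1 * s.2)) :
    Cnt S (4000 * (1 + X * Y / I) ^ 2) := by
  set h : ℝ := I / (6 * X ^ 2) with hh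
  have hhpos : 0 < h := by positivity
  set sl : GI × GI → ℂ := fun s => GaussianInt.toComplex s.2 / GaussianInt.toComplex s.1 with hsl
  have hnz : ∀ s ∈ S, s.1 ≠ 0 := by
    intro s hs h0
    have := (h1 s hs).1
    rw [h0, nrm_zero] at this
    linarith
  set ρ : ℝ := 2 * Y / X with hρ
  have hρ0 : 0 ≤ ρ := by positivity
  have hslb : ∀ s ∈ S, ‖sl s‖ ≤ ρ := by
    intro s hs
    obtain ⟨ha, hb, hc, _⟩ := h1 s hs
    rw [hsl]
    simp only [norm_div]
    change nrm s.2 / nrm s.1 ≤ ρ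
    rw [hρ]
    exact div_le_div₀ (by positivity) hc hX ha
  have hcell := cnt_int_Icc (ρ / h + 1) (by positivity)
  have hval : (2 * (ρ / h + 1) + 1) * (2 * (ρ / h + 1) + 1) * 4 ≤ 4000 * (1 + X * Y / I) ^ 2 := by
    have : ρ / h = 12 * (X * Y / I) := by rw [hρ, hh]; field_simp; ring
    rw [this]
    have h0 : 0 ≤ X * Y / I := by positivity
    nlinarith
  refine Cnt.le ?_ hval
  refine Cnt.fiber (f := fun s => (⌊(sl s).re / h⌋, ⌊(sl s).im / h⌋))
    ((cnt_prod hcell hcell).subset ?_) (by norm_num) ?_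
  · rintro _ ⟨s, hs, rfl⟩
    have hb := hslb s hs
    refine ⟨?_, ?_⟩
    · apply floor_abs_le
      rw [abs_div, abs_of_pos hhpos]
      gcongr
      exact (Complex.abs_re_le_norm _).trans hb
    · apply floor_abs_le
      rw [abs_div, abs_of_pos hhpos]
      gcongr
      exact (Complex.abs_im_le_norm _).trans hb
  · rintro _ ⟨s, hs, rfl⟩
    refine (cnt_units.image (fun e => (s.1 * e, s.2 * e))).subset ?_
    rintro t ⟨ht, hts⟩
    simp only [Prod.mk.injEq] at hts
    have hre := abs_sub_lt_of_floor hts.1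
    have him := abs_sub_lt_of_floor hts.2
    rw [← sub_div, abs_div, abs_of_pos hhpos, div_lt_one hhpos] at hre him
    have hdiff : ‖sl t - sl s‖ < 1.5 * h := by
      have hns : ‖sl t - sl s‖ ^ 2 < (1.5 * h) ^ 2 := by
        rw [← Complex.normSq_eq_norm_sq, Complex.normSq_apply]
        simp only [Complex.sub_re, Complex.sub_im]
        have := abs_lt.1 hre
        have := abs_lt.1 him
        nlinarith
      exact lt_of_pow_lt_pow_left₀ 2 (by positivity) hns
    have hs0 := hnz s hs
    have ht0 := hnz t ht
    have hdet : s.1 * t.2 - t.1 * s.2 = 0 := by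
      rcases h2 s hs t ht with h | hlarge
      · exact h
      exfalso
      have hsc : GaussianInt.toComplex s.1 ≠ 0 := by simpa using hs0
      have htc : GaussianInt.toComplex t.1 ≠ 0 := by simpa using ht0
      have heq : nrm (s.1 * t.2 - t.1 * s.2) = nrm s.1 * nrm t.1 * ‖sl t - sl s‖ := by
        simp only [nrm, hsl]
        rw [← norm_mul, ← norm_mul]
        congr 1
        simp only [map_sub, map_mul]
        field_simp
      rw [heq] at hlarge
      have hs2 := (h1 s hs).2.1
      have ht2 := (h1 t ht).2.1
      have hb : nrm s.1 * nrm t.1 ≤ (2 * X) * (2 * X) :=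
        mul_le_mul hs2 ht2 (nrm_nonneg _) (by positivity)
      have hb2 : nrm s.1 * nrm t.1 * ‖sl t - sl s‖ < (2 * X) * (2 * X) * (1.5 * h) := by
        have hp : 0 < nrm s.1 * nrm t.1 := mul_pos (nrm_pos hs0) (nrm_pos ht0)
        calc nrm s.1 * nrm t.1 * ‖sl t - sl s‖ < nrm s.1 * nrm t.1 * (1.5 * h) := by gcongr
          _ ≤ _ := by gcongr
      have : (2 * X) * (2 * X) * (1.5 * h) = I := by rw [hh]; field_simp; norm_num
      linarith
    have hc1 := (h1 s hs).2.2.2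
    have hc2 := (h1 t ht).2.2.2
    have heq : s.1 * t.2 = t.1 * s.2 := sub_eq_zero.1 hdet
    have d1 : s.1 ∣ t.1 := hc1.dvd_of_dvd_mul_right (Dvd.intro _ heq)
    have d2 : t.1 ∣ s.1 := hc2.dvd_of_dvd_mul_right (Dvd.intro _ heq.symm)
    obtain ⟨e, he⟩ := associated_of_dvd_dvd d1 d2
    refine ⟨e, e.isUnit, ?_⟩
    refine Prod.ext he ?_
    have : s.1 * t.2 = s.1 * (s.2 * e) := by rw [heq, ← he]; ring
    exact (mul_left_cancel₀ hs0 this).symm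

theorem slopesZ {S : Set (ℤ × ℤ)} {X Y I : ℝ} (hX : 0 < X) (hY : 0 ≤ Y) (hI : 0 < I)
    (h1 : ∀ s ∈ S, X ≤ |(s.1 : ℝ)| ∧ |(s.1 : ℝ)| ≤ 2 * X ∧ |(s.2 : ℝ)| ≤ 2 * Y ∧
      IsCoprime s.1 s.2)
    (h2 : ∀ s ∈ S, ∀ t ∈ S, s.1 * t.2 - t.1 * s.2 = 0 ∨
      I ≤ |((s.1 * t.2 - t.1 * s.2 : ℤ) : ℝ)|) :
    Cnt S (50 * (1 + X * Y / I)) := by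
  set h : ℝ := I / (6 * X ^ 2) with hh
  have hhpos : 0 < h := by positivity
  set sl : ℤ × ℤ → ℝ := fun s => (s.2 : ℝ) / (s.1 : ℝ) with hsl
  have hnz : ∀ s ∈ S, s.1 ≠ 0 := by
    intro s hs h0
    have := (h1 s hs).1
    rw [h0] at this
    simp at this
    linarith
  set ρ : ℝ := 2 * Y / X with hρ
  have hρ0 : 0 ≤ ρ := by positivity
  have hcell := cnt_int_Icc (ρ / h + 1) (by positivity)
  have hval : (2 * (ρ / h + 1) + 1) * 2 ≤ 50 * (1 + X * Y / I) := by
    have : ρ / h = 12 * (X * Y / I) := by rw [hρ, hh]; field_simp; ring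
    rw [this]
    have h0 : 0 ≤ X * Y / I := by positivity
    nlinarith
  refine Cnt.le ?_ hval
  refine Cnt.fiber (f := fun s => ⌊(sl s) / h⌋) (hcell.subset ?_) (by norm_num) ?_
  · rintro _ ⟨s, hs, rfl⟩
    obtain ⟨ha, hb, hc, _⟩ := h1 s hs
    apply floor_abs_le
    rw [abs_div, abs_of_pos hhpos]
    gcongr
    rw [hsl]
    simp only [abs_div]
    rw [hρ]
    exact div_le_div₀ (by positivity) hc hX ha
  · rintro _ ⟨s, hs, rfl⟩
    have hu : Cnt ((({1, -1} : Finset ℤ)) : Set ℤ) 2 := by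
      refine ⟨Finset.finite_toSet _, ?_⟩
      rw [Set.ncard_coe_finset]
      exact_mod_cast Finset.card_le_two
    refine (hu.image (fun e => (s.1 * e, s.2 * e))).subset ?_
    rintro t ⟨ht, hts⟩
    have hre := abs_sub_lt_of_floor hts
    rw [← sub_div, abs_div, abs_of_pos hhpos, div_lt_one hhpos] at hre
    have hs0 := hnz s hs
    have ht0 := hnz t ht
    have hdet : s.1 * t.2 - t.1 * s.2 = 0 := by
      rcases h2 s hs t ht with h | hlarge
      · exact h
      exfalso
      have hsc : (s.1 : ℝ) ≠ 0 := by exact_mod_cast hs0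
      have htc : (t.1 : ℝ) ≠ 0 := by exact_mod_cast ht0
      have heq : |((s.1 * t.2 - t.1 * s.2 : ℤ) : ℝ)| =
          |(s.1 : ℝ)| * |(t.1 : ℝ)| * |sl t - sl s| := by
        simp only [hsl]
        rw [← abs_mul, ← abs_mul]
        congr 1
        push_cast
        field_simp
      rw [heq] at hlarge
      have hs2 := (h1 s hs).2.1
      have ht2 := (h1 t ht).2.1
      have hb : |(s.1 : ℝ)| * |(t.1 : ℝ)| ≤ (2 * X) * (2 * X) :=
        mul_le_mul hs2 ht2 (abs_nonneg _) (by positivity)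
      have hb2 : |(s.1 : ℝ)| * |(t.1 : ℝ)| * |sl t - sl s| < (2 * X) * (2 * X) * (1.5 * h) := by
        have hp : 0 < |(s.1 : ℝ)| * |(t.1 : ℝ)| := mul_pos (abs_pos.2 hsc) (abs_pos.2 htc)
        calc |(s.1 : ℝ)| * |(t.1 : ℝ)| * |sl t - sl s|
            < |(s.1 : ℝ)| * |(t.1 : ℝ)| * (1.5 * h) := by gcongr; linarith
          _ ≤ _ := by gcongr
      have : (2 * X) * (2 * X) * (1.5 * h) = I := by rw [hh]; field_simp; norm_num
      linarith
    have hc1 := (h1 s hs).2.2.2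
    have hc2 := (h1 t ht).2.2.2
    have heq : s.1 * t.2 = t.1 * s.2 := sub_eq_zero.1 hdet
    have d1 : s.1 ∣ t.1 := hc1.dvd_of_dvd_mul_right (Dvd.intro _ heq)
    have d2 : t.1 ∣ s.1 := hc2.dvd_of_dvd_mul_right (Dvd.intro _ heq.symm)
    obtain ⟨e, he⟩ := associated_of_dvd_dvd d1 d2
    refine ⟨e, ?_, ?_⟩
    · rcases Int.units_eq_one_or e with h | h <;> simp [h]
    refine Prod.ext he ?_
    have : s.1 * t.2 = s.1 * (s.2 * e) := by rw [heq, ← he]; ring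
    exact (mul_left_cancel₀ hs0 this).symm

/-! ### Content and primitive part -/

/-- content of a Gaussian integer -/
def cont (z : GI) : ℤ := (Int.gcd z.re z.im : ℤ)

/-- primitive part of a Gaussian integer -/
def prim (z : GI) : GI := ⟨z.re / cont z, z.im / cont z⟩

theorem cont_mul_prim (z : GI) : (cont z : GI) * prim z = z := by
  have h1 : cont z ∣ z.re := Int.gcd_dvd_left ..
  have h2 : cont z ∣ z.im := Int.gcd_dvd_right ..
  apply Zsqrtd.ext
  · simp [prim, Int.mul_ediv_cancel' h1]
  · simp [prim, Int.mul_ediv_cancel' h2]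

theorem cont_nonneg (z : GI) : 0 ≤ cont z := by simp [cont]

theorem cont_pos {z : GI} (hz : z ≠ 0) : 0 < cont z := by
  rcases (cont_nonneg z).lt_or_eq with h | h
  · exact h
  · exfalso; apply hz; rw [← cont_mul_prim z, ← h]; simp

theorem cont_neg (z : GI) : cont (-z) = cont z := by simp [cont]

theorem cont_star (z : GI) : cont (star z) = cont z := by simp [cont]

theorem prim_neg (z : GI) (hz : z ≠ 0) : prim (-z) = - prim z := by
  have h := cont_mul_prim z
  have h' := cont_mul_prim (-z)
  rw [cont_neg] at h'
  have hc : ((cont z : ℤ) : GI) ≠ 0 := by exact_mod_cast (cont_pos hz).ne'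
  apply mul_left_cancel₀ hc
  rw [h', mul_neg, h]

theorem prim_ne_zero {z : GI} (hz : z ≠ 0) : prim z ≠ 0 := by
  intro h; apply hz; rw [← cont_mul_prim z, h, mul_zero]

theorem prim_coprime {z : GI} (hz : z ≠ 0) : IsCoprime (prim z).re (prim z).im := by
  rw [Int.isCoprime_iff_gcd_eq_one]
  have hz' : 0 < Int.gcd z.re z.im := by
    have := cont_pos hz
    unfold cont at this
    exact_mod_cast this
  exact Int.gcd_div_gcd_div_gcd hz'

theorem cont_mul_int (n : ℤ) (z : GI) : cont ((n : GI) * z) = |n| * cont z := by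
  simp [cont, Int.gcd_mul_left]

theorem cont_eq_one_of_coprime {z : GI} (h : IsCoprime z.re z.im) : cont z = 1 := by
  rw [Int.isCoprime_iff_gcd_eq_one] at h
  simp [cont, h]

theorem cont_prim {z : GI} (hz : z ≠ 0) : cont (prim z) = 1 :=
  cont_eq_one_of_coprime (prim_coprime hz)

theorem nrm_cont_prim (z : GI) : nrm z = (cont z : ℝ) * nrm (prim z) := by
  conv_lhs => rw [← cont_mul_prim z]
  rw [nrm_mul, nrm_int, abs_of_nonneg]
  exact_mod_cast cont_nonneg z

theorem one_le_cont {z : GI} (hz : z ≠ 0) : (1 : ℝ) ≤ cont z := by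
  exact_mod_cast cont_pos hz

theorem cont_le_nrm (z : GI) (hz : z ≠ 0) : (cont z : ℝ) ≤ nrm z := by
  rw [nrm_cont_prim]
  have h1 := one_le_nrm (prim_ne_zero hz)
  have h2 := one_le_cont hz
  nlinarith

theorem nrm_prim_le (z : GI) (hz : z ≠ 0) : nrm (prim z) ≤ nrm z := by
  rw [nrm_cont_prim z]
  have h1 := one_le_nrm (prim_ne_zero hz)
  have h2 := one_le_cont hz
  nlinarith

theorem mul_star_eq (w : GI) : w * star w = ((w.norm : ℤ) : GI) := by
  rw [Zsqrtd.norm_eq_mul_conj]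

/-- If a Gaussian integer divides a rational integer, so does content times norm of
its primitive part. -/
theorem cont_norm_dvd {f : GI} (hf : f ≠ 0) {n : ℤ} (h : f ∣ (n : GI)) :
    cont f * (prim f).norm ∣ n := by
  obtain ⟨z, hz⟩ := h
  have h1 : (n : GI) * star (prim f) = ((cont f * (prim f).norm : ℤ) : GI) * z := by
    rw [hz]
    conv_lhs => rw [← cont_mul_prim f]
    push_cast
    rw [← mul_star_eq]
    have hc : prim ((cont f : GI) * prim f) = prim f := by rw [cont_mul_prim]
    rw [hc]; ring
  set m := cont f * (prim f).norm with hm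
  have hre : m ∣ n * (prim f).re := by
    have := congrArg Zsqrtd.re h1
    simp at this
    exact ⟨z.re, this⟩
  have him : m ∣ n * (prim f).im := by
    have := congrArg Zsqrtd.im h1
    simp at this
    refine ⟨-z.im, by linarith⟩
  obtain ⟨a, b, hab⟩ := prim_coprime hf
  have : n = a * (n * (prim f).re) + b * (n * (prim f).im) := by
    calc n = n * (a * (prim f).re + b * (prim f).im) := by rw [hab, mul_one]
      _ = _ := by ring
  rw [this]
  exact dvd_add (hre.mul_left _) (him.mul_left _)

end ACQ


namespace ACQ

/-! ### Configurations and their parametrization -/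

/-- four distinct labels -/
def Q4 (i j k l : Fin 4) : Prop := i ≠ j ∧ i ≠ k ∧ i ≠ l ∧ j ≠ k ∧ j ≠ l ∧ k ≠ l

theorem Q4.s1 {i j k l : Fin 4} (h : Q4 i j k l) : Q4 j i k l := by unfold Q4 at *; tauto
theorem Q4.s2 {i j k l : Fin 4} (h : Q4 i j k l) : Q4 i k j l := by unfold Q4 at *; tauto
theorem Q4.s3 {i j k l : Fin 4} (h : Q4 i j k l) : Q4 i j l k := by unfold Q4 at *; tauto

theorem Q4.cases {i j k l : Fin 4} (h : Q4 i j k l) (x : Fin 4) :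
    x = i ∨ x = j ∨ x = k ∨ x = l := by
  revert h; unfold Q4; revert i j k l x; decide

theorem exists_Q4 (i : Fin 4) : ∃ j k l, Q4 i j k l := by unfold Q4; revert i; decide

theorem exists_Q4' (i j : Fin 4) (h : i ≠ j) : ∃ k l, Q4 i j k l := by
  revert h; unfold Q4; revert i j; decide

/-- difference functions of non-degenerate asymmetric concyclic quadruples -/
structure Good (D : Fin 4 → Fin 4 → GI) : Prop where
  coc : ∀ i j k, D i j + D j k + D k i = 0
  ne : ∀ i j, i ≠ j → D i j ≠ 0
  cross : ∀ i j k l, Q4 i j k l → (D i j * D k l * star (D i k * D l j)).im = 0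
  ncol : ∀ i j k l, Q4 i j k l → (D i j * star (D j k)).im ≠ 0
  asym : ∀ i j k l, Q4 i j k l → (D i j).norm ≠ (D k l).norm

theorem coc_self {D : Fin 4 → Fin 4 → GI} (hD : ∀ i j k, D i j + D j k + D k i = 0) (i : Fin 4) :
    D i i = 0 := by
  have h := hD i i i
  have h2 : (3 : GI) * D i i = 0 := by linear_combination h
  have h3 : (3 : GI) ≠ 0 := by decide
  exact (mul_eq_zero.1 h2).resolve_left h3

theorem coc_anti {D : Fin 4 → Fin 4 → GI} (hD : ∀ i j k, D i j + D j k + D k i = 0)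
    (i j : Fin 4) : D j i = - D i j := by
  have h := hD i j i
  rw [coc_self hD i] at h
  linear_combination h

theorem coc_add {D : Fin 4 → Fin 4 → GI} (hD : ∀ i j k, D i j + D j k + D k i = 0)
    (i j k : Fin 4) : D i k = D i j + D j k := by
  have h := hD i j k
  rw [coc_anti hD i k] at h
  linear_combination -h

@[ext]
structure Par where
  κ : Fin 4 → GI
  F : Fin 4 → Fin 4 → GI

structure Valid (p : Par) : Prop where
  anti : ∀ k l, p.F l k = - p.F k l
  tri : ∀ i j k l, Q4 i j k l → p.κ l * p.F j k + p.κ j * p.F k l + p.κ k * p.F l j = 0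
  κne : ∀ i, p.κ i ≠ 0
  Fne : ∀ k l, k ≠ l → p.F k l ≠ 0
  cop : ∀ i j k l, Q4 i j k l → IsCoprime (p.κ l * p.F j k) (p.κ j * p.F k l)
  conj : ∀ i j k l, Q4 i j k l → ∃ e, IsUnit e ∧ prim (p.F k l) = e * star (prim (p.F i j))
  pto : ∀ i j k l, Q4 i j k l →
    p.F i j * p.F k l + p.F i k * p.F l j + p.F i l * p.F j k = 0
  ncol : ∀ i j k l, Q4 i j k l → (p.κ l * p.F j k * star (p.κ j * p.F k l)).im ≠ 0
  asym : ∀ i j k l, Q4 i j k l →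
    (p.κ i * p.κ j * p.F k l).norm ≠ (p.κ k * p.κ l * p.F i j).norm
  cross : ∀ i j k l, Q4 i j k l → (p.F i j * p.F k l * star (p.F i k * p.F l j)).im = 0

theorem star_ne_zero' {z : GI} (hz : z ≠ 0) : star z ≠ 0 := by
  intro h; apply hz; rw [← star_star z, h, star_zero]

theorem im_zero_iff {z : GI} : z.im = 0 ↔ star z = z := by
  constructor
  · intro h; apply Zsqrtd.ext <;> simp [h]
  · intro h
    have := congrArg Zsqrtd.im h
    simp at this; omega

theorem im_zero_cancel {n : ℤ} (hn : n ≠ 0) {z : GI} (h : ((n : GI) * z).im = 0) : z.im = 0 := by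
  simp at h
  tauto

theorem im_int_mul (n : ℤ) (z : GI) : ((n : GI) * z).im = n * z.im := by simp

theorem isCoprime_symm_of_sum {a b c : GI} (h : a + b + c = 0) (hab : IsCoprime a b) :
    IsCoprime b c := by
  obtain ⟨x, y, hxy⟩ := hab
  refine ⟨y - x, -x, ?_⟩
  linear_combination hxy - x * h

/-- two coprime Gaussian integers with real ratio are real or both imaginary -/
theorem star_eq_of_coprime {α β : GI} (h : IsCoprime α β) (him : (α * star β).im = 0)
    (hα : α ≠ 0) (hβ : β ≠ 0) : star α = α ∨ star α = - α := by
  have h1 : star (α * star β) = α * star β := im_zero_iff.1 him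
  rw [star_mul, star_star] at h1
  -- β * star α = α * star β
  have hd : α ∣ star α := by
    have : α ∣ β * star α := Dvd.intro _ h1.symm
    exact h.dvd_of_dvd_mul_left this
  obtain ⟨e, he⟩ := hd
  have hn : e.norm = 1 := by
    have h2 : (star α).norm = (α * e).norm := by rw [he]
    rw [Zsqrtd.norm_conj, Zsqrtd.norm_mul] at h2
    have h3 : α.norm ≠ 0 := (GaussianInt.norm_pos.2 hα).ne'
    have : α.norm * e.norm = α.norm * 1 := by rw [← h2, mul_one]
    exact mul_left_cancel₀ h3 this
  have hβe : star β = β * e := by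
    have : α * star β = α * (β * e) := by rw [← h1, he]; ring
    exact mul_left_cancel₀ hα this
  have key : ∀ z : GI, (star z = z * ⟨0, 1⟩ ∨ star z = z * ⟨0, -1⟩) → (⟨1, 1⟩ : GI) ∣ z := by
    intro z hz
    have h4 : z.re = z.im ∨ z.re = - z.im := by
      rcases hz with hz | hz
      · right
        have := congrArg Zsqrtd.re hz
        simpa using this
      · left
        have := congrArg Zsqrtd.re hz
        simpa using this
    rcases h4 with h4 | h4
    · refine ⟨⟨z.im, 0⟩, ?_⟩
      apply Zsqrtd.ext <;> simp [h4]
    · refine ⟨⟨0, z.im⟩, ?_⟩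
      apply Zsqrtd.ext <;> simp [h4]
  have hnu : ¬ IsUnit (⟨1, 1⟩ : GI) := by
    rw [isUnit_iff_norm, norm_eq]; simp
  rcases isUnit_cases (isUnit_iff_norm.2 hn) with h5 | h5 | h5 | h5
  · left; rw [he, h5, mul_one]
  · right; rw [he, h5]; ring
  · exfalso
    exact hnu (h.isUnit_of_dvd' (key α (Or.inl (by rw [he, h5]))) (key β (Or.inl (by rw [hβe, h5]))))
  · exfalso
    exact hnu (h.isUnit_of_dvd' (key α (Or.inr (by rw [he, h5]))) (key β (Or.inr (by rw [hβe, h5]))))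

theorem cont_unit_mul {e : GI} (he : IsUnit e) (z : GI) : cont (e * z) = cont z := by
  rcases isUnit_cases he with h | h | h | h <;> subst h
  · simp
  · simp [cont]
  · simp [cont, Int.gcd_comm]
  · simp [cont, Int.gcd_comm]

/-- if `w₁ w₂` is real or imaginary for primitive `w₁,w₂`, then `w₂ ~ conj w₁` -/
theorem prim_conj {w₁ w₂ : GI} (h1 : cont w₁ = 1) (h2 : cont w₂ = 1) (hw₁ : w₁ ≠ 0)
    (h : star (w₁ * w₂) = w₁ * w₂ ∨ star (w₁ * w₂) = -(w₁ * w₂)) :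
    ∃ e, IsUnit e ∧ w₂ = e * star w₁ := by
  obtain ⟨e, m, he, hm⟩ : ∃ (e : GI) (m : ℤ), IsUnit e ∧ w₁ * w₂ = (m : GI) * e := by
    rcases h with h | h
    · refine ⟨1, (w₁ * w₂).re, isUnit_one, ?_⟩
      have := im_zero_iff.2 h
      apply Zsqrtd.ext
      · simp
      · rw [this]; simp
    · refine ⟨⟨0, 1⟩, (w₁ * w₂).im, ?_, ?_⟩
      · rw [isUnit_iff_norm, norm_eq]; simp
      · have h3 := congrArg Zsqrtd.re h
        have h4 : (w₁ * w₂).re = 0 := by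
          rw [Zsqrtd.re_star, Zsqrtd.re_neg] at h3
          omega
        apply Zsqrtd.ext
        · rw [h4]; simp
        · simp
  have h3 : ((w₁.norm : ℤ) : GI) * w₂ = (m : GI) * (e * star w₁) := by
    rw [← mul_star_eq]
    linear_combination (star w₁) * hm
  have h4 := congrArg cont h3
  rw [cont_mul_int, cont_mul_int, cont_unit_mul he, cont_star, h1, h2, mul_one, mul_one] at h4
  have hn : 0 < w₁.norm := GaussianInt.norm_pos.2 hw₁
  have hn0 : ((w₁.norm : ℤ) : GI) ≠ 0 := by exact_mod_cast hn.ne'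
  rw [abs_of_pos hn] at h4
  rcases abs_choice m with h5 | h5
  · refine ⟨e, he, mul_left_cancel₀ hn0 ?_⟩
    rw [h3, h4, h5]
  · refine ⟨-e, he.neg, mul_left_cancel₀ hn0 ?_⟩
    rw [h3, h4, h5]
    push_cast; ring

theorem exists_par {D : Fin 4 → Fin 4 → GI} (hD : Good D)
    (hprim : ∀ g : GI, (∀ i j, g ∣ D i j) → IsUnit g) :
    ∃ p : Par, Valid p ∧ ∀ i j k l, Q4 i j k l → D k l = p.κ i * p.κ j * p.F k l := by
  have hself := coc_self hD.coc
  have hanti := coc_anti hD.coc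
  have hadd := coc_add hD.coc
  have H : ∀ i j k l, Q4 i j k l → ∀ d, d ∣ D j k → d ∣ D k l →
      ∀ a b, a ≠ i → b ≠ i → d ∣ D a b := by
    intro i j k l hq d h1 h2
    have hk : ∀ a, a ≠ i → d ∣ D k a := by
      intro a ha
      rcases hq.cases a with h | h | h | h
      · exact absurd h ha
      · rw [h, hanti]; exact h1.neg_right
      · rw [h, hself]; exact dvd_zero _
      · rw [h]; exact h2
    intro a b ha hb
    rw [hadd a k b, hanti k a]
    exact dvd_add (hk a ha).neg_right (hk b hb)
  have hκ : ∀ i, ∃ g : GI, g ≠ 0 ∧ (∀ a b, a ≠ i → b ≠ i → g ∣ D a b) ∧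
      (∀ j k l, Q4 i j k l → ∀ d, d ∣ D j k → d ∣ D k l → d ∣ g) := by
    intro i
    obtain ⟨j, k, l, hq⟩ := exists_Q4 i
    have hjk : D j k ≠ 0 := hD.ne j k hq.2.2.2.1
    refine ⟨EuclideanDomain.gcd (D j k) (D k l), ?_, ?_, ?_⟩
    · intro h0
      rw [EuclideanDomain.gcd_eq_zero_iff] at h0
      exact hjk h0.1
    · exact H i j k l hq _ (EuclideanDomain.gcd_dvd_left _ _) (EuclideanDomain.gcd_dvd_right _ _)
    · intro j' k' l' hq' d h1 h2
      have := H i j' k' l' hq' d h1 h2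
      exact EuclideanDomain.dvd_gcd (this j k hq.1.symm hq.2.1.symm)
        (this k l hq.2.1.symm hq.2.2.1.symm)
  choose κ hκ0 hκd hκm using hκ
  have hκc : ∀ i j, i ≠ j → IsCoprime (κ i) (κ j) := by
    intro i j hij
    rw [← EuclideanDomain.gcd_isUnit_iff]
    apply hprim
    set g := EuclideanDomain.gcd (κ i) (κ j) with hg
    have h1 : g ∣ κ i := EuclideanDomain.gcd_dvd_left _ _
    have h2 : g ∣ κ j := EuclideanDomain.gcd_dvd_right _ _
    have h3 : ∀ a b, a ≠ i → b ≠ i → g ∣ D a b := fun a b ha hb => h1.trans (hκd i a b ha hb)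
    have h4 : ∀ a b, a ≠ j → b ≠ j → g ∣ D a b := fun a b ha hb => h2.trans (hκd j a b ha hb)
    obtain ⟨k, l, hq⟩ := exists_Q4' i j hij
    have hk : ∀ a, g ∣ D k a := by
      intro a
      by_cases ha : a = i
      · exact h4 k a hq.2.2.2.1.symm (by rw [ha]; exact hij)
      · exact h3 k a hq.2.1.symm ha
    intro a b
    rw [hadd a k b, hanti k a]
    exact dvd_add (hk a).neg_right (hk b)
  have hF : ∀ k l, ∃ f : GI, (∀ i j, Q4 i j k l → D k l = κ i * κ j * f) ∧ (k = l → f = 0) := by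
    intro k l
    by_cases hkl : k = l
    · exact ⟨0, fun i j hq => absurd hkl hq.2.2.2.2.2, fun _ => rfl⟩
    · obtain ⟨i, j, hq⟩ := exists_Q4' k l hkl
      have hd : κ i * κ j ∣ D k l :=
        (hκc i j hq.2.2.2.2.2).mul_dvd (hκd i k l hq.2.1 hq.2.2.2.1)
          (hκd j k l hq.2.2.1 hq.2.2.2.2.1)
      obtain ⟨f, hf⟩ := hd
      refine ⟨f, ?_, fun h => absurd h hkl⟩
      intro i' j' hq'
      have : (i' = i ∧ j' = j) ∨ (i' = j ∧ j' = i) := by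
        have a1 := hq.cases i'
        have a2 := hq.cases j'
        unfold Q4 at hq'
        grind
      rcases this with ⟨rfl, rfl⟩ | ⟨rfl, rfl⟩
      · exact hf
      · rw [hf]; ring
  choose F hFD hF0 using hF
  have hFne : ∀ k l, k ≠ l → F k l ≠ 0 := by
    intro k l hkl h0
    obtain ⟨i, j, hq⟩ := exists_Q4' k l hkl
    apply hD.ne k l hkl
    rw [hFD k l i j (by unfold Q4 at *; tauto), h0, mul_zero]
  have htri : ∀ i j k l, Q4 i j k l → κ l * F j k + κ j * F k l + κ k * F l j = 0 := by
    intro i j k l hq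
    have h := hD.coc j k l
    rw [hFD j k i l (by unfold Q4 at *; tauto), hFD k l i j hq,
      hFD l j i k (by unfold Q4 at *; tauto)] at h
    apply mul_left_cancel₀ (hκ0 i)
    linear_combination h
  have hcop : ∀ i j k l, Q4 i j k l → IsCoprime (κ l * F j k) (κ j * F k l) := by
    intro i j k l hq
    rw [← EuclideanDomain.gcd_isUnit_iff]
    set g := EuclideanDomain.gcd (κ l * F j k) (κ j * F k l) with hg
    have h1 : κ i * g ∣ D j k := by
      rw [hFD j k i l (by unfold Q4 at *; tauto), mul_assoc]
      exact mul_dvd_mul_left _ (EuclideanDomain.gcd_dvd_left _ _)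
    have h2 : κ i * g ∣ D k l := by
      rw [hFD k l i j hq, mul_assoc]
      exact mul_dvd_mul_left _ (EuclideanDomain.gcd_dvd_right _ _)
    have h3 : κ i * g ∣ κ i * 1 := by rw [mul_one]; exact hκm i j k l hq _ h1 h2
    exact isUnit_of_dvd_one ((mul_dvd_mul_iff_left (hκ0 i)).1 h3)
  have hpto : ∀ i j k l, Q4 i j k l → F i j * F k l + F i k * F l j + F i l * F j k = 0 := by
    intro i j k l hq
    have e1 := hFD i j k l (by unfold Q4 at *; tauto)
    have e2 := hFD k l i j hq
    have e3 := hFD i k j l (by unfold Q4 at *; tauto)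
    have e4 := hFD l j i k (by unfold Q4 at *; tauto)
    have e5 := hFD i l j k (by unfold Q4 at *; tauto)
    have e6 := hFD j k i l (by unfold Q4 at *; tauto)
    have hid : D i j * D k l + D i k * D l j + D i l * D j k = 0 := by
      have a1 := hadd i j k
      have a2 := hadd j k l
      have a3 := hadd i j l
      have a4 := hanti j l
      rw [a4, a1, a3, a2]; ring
    have hP : κ i * κ j * κ k * κ l ≠ 0 :=
      mul_ne_zero (mul_ne_zero (mul_ne_zero (hκ0 i) (hκ0 j)) (hκ0 k)) (hκ0 l)
    apply mul_left_cancel₀ hP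
    rw [mul_zero, ← hid, e1, e2, e3, e4, e5, e6]
    ring
  have hcross : ∀ i j k l, Q4 i j k l → (F i j * F k l * star (F i k * F l j)).im = 0 := by
    intro i j k l hq
    have e1 := hFD i j k l (by unfold Q4 at *; tauto)
    have e2 := hFD k l i j hq
    have e3 := hFD i k j l (by unfold Q4 at *; tauto)
    have e4 := hFD l j i k (by unfold Q4 at *; tauto)
    have h := hD.cross i j k l hq
    have hP : κ i * κ j * κ k * κ l ≠ 0 :=
      mul_ne_zero (mul_ne_zero (mul_ne_zero (hκ0 i) (hκ0 j)) (hκ0 k)) (hκ0 l)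
    have heq : D i j * D k l * star (D i k * D l j) =
        (((κ i * κ j * κ k * κ l).norm : ℤ) : GI) * (F i j * F k l * star (F i k * F l j)) := by
      rw [← mul_star_eq, e1, e2, e3, e4]
      simp only [star_mul]
      ring
    rw [heq] at h
    exact im_zero_cancel (GaussianInt.norm_pos.2 hP).ne' h
  have hFanti : ∀ k l, F l k = - F k l := by
    intro k l
    by_cases hkl : k = l
    · rw [hF0 l k hkl.symm, hF0 k l hkl, neg_zero]
    · obtain ⟨i, j, hq⟩ := exists_Q4' k l hkl
      have e1 := hFD k l i j (by unfold Q4 at *; tauto)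
      have e2 := hFD l k i j (by unfold Q4 at *; tauto)
      apply mul_left_cancel₀ (mul_ne_zero (hκ0 i) (hκ0 j))
      rw [← e2, hanti, e1]; ring
  have hadj : ∀ i j k l, Q4 i j k l → IsCoprime (F j k) (F k l) := by
    intro i j k l hq
    exact (hcop i j k l hq).of_mul_left_right.of_mul_right_right
  refine ⟨⟨κ, F⟩, ⟨hFanti, htri, hκ0, hFne, hcop, ?_, hpto, ?_, ?_, hcross⟩, ?_⟩
  · intro i j k l hq
    have hij : F i j ≠ 0 := hFne i j hq.1
    have hkl : F k l ≠ 0 := hFne k l hq.2.2.2.2.2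
    have hik : F i k ≠ 0 := hFne i k hq.2.1
    have hlj : F l j ≠ 0 := hFne l j hq.2.2.2.2.1.symm
    have c1 : IsCoprime (F i j) (F i k) := by
      have := hadj l j i k (by unfold Q4 at *; tauto)
      rw [hFanti i j] at this
      exact (IsCoprime.neg_left_iff _ _).1 this
    have c2 : IsCoprime (F i j) (F l j) := by
      have := hadj k i j l (by unfold Q4 at *; tauto)
      rw [hFanti l j] at this
      exact (IsCoprime.neg_right_iff _ _).1 this
    have c3 : IsCoprime (F k l) (F i k) := (hadj j i k l (by unfold Q4 at *; tauto)).symm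
    have c4 : IsCoprime (F k l) (F l j) := hadj i k l j (by unfold Q4 at *; tauto)
    have hc : IsCoprime (F i j * F k l) (F i k * F l j) :=
      IsCoprime.mul_left (IsCoprime.mul_right c1 c2) (IsCoprime.mul_right c3 c4)
    have hs := star_eq_of_coprime hc (hcross i j k l hq) (mul_ne_zero hij hkl)
      (mul_ne_zero hik hlj)
    have hn : ((cont (F i j) * cont (F k l) : ℤ) : GI) ≠ 0 := by
      have := mul_pos (cont_pos hij) (cont_pos hkl)
      exact_mod_cast this.ne'
    have hα : F i j * F k l = ((cont (F i j) * cont (F k l) : ℤ) : GI) *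
        (prim (F i j) * prim (F k l)) := by
      conv_lhs => rw [← cont_mul_prim (F i j), ← cont_mul_prim (F k l)]
      push_cast; ring
    apply prim_conj (cont_prim hij) (cont_prim hkl) (prim_ne_zero hij)
    rw [hα, star_mul] at hs
    have hsi : ∀ n : ℤ, star (n : GI) = (n : GI) := by
      intro n; apply Zsqrtd.ext <;> simp
    rw [hsi, mul_comm (star _)] at hs
    rcases hs with hs | hs
    · left; exact mul_left_cancel₀ hn hs
    · right
      rw [← mul_neg] at hs
      exact mul_left_cancel₀ hn hs
  · intro i j k l hq h0
    have := hD.ncol j k l i (by unfold Q4 at *; tauto)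
    apply this
    rw [hFD j k i l (by unfold Q4 at *; tauto), hFD k l i j hq]
    have : κ i * κ l * F j k * star (κ i * κ j * F k l) =
        (((κ i).norm : ℤ) : GI) * (κ l * F j k * star (κ j * F k l)) := by
      rw [← mul_star_eq]; simp only [star_mul]; ring
    rw [this, im_int_mul]
    have h0' : (κ l * F j k * star (κ j * F k l)).im = 0 := h0
    rw [h0', mul_zero]
  · intro i j k l hq
    have := hD.asym k l i j (by unfold Q4 at *; tauto)
    rw [hFD k l i j hq, hFD i j k l (by unfold Q4 at *; tauto)] at this
    exact this
  · intro i j k l hq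
    exact hFD k l i j hq

end ACQ


namespace ACQ

/-! ### Boxes -/

/-- dyadic sizes of a box -/
structure Bx (A : Fin 4 → ℝ) (U W : Fin 4 → Fin 4 → ℝ) : Prop where
  A1 : ∀ i, 1 ≤ A i
  U1 : ∀ k l, 1 ≤ U k l
  W1 : ∀ k l, 1 ≤ W k l

structure InBox (A : Fin 4 → ℝ) (U W : Fin 4 → Fin 4 → ℝ) (P : Par) : Prop where
  κ1 : ∀ i, A i ≤ nrm (P.κ i)
  κ2 : ∀ i, nrm (P.κ i) ≤ 2 * A i
  u1 : ∀ k l, k ≠ l → U k l ≤ cont (P.F k l)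
  u2 : ∀ k l, k ≠ l → (cont (P.F k l) : ℝ) ≤ 2 * U k l
  w1 : ∀ k l, k ≠ l → W k l ≤ nrm (prim (P.F k l))
  w2 : ∀ k l, k ≠ l → nrm (prim (P.F k l)) ≤ 2 * W k l

def Cls (A : Fin 4 → ℝ) (U W : Fin 4 → Fin 4 → ℝ) (S : Set Par) : Prop :=
  ∀ P ∈ S, Valid P ∧ InBox A U W P

theorem Cls.sub {A : Fin 4 → ℝ} {U W : Fin 4 → Fin 4 → ℝ} {S T : Set Par} (h : Cls A U W T)
    (hs : S ⊆ T) : Cls A U W S := fun P hP => h P (hs hP)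

theorem cnt_disc2 {a : ℝ} (ha : 1 ≤ a) : Cnt {z : GI | nrm z ≤ 2 * a} (36 * a ^ 2) :=
  (cnt_disc (2 * a) (by linarith)).le (by nlinarith)

theorem cnt_int2 {a : ℝ} (ha : 1 ≤ a) : Cnt {n : ℤ | |(n : ℝ)| ≤ 2 * a} (5 * a) :=
  (cnt_int_Icc (2 * a) (by linarith)).le (by linarith)

theorem int_mem {P : Par} {A : Fin 4 → ℝ} {U W : Fin 4 → Fin 4 → ℝ} (h : InBox A U W P)
    {k l : Fin 4} (hkl : k ≠ l) : cont (P.F k l) ∈ {n : ℤ | |(n : ℝ)| ≤ 2 * U k l} := by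
  have h1 : (0 : ℝ) ≤ cont (P.F k l) := by exact_mod_cast cont_nonneg _
  change |((cont (P.F k l) : ℤ) : ℝ)| ≤ 2 * U k l
  rw [abs_of_nonneg h1]
  exact h.u2 k l hkl

theorem isCoprime_int {m n : ℤ} (h : IsCoprime (m : GI) (n : GI)) : IsCoprime m n := by
  obtain ⟨a, b, hab⟩ := h
  refine ⟨a.re, b.re, ?_⟩
  have := congrArg Zsqrtd.re hab
  simpa using this

theorem cont_dvd (z : GI) : (cont z : GI) ∣ z := ⟨prim z, (cont_mul_prim z).symm⟩
theorem prim_dvd (z : GI) : prim z ∣ z := ⟨cont z, by rw [mul_comm, cont_mul_prim]⟩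

theorem cont_coprime {a b : GI} (h : IsCoprime a b) : IsCoprime (cont a) (cont b) :=
  isCoprime_int ((h.of_isCoprime_of_dvd_left (cont_dvd a)).of_isCoprime_of_dvd_right (cont_dvd b))

theorem eq_of_cont_prim {a b : GI} (h1 : cont a = cont b) (h2 : prim a = prim b) : a = b := by
  rw [← cont_mul_prim a, ← cont_mul_prim b, h1, h2]

namespace Valid
variable {P : Par}

theorem diag (h : Valid P) (k : Fin 4) : P.F k k = 0 := by
  have h1 := h.anti k k
  have h2 : (2 : GI) * P.F k k = 0 := by linear_combination h1
  have h3 : (2 : GI) ≠ 0 := by decide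
  exact (mul_eq_zero.1 h2).resolve_left h3

theorem adj (h : Valid P) {i j k l : Fin 4} (hq : Q4 i j k l) :
    IsCoprime (P.F j k) (P.F k l) :=
  (h.cop i j k l hq).of_mul_left_right.of_mul_right_right

theorem adj' (h : Valid P) {i j k l : Fin 4} (hq : Q4 i j k l) :
    IsCoprime (P.F k j) (P.F k l) := by
  rw [h.anti j k]; exact (IsCoprime.neg_left_iff _ _).2 (h.adj hq)

theorem copκ (h : Valid P) {i j k l : Fin 4} (hq : Q4 i j k l) :
    IsCoprime (P.κ l) (P.κ j) :=
  (h.cop i j k l hq).of_mul_left_left.of_mul_right_left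
end Valid

theorem par_ext {P P' : Par} (h : Valid P) (h' : Valid P') {o i j k : Fin 4} (hq : Q4 o i j k)
    (ho : P.κ o = P'.κ o) (hi : P.κ i = P'.κ i) (hj : P.κ j = P'.κ j) (hk : P.κ k = P'.κ k)
    (hoi : P.F o i = P'.F o i) (hoj : P.F o j = P'.F o j) (hok : P.F o k = P'.F o k)
    (hij : P.F i j = P'.F i j) (hjk : P.F j k = P'.F j k) (hki : P.F k i = P'.F k i) :
    P = P' := by
  apply Par.ext
  · funext x
    rcases hq.cases x with h | h | h | h <;> rw [h] <;> assumption
  · funext x y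
    have d := h.diag
    have d' := h'.diag
    have a := h.anti
    have a' := h'.anti
    have hio : P.F i o = P'.F i o := by rw [a, a', hoi]
    have hjo : P.F j o = P'.F j o := by rw [a, a', hoj]
    have hko : P.F k o = P'.F k o := by rw [a, a', hok]
    have hji : P.F j i = P'.F j i := by rw [a, a', hij]
    have hkj : P.F k j = P'.F k j := by rw [a, a', hjk]
    have hik : P.F i k = P'.F i k := by rw [a, a', hki]
    rcases hq.cases x with h | h | h | h <;> rcases hq.cases y with h1 | h1 | h1 | h1 <;>
      rw [h, h1] <;> first | assumption | rw [d, d']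

/-- all parameters away from the label `o` are constant on `S` -/
def Fixed (o : Fin 4) (S : Set Par) : Prop :=
  ∀ P ∈ S, ∀ P' ∈ S, (∀ x, x ≠ o → P.κ x = P'.κ x) ∧
    (∀ x y, x ≠ o → y ≠ o → P.F x y = P'.F x y)

theorem fixed_of {o i j k : Fin 4} (hq : Q4 o i j k) {S : Set Par} (hS : ∀ P ∈ S, Valid P)
    (h : ∀ P ∈ S, ∀ P' ∈ S, P.κ i = P'.κ i ∧ P.κ j = P'.κ j ∧ P.κ k = P'.κ k ∧
      P.F i j = P'.F i j ∧ P.F j k = P'.F j k ∧ P.F k i = P'.F k i) : Fixed o S := by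
  intro P hP P' hP'
  obtain ⟨hi, hj, hk, hij, hjk, hki⟩ := h P hP P' hP'
  have d := (hS P hP).diag
  have d' := (hS P' hP').diag
  have a := (hS P hP).anti
  have a' := (hS P' hP').anti
  have hji : P.F j i = P'.F j i := by rw [a, a', hij]
  have hkj : P.F k j = P'.F k j := by rw [a, a', hjk]
  have hik : P.F i k = P'.F i k := by rw [a, a', hki]
  constructor
  · intro x hx
    rcases hq.cases x with h | h | h | h
    · exact absurd h hx
    all_goals rw [h]; assumption
  · intro x y hx hy
    rcases hq.cases x with h | h | h | h
    · exact absurd h hx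
    all_goals
      rcases hq.cases y with h1 | h1 | h1 | h1
      · exact absurd h1 hy
      all_goals rw [h, h1]; first | assumption | rw [d, d']

/-! ### Recovering the fourth vertex -/

theorem optS2 {A : Fin 4 → ℝ} {U W : Fin 4 → Fin 4 → ℝ} (bx : Bx A U W) {S : Set Par}
    (hS : Cls A U W S) {o i j k : Fin 4} (hq : Q4 o i j k) (hfix : Fixed o S) :
    Cnt S (800 * (1 + U o i * U o j / (U i j * W i j ^ 2))) := by
  have hUoi := bx.U1 o i
  have hUoj := bx.U1 o j
  have hUij := bx.U1 i j
  have hWij := bx.W1 i j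
  rcases S.eq_empty_or_nonempty with hemp | ⟨P0, hP0⟩
  · rw [hemp]; exact cnt_empty (by positivity)
  have q1 : Q4 j k o i := by unfold Q4 at *; tauto
  have q2 : Q4 k i o j := by unfold Q4 at *; tauto
  have q3 : Q4 k o i j := by unfold Q4 at *; tauto
  have q4 : Q4 j o i k := by unfold Q4 at *; tauto
  obtain ⟨noi, noj, nok, nij, nik, njk⟩ := hq
  have hq : Q4 o i j k := ⟨noi, noj, nok, nij, nik, njk⟩
  have hc1 : Cnt {z : GI | ∃ e, IsUnit e ∧ z = e * star (prim (P0.F j k))} 4 := by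
    refine (cnt_units.image (fun e => e * star (prim (P0.F j k)))).subset ?_
    rintro z ⟨e, he, rfl⟩; exact ⟨e, he, rfl⟩
  have hc2 : Cnt {z : GI | ∃ e, IsUnit e ∧ z = e * star (prim (P0.F k i))} 4 := by
    refine (cnt_units.image (fun e => e * star (prim (P0.F k i)))).subset ?_
    rintro z ⟨e, he, rfl⟩; exact ⟨e, he, rfl⟩
  have h16 : (800 : ℝ) * (1 + U o i * U o j / (U i j * W i j ^ 2)) =
      (4 * 4) * (50 * (1 + U o i * U o j / (U i j * W i j ^ 2))) := by ring
  rw [h16]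
  refine Cnt.fiber (f := fun P => (prim (P.F o i), prim (P.F o j)))
    ((cnt_prod hc1 hc2).subset ?_) (by positivity) ?_
  · rintro _ ⟨P, hP, rfl⟩
    refine ⟨?_, ?_⟩
    · obtain ⟨e, he, h⟩ := (hS P hP).1.conj j k o i q1
      exact ⟨e, he, h.trans (by rw [(hfix P hP P0 hP0).2 j k noj.symm nok.symm])⟩
    · obtain ⟨e, he, h⟩ := (hS P hP).1.conj k i o j q2
      exact ⟨e, he, h.trans (by rw [(hfix P hP P0 hP0).2 k i nok.symm noi.symm])⟩
  rintro _ ⟨P1, hP1, rfl⟩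
  refine Cnt.of_injOn (f := fun P => (cont (P.F o i), cont (P.F o j)))
    (slopesZ (X := U o i) (Y := U o j) (by linarith) (by linarith) (by positivity) ?_ ?_) ?_
  · rintro _ ⟨P, ⟨hP, -⟩, rfl⟩
    have hb := (hS P hP).2
    have hv := (hS P hP).1
    have h1 := int_mem hb noi
    have h2 := int_mem hb noj
    refine ⟨(hb.u1 o i noi).trans (le_abs_self _), h1, h2, ?_⟩
    apply cont_coprime
    exact hv.adj' (i := k) (by unfold Q4 at *; tauto)
  · rintro _ ⟨P, ⟨hP, hPp⟩, rfl⟩ _ ⟨P', ⟨hP', hPp'⟩, rfl⟩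
    simp only [Prod.mk.injEq] at hPp hPp'
    have hv := (hS P hP).1
    have hv' := (hS P' hP').1
    have hb := (hS P hP).2
    have e1 : prim (P'.F o i) = prim (P.F o i) := hPp'.1.trans hPp.1.symm
    have e2 : prim (P'.F o j) = prim (P.F o j) := hPp'.2.trans hPp.2.symm
    have ff := hfix P' hP' P hP
    have t := hv.tri k o i j q3
    have t' := hv'.tri k o i j q3
    rw [ff.1 j noj.symm, ff.1 i noi.symm, ff.2 i j noi.symm noj.symm] at t'
    rw [hv.anti o j] at t
    rw [hv'.anti o j] at t'
    simp only
    set u := cont (P.F o i)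
    set v := cont (P.F o j)
    set u' := cont (P'.F o i)
    set v' := cont (P'.F o j)
    have f1 : P.F o i = (u : GI) * prim (P.F o i) := (cont_mul_prim _).symm
    have f2 : P.F o j = (v : GI) * prim (P.F o j) := (cont_mul_prim _).symm
    have f1' : P'.F o i = (u' : GI) * prim (P.F o i) := by rw [← e1]; exact (cont_mul_prim _).symm
    have f2' : P'.F o j = (v' : GI) * prim (P.F o j) := by rw [← e2]; exact (cont_mul_prim _).symm
    have hd : P.F i j ∣ (P.κ j * prim (P.F o i)) * ((u * v' - u' * v : ℤ) : GI) := by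
      refine ⟨P'.κ o * v - P.κ o * v', ?_⟩
      rw [f1, f2] at t
      rw [f1', f2'] at t'
      push_cast
      linear_combination (v' : GI) * t - (v : GI) * t'
    have hcop : IsCoprime (P.F i j) (P.κ j * prim (P.F o i)) := by
      have h1 := hv.cop k o i j q3
      have h2 : IsCoprime (P.F i j) (P.κ j * P.F o i) := h1.of_mul_right_right.symm
      exact h2.of_isCoprime_of_dvd_right (mul_dvd_mul_left _ (prim_dvd _))
    have hd2 : P.F i j ∣ ((u * v' - u' * v : ℤ) : GI) := hcop.dvd_of_dvd_mul_left hd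
    have hd3 := cont_norm_dvd (hv.Fne i j nij) hd2
    by_cases h0 : u * v' - u' * v = 0
    · left; exact h0
    right
    have h4 := Int.le_of_dvd (abs_pos.2 h0) ((dvd_abs _ _).2 hd3)
    have h5 : ((cont (P.F i j) * (prim (P.F i j)).norm : ℤ) : ℝ) ≤
        ((|u * v' - u' * v| : ℤ) : ℝ) := by exact_mod_cast h4
    rw [Int.cast_abs] at h5
    refine le_trans ?_ h5
    push_cast
    rw [← nrm_sq]
    have := hb.u1 i j nij
    have := hb.w1 i j nij
    have hc0 : (0 : ℝ) ≤ cont (P.F i j) := by exact_mod_cast cont_nonneg _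
    gcongr
  · rintro P ⟨hP, hPp⟩ P' ⟨hP', hPp'⟩ he
    simp only [Prod.mk.injEq] at hPp hPp' he
    have hv := (hS P hP).1
    have hv' := (hS P' hP').1
    have e1 : P.F o i = P'.F o i := eq_of_cont_prim he.1 (hPp.1.trans hPp'.1.symm)
    have e2 : P.F o j = P'.F o j := eq_of_cont_prim he.2 (hPp.2.trans hPp'.2.symm)
    have ff := hfix P hP P' hP'
    have t := hv.tri k o i j q3
    have t' := hv'.tri k o i j q3
    rw [← ff.1 j noj.symm, ← ff.1 i noi.symm, ← ff.2 i j noi.symm noj.symm, ← e1, hv'.anti o j,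
      ← e2] at t'
    rw [hv.anti o j] at t
    have e3 : P.κ o = P'.κ o := by
      apply mul_right_cancel₀ (hv.Fne i j nij)
      linear_combination t - t'
    have s := hv.tri j o i k q4
    have s' := hv'.tri j o i k q4
    rw [← ff.1 k nok.symm, ← ff.1 i noi.symm, ← ff.2 i k noi.symm nok.symm, ← e1, ← e3,
      hv'.anti o k] at s'
    rw [hv.anti o k] at s
    have e4 : P.F o k = P'.F o k := by
      apply mul_left_cancel₀ (hv.κne i)
      linear_combination s' - s
    exact par_ext hv hv' hq e3 (ff.1 i noi.symm) (ff.1 j noj.symm) (ff.1 k nok.symm) e1 e2 e4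
      (ff.2 i j noi.symm noj.symm) (ff.2 j k noj.symm nok.symm) (ff.2 k i nok.symm noi.symm)

/-! ### Options F, E and X -/

theorem real_indep {x y : GI} (h : (x * star y).im ≠ 0) {m n : ℤ}
    (he : (m : GI) * x + (n : GI) * y = 0) : m = 0 ∧ n = 0 := by
  have h1 : (m : GI) * (x * star y) + ((n * y.norm : ℤ) : GI) = 0 := by
    push_cast; rw [← mul_star_eq]; linear_combination (star y) * he
  have h2 := congrArg Zsqrtd.im h1
  rw [Zsqrtd.im_add, im_int_mul] at h2
  simp only [Zsqrtd.im_intCast, Zsqrtd.im_zero, add_zero] at h2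
  have hm : m = 0 := (mul_eq_zero.1 h2).resolve_right h
  refine ⟨hm, ?_⟩
  rw [hm] at he
  have hy : y ≠ 0 := by rintro rfl; simp at h
  have h3 : (n : GI) * y = 0 := by simpa using he
  have := (mul_eq_zero.1 h3).resolve_right hy
  exact_mod_cast this

theorem optF {A : Fin 4 → ℝ} {U W : Fin 4 → Fin 4 → ℝ} (bx : Bx A U W) {S : Set Par}
    (hS : Cls A U W S) {o i j k : Fin 4} (hq : Q4 o i j k) {m : ℝ} (hm : 0 ≤ m)
    (hS2 : ∀ S' ⊆ S, Fixed o S' → Cnt S' m) :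
    Cnt S ((36 * A i ^ 2) * ((36 * A j ^ 2) * ((36 * A k ^ 2) *
      ((36 * W i j ^ 2) * ((36 * W j k ^ 2) * (36 * W k i ^ 2))))) * m) := by
  obtain ⟨noi, noj, nok, nij, nik, njk⟩ := hq
  have hq : Q4 o i j k := ⟨noi, noj, nok, nij, nik, njk⟩
  refine Cnt.fiber (f := fun P => (P.κ i, P.κ j, P.κ k, prim (P.F i j), prim (P.F j k),
    prim (P.F k i))) ((cnt_prod (cnt_disc2 (bx.A1 i)) (cnt_prod (cnt_disc2 (bx.A1 j))
      (cnt_prod (cnt_disc2 (bx.A1 k)) (cnt_prod (cnt_disc2 (bx.W1 i j))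
        (cnt_prod (cnt_disc2 (bx.W1 j k)) (cnt_disc2 (bx.W1 k i))))))).subset ?_) hm ?_
  · rintro _ ⟨P, hP, rfl⟩
    have hb := (hS P hP).2
    exact ⟨hb.κ2 i, hb.κ2 j, hb.κ2 k, hb.w2 i j nij, hb.w2 j k njk, hb.w2 k i nik.symm⟩
  rintro _ ⟨P0, hP0, rfl⟩
  refine hS2 _ (fun P hP => hP.1) (fixed_of hq (fun P hP => (hS P hP.1).1) ?_)
  rintro P ⟨hP, hPp⟩ P' ⟨hP', hPp'⟩
  have hpp := hPp.trans hPp'.symm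
  simp only [Prod.mk.injEq] at hpp
  obtain ⟨ki, kj, kk, wij, wjk, wki⟩ := hpp
  have hv := (hS P hP).1
  have hv' := (hS P' hP').1
  have t := hv.tri o i j k hq
  have t' := hv'.tri o i j k hq
  have nc := hv.ncol o i j k hq
  rw [← ki, ← kj, ← kk] at t'
  have f1 := (cont_mul_prim (P.F i j)).symm
  have f2 := (cont_mul_prim (P.F j k)).symm
  have f3 := (cont_mul_prim (P.F k i)).symm
  have f1' := (cont_mul_prim (P'.F i j)).symm
  have f2' := (cont_mul_prim (P'.F j k)).symm
  have f3' := (cont_mul_prim (P'.F k i)).symm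
  rw [← wij] at f1'
  rw [← wjk] at f2'
  rw [← wki] at f3'
  have p1 := cont_pos (hv.Fne i j nij)
  have p2 := cont_pos (hv.Fne j k njk)
  have p3 := cont_pos (hv.Fne k i nik.symm)
  have p1' := cont_pos (hv'.Fne i j nij)
  have p3' := cont_pos (hv'.Fne k i nik.symm)
  have c : IsCoprime (cont (P.F k i)) (cont (P.F i j)) :=
    cont_coprime (hv.adj (i := o) (by unfold Q4 at *; tauto))
  have c' : IsCoprime (cont (P'.F k i)) (cont (P'.F i j)) :=
    cont_coprime (hv'.adj (i := o) (by unfold Q4 at *; tauto))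
  generalize cont (P.F i j) = u at *
  generalize cont (P.F j k) = v at *
  generalize cont (P.F k i) = w at *
  generalize cont (P'.F i j) = u' at *
  generalize cont (P'.F j k) = v' at *
  generalize cont (P'.F k i) = w' at *
  rw [f1, f2] at nc
  have nc' : ((P.κ k * prim (P.F i j)) * star (P.κ i * prim (P.F j k))).im ≠ 0 := by
    intro h0; apply nc
    have hsi : star (v : GI) = (v : GI) := by apply Zsqrtd.ext <;> simp
    have : P.κ k * ((u : GI) * prim (P.F i j)) * star (P.κ i * ((v : GI) * prim (P.F j k))) =
        ((u * v : ℤ) : GI) * ((P.κ k * prim (P.F i j)) * star (P.κ i * prim (P.F j k))) := by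
      simp only [star_mul, hsi]; push_cast; ring
    rw [this, im_int_mul, h0, mul_zero]
  rw [f1, f2, f3] at t
  rw [f1', f2', f3'] at t'
  have hlin : ((w' * u - w * u' : ℤ) : GI) * (P.κ k * prim (P.F i j)) +
      ((w' * v - w * v' : ℤ) : GI) * (P.κ i * prim (P.F j k)) = 0 := by
    push_cast
    linear_combination (w' : GI) * t - (w : GI) * t'
  obtain ⟨h1, h2⟩ := real_indep nc' hlin
  have d1 : w ∣ w' := c.dvd_of_dvd_mul_right (Dvd.intro u' (by linarith))
  have d2 : w' ∣ w := c'.dvd_of_dvd_mul_right (Dvd.intro u (by linarith))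
  have hw : w = w' := Int.dvd_antisymm p3.le p3'.le d1 d2
  have hu : u = u' := by
    apply mul_left_cancel₀ p3'.ne'
    rw [hw] at h1; linarith
  have hvv : v = v' := by
    apply mul_left_cancel₀ p3'.ne'
    rw [hw] at h2; linarith
  exact ⟨ki, kj, kk, by rw [f1, f1', hu], by rw [f2, f2', hvv], by rw [f3, f3', hw]⟩

theorem optE {A : Fin 4 → ℝ} {U W : Fin 4 → Fin 4 → ℝ} (bx : Bx A U W) {S : Set Par}
    (hS : Cls A U W S) {o i j k : Fin 4} (hq : Q4 o i j k) {m : ℝ} (hm : 0 ≤ m)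
    (hS2 : ∀ S' ⊆ S, Fixed o S' → Cnt S' m) :
    Cnt S ((36 * A i ^ 2) * ((36 * A j ^ 2) * ((36 * A k ^ 2) *
      ((5 * U i j) * ((5 * U j k) * (5 * U k i))))) *
      ((4000 * (1 + W i j * W j k / (A j * U k i)) ^ 2) * m)) := by
  obtain ⟨noi, noj, nok, nij, nik, njk⟩ := hq
  have hq : Q4 o i j k := ⟨noi, noj, nok, nij, nik, njk⟩
  have hWij := bx.W1 i j
  have hWjk := bx.W1 j k
  have hAj := bx.A1 j
  have hUki := bx.U1 k i
  refine Cnt.fiber (f := fun P => (P.κ i, P.κ j, P.κ k, cont (P.F i j), cont (P.F j k),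
    cont (P.F k i))) ((cnt_prod (cnt_disc2 (bx.A1 i)) (cnt_prod (cnt_disc2 (bx.A1 j))
      (cnt_prod (cnt_disc2 (bx.A1 k)) (cnt_prod (cnt_int2 (bx.U1 i j))
        (cnt_prod (cnt_int2 (bx.U1 j k)) (cnt_int2 (bx.U1 k i))))))).subset ?_)
        (by positivity) ?_
  · rintro _ ⟨P, hP, rfl⟩
    have hb := (hS P hP).2
    exact ⟨hb.κ2 i, hb.κ2 j, hb.κ2 k, int_mem hb nij, int_mem hb njk, int_mem hb nik.symm⟩
  rintro _ ⟨P0, hP0, rfl⟩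
  refine Cnt.fiber (f := fun P => (prim (P.F i j), prim (P.F j k)))
    (slopesG (X := W i j) (Y := W j k) (I := A j * U k i) (by linarith) (by linarith)
      (by positivity) ?_ ?_) hm ?_
  · rintro _ ⟨P, ⟨hP, -⟩, rfl⟩
    have hb := (hS P hP).2
    refine ⟨hb.w1 i j nij, hb.w2 i j nij, hb.w2 j k njk, ?_⟩
    exact (((hS P hP).1.adj hq).of_isCoprime_of_dvd_left (prim_dvd _)).of_isCoprime_of_dvd_right
      (prim_dvd _)
  · rintro _ ⟨P, ⟨hP, hPp⟩, rfl⟩ _ ⟨P', ⟨hP', hPp'⟩, rfl⟩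
    have hpp := hPp.trans hPp'.symm
    simp only [Prod.mk.injEq] at hpp
    obtain ⟨ki, kj, kk, uij, ujk, uki⟩ := hpp
    have hv := (hS P hP).1
    have hv' := (hS P' hP').1
    have hb := (hS P hP).2
    have t := hv.tri o i j k hq
    have t' := hv'.tri o i j k hq
    rw [← ki, ← kj, ← kk] at t'
    have f1 := (cont_mul_prim (P.F i j)).symm
    have f2 := (cont_mul_prim (P.F j k)).symm
    have f3 := (cont_mul_prim (P.F k i)).symm
    have f1' := (cont_mul_prim (P'.F i j)).symm
    have f2' := (cont_mul_prim (P'.F j k)).symm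
    have f3' := (cont_mul_prim (P'.F k i)).symm
    rw [← uij] at f1'
    rw [← ujk] at f2'
    rw [← uki] at f3'
    have hcop : IsCoprime (P.κ j * (cont (P.F k i) : GI)) (P.κ k * (cont (P.F i j) : GI)) := by
      have h1 := hv.cop o k i j (by unfold Q4 at *; tauto)
      exact (h1.of_isCoprime_of_dvd_left (mul_dvd_mul_left _ (cont_dvd _))).of_isCoprime_of_dvd_right
        (mul_dvd_mul_left _ (cont_dvd _))
    have n1 := hb.κ1 j
    have n2 := hb.u1 k i nik.symm
    simp only
    have hd : P.κ j * (cont (P.F k i) : GI) ∣ (P.κ k * (cont (P.F i j) : GI)) *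
        (prim (P.F i j) * prim (P'.F j k) - prim (P'.F i j) * prim (P.F j k)) := by
      refine ⟨prim (P'.F k i) * prim (P.F j k) - prim (P.F k i) * prim (P'.F j k), ?_⟩
      rw [f1, f2, f3] at t
      rw [f1', f2', f3'] at t'
      linear_combination (prim (P'.F j k)) * t - (prim (P.F j k)) * t'
    have hd2 := hcop.dvd_of_dvd_mul_left hd
    by_cases h0 : prim (P.F i j) * prim (P'.F j k) - prim (P'.F i j) * prim (P.F j k) = 0
    · left; exact h0
    right
    refine le_trans ?_ (nrm_le_of_dvd h0 hd2)
    rw [nrm_mul, nrm_int]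
    have := le_abs_self ((cont (P.F k i) : ℤ) : ℝ)
    exact mul_le_mul n1 (n2.trans this) (by linarith) (nrm_nonneg _)
  · rintro _ ⟨P1, hP1, rfl⟩
    refine hS2 _ (fun P hP => hP.1.1) (fixed_of hq (fun P hP => (hS P hP.1.1).1) ?_)
    rintro P ⟨⟨hP, hPp⟩, hPw⟩ P' ⟨⟨hP', hPp'⟩, hPw'⟩
    have hpp := hPp.trans hPp'.symm
    have hww := hPw.trans hPw'.symm
    simp only [Prod.mk.injEq] at hpp hww
    obtain ⟨ki, kj, kk, uij, ujk, uki⟩ := hpp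
    have hv := (hS P hP).1
    have hv' := (hS P' hP').1
    have t := hv.tri o i j k hq
    have t' := hv'.tri o i j k hq
    have e1 := eq_of_cont_prim uij hww.1
    have e2 := eq_of_cont_prim ujk hww.2
    rw [← ki, ← kj, ← kk, ← e1, ← e2] at t'
    refine ⟨ki, kj, kk, e1, e2, ?_⟩
    apply mul_left_cancel₀ (hv.κne j)
    linear_combination t - t'

theorem optX {A : Fin 4 → ℝ} {U W : Fin 4 → Fin 4 → ℝ} (bx : Bx A U W) {S : Set Par}
    (hS : Cls A U W S) {o i j k : Fin 4} (hq : Q4 o i j k) {R M : ℝ} (hM0 : 0 ≤ M)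
    (hR : ∀ P ∈ S, ∀ x y, x ≠ y → nrm (P.F x y) ≤ R)
    (hM : ∀ z : GI, z ≠ 0 → nrm z ≤ R ^ 2 → Cnt {d | d ∣ z} M) :
    Cnt S ((5 * U o i) * ((5 * U j k) * ((5 * U o j) * ((5 * U k i) *
      ((36 * W o i ^ 2) * (36 * W o j ^ 2))))) *
      ((4 * 4) * (M * (4000 * (1 + A i * A j / (U i j * W i j)) ^ 2)))) := by
  obtain ⟨noi, noj, nok, nij, nik, njk⟩ := hq
  have hq : Q4 o i j k := ⟨noi, noj, nok, nij, nik, njk⟩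
  have hAi := bx.A1 i
  have hAj := bx.A1 j
  have hUij := bx.U1 i j
  have hWij := bx.W1 i j
  have q1 : Q4 o i j k := hq
  have q3 : Q4 k o i j := by unfold Q4 at *; tauto
  refine Cnt.fiber (f := fun P => (cont (P.F o i), cont (P.F j k), cont (P.F o j), cont (P.F k i),
    prim (P.F o i), prim (P.F o j))) ((cnt_prod (cnt_int2 (bx.U1 o i))
      (cnt_prod (cnt_int2 (bx.U1 j k)) (cnt_prod (cnt_int2 (bx.U1 o j))
      (cnt_prod (cnt_int2 (bx.U1 k i)) (cnt_prod (cnt_disc2 (bx.W1 o i))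
        (cnt_disc2 (bx.W1 o j))))))).subset ?_) (by positivity) ?_
  · rintro _ ⟨P, hP, rfl⟩
    have hb := (hS P hP).2
    exact ⟨int_mem hb noi, int_mem hb njk, int_mem hb noj, int_mem hb nik.symm, hb.w2 o i noi,
      hb.w2 o j noj⟩
  rintro _ ⟨P0, hP0, rfl⟩
  have hc1 : ∀ w : GI, Cnt {z : GI | ∃ e, IsUnit e ∧ z = e * star w} 4 := by
    intro w
    refine (cnt_units.image (fun e => e * star w)).subset ?_
    rintro z ⟨e, he, rfl⟩; exact ⟨e, he, rfl⟩
  refine Cnt.fiber (f := fun P => (prim (P.F j k), prim (P.F k i)))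
    ((cnt_prod (hc1 (prim (P0.F o i))) (hc1 (prim (P0.F o j)))).subset ?_) (by positivity) ?_
  · rintro _ ⟨P, ⟨hP, hPp⟩, rfl⟩
    simp only [Prod.mk.injEq] at hPp
    refine ⟨?_, ?_⟩
    · obtain ⟨e, he, h⟩ := (hS P hP).1.conj o i j k hq
      exact ⟨e, he, h.trans (by rw [hPp.2.2.2.2.1])⟩
    · obtain ⟨e, he, h⟩ := (hS P hP).1.conj o j k i (by unfold Q4 at *; tauto)
      exact ⟨e, he, h.trans (by rw [hPp.2.2.2.2.2])⟩
  rintro _ ⟨P1, ⟨hP1, hP10⟩, rfl⟩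
  have hfix : ∀ P, (P ∈ {x | x ∈ {x | x ∈ S ∧ (cont (x.F o i), cont (x.F j k), cont (x.F o j),
      cont (x.F k i), prim (x.F o i), prim (x.F o j)) = (cont (P0.F o i), cont (P0.F j k),
      cont (P0.F o j), cont (P0.F k i), prim (P0.F o i), prim (P0.F o j))} ∧
      (prim (x.F j k), prim (x.F k i)) = (prim (P1.F j k), prim (P1.F k i))}) →
      P ∈ S ∧ P.F o i = P1.F o i ∧ P.F j k = P1.F j k ∧ P.F o j = P1.F o j ∧
        P.F k i = P1.F k i := by
    rintro P ⟨⟨hP, hPp⟩, hPw⟩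
    have h1 := hPp.trans hP10.symm
    simp only [Prod.mk.injEq] at h1 hPw
    exact ⟨hP, eq_of_cont_prim h1.1 h1.2.2.2.2.1, eq_of_cont_prim h1.2.1 hPw.1,
      eq_of_cont_prim h1.2.2.1 h1.2.2.2.2.2, eq_of_cont_prim h1.2.2.2.1 hPw.2⟩
  set S1 := {x | x ∈ {x | x ∈ S ∧ (cont (x.F o i), cont (x.F j k), cont (x.F o j),
      cont (x.F k i), prim (x.F o i), prim (x.F o j)) = (cont (P0.F o i), cont (P0.F j k),
      cont (P0.F o j), cont (P0.F k i), prim (P0.F o i), prim (P0.F o j))} ∧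
      (prim (x.F j k), prim (x.F k i)) = (prim (P1.F j k), prim (P1.F k i))} with hS1
  have hv1 := (hS P1 hP1).1
  refine Cnt.fiber (S := S1) (f := fun P => P.F i j)
    ((hM (P1.F o k * P1.F i j) (mul_ne_zero (hv1.Fne o k nok) (hv1.Fne i j nij)) ?_).subset ?_)
    (by positivity) ?_
  · rw [nrm_mul, sq]
    exact mul_le_mul (hR P1 hP1 o k nok) (hR P1 hP1 i j nij) (nrm_nonneg _)
      ((nrm_nonneg _).trans (hR P1 hP1 o k nok))
  · rintro _ ⟨P, hP, rfl⟩
    obtain ⟨hPS, a1, a2, a3, a4⟩ := hfix P hP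
    have t := (hS P hPS).1.pto o i j k hq
    have t1 := hv1.pto o i j k hq
    rw [a1, a2, a3, a4] at t
    exact ⟨P.F o k, by linear_combination t1 - t⟩
  rintro _ ⟨P2, hP2, rfl⟩
  refine Cnt.of_injOn (f := fun P => (P.κ i, P.κ j))
    (slopesG (X := A i) (Y := A j) (by linarith) (by linarith) (by positivity) ?_ ?_) ?_
  · rintro _ ⟨P, ⟨hP, -⟩, rfl⟩
    obtain ⟨hPS, -⟩ := hfix P hP
    have hb := (hS P hPS).2
    exact ⟨hb.κ1 i, hb.κ2 i, hb.κ2 j, (hS P hPS).1.copκ (i := o) (k := k)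
      (by unfold Q4 at *; tauto)⟩
  · rintro _ ⟨P, ⟨hP, hPf⟩, rfl⟩ _ ⟨P', ⟨hP', hPf'⟩, rfl⟩
    obtain ⟨hPS, a1, a2, a3, a4⟩ := hfix P hP
    obtain ⟨hPS', b1, b2, b3, b4⟩ := hfix P' hP'
    have e := hPf'.trans hPf.symm
    simp only at e ⊢
    have hv := (hS P hPS).1
    have hv' := (hS P' hPS').1
    have t := hv.tri k o i j q3
    have t' := hv'.tri k o i j q3
    rw [hv.anti o j] at t
    rw [hv'.anti o j, b1.trans a1.symm, b3.trans a3.symm, e] at t'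
    have hcop : IsCoprime (P.F i j) (P.F o i) := (hv.adj q3).symm
    have hd : P.F i j ∣ (P.F o i) * (P.κ i * P'.κ j - P'.κ i * P.κ j) := by
      refine ⟨P'.κ i * P.κ o - P.κ i * P'.κ o, ?_⟩
      linear_combination (P.κ i) * t' - (P'.κ i) * t
    have hd2 := hcop.dvd_of_dvd_mul_left hd
    by_cases h0 : P.κ i * P'.κ j - P'.κ i * P.κ j = 0
    · left; exact h0
    right
    refine le_trans ?_ (nrm_le_of_dvd h0 hd2)
    rw [nrm_cont_prim]
    have hb := (hS P hPS).2
    have := hb.u1 i j nij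
    have := hb.w1 i j nij
    have hc0 : (0 : ℝ) ≤ cont (P.F i j) := by exact_mod_cast cont_nonneg _
    gcongr
  · rintro P ⟨hP, hPf⟩ P' ⟨hP', hPf'⟩ he
    obtain ⟨hPS, a1, a2, a3, a4⟩ := hfix P hP
    obtain ⟨hPS', b1, b2, b3, b4⟩ := hfix P' hP'
    have e := hPf.trans hPf'.symm
    simp only [Prod.mk.injEq] at e he
    have hv := (hS P hPS).1
    have hv' := (hS P' hPS').1
    have t := hv.tri k o i j q3
    have t' := hv'.tri k o i j q3
    have s := hv.tri o i j k hq
    have s' := hv'.tri o i j k hq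
    have r := hv.pto o i j k hq
    have r' := hv'.pto o i j k hq
    have eoi := a1.trans b1.symm
    have ejk := a2.trans b2.symm
    have eoj := a3.trans b3.symm
    have eki := a4.trans b4.symm
    rw [hv.anti o j] at t
    rw [hv'.anti o j, ← eoi, ← eoj, ← e, ← he.1, ← he.2] at t'
    rw [← ejk, ← eki, ← e, ← he.1, ← he.2] at s'
    rw [← eoi, ← ejk, ← eoj, ← eki, ← e] at r'
    have k1 : P.κ o = P'.κ o := by
      apply mul_right_cancel₀ (hv.Fne i j nij)
      linear_combination t - t'
    have k2 : P.κ k = P'.κ k := by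
      apply mul_right_cancel₀ (hv.Fne i j nij)
      linear_combination s - s'
    have k3 : P.F o k = P'.F o k := by
      apply mul_right_cancel₀ (hv.Fne i j nij)
      linear_combination r - r'
    exact par_ext hv hv' hq k1 he.1 he.2 k2 eoi eoj k3 e ejk eki

end ACQ


namespace ACQ

/-! ### Four points with real cross ratio -/

def CR (a b c d : GI) : Prop := ((b - a) * (d - c) * star ((c - a) * (b - d))).im = 0

theorem CR.rot {a b c d : GI} (h : CR a b c d) : CR b c d a := by
  unfold CR at *
  simp only [star_mul, star_sub, Zsqrtd.im_mul, Zsqrtd.re_mul, Zsqrtd.im_sub, Zsqrtd.re_sub,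
    Zsqrtd.re_star, Zsqrtd.im_star] at *
  linear_combination -h

theorem CR.swap {a b c d : GI} (h : CR a b c d) : CR b a c d := by
  unfold CR at *
  simp only [star_mul, star_sub, Zsqrtd.im_mul, Zsqrtd.re_mul, Zsqrtd.im_sub, Zsqrtd.re_sub,
    Zsqrtd.re_star, Zsqrtd.im_star] at *
  linear_combination -h

theorem third_pair {p0 p1 p2 p3 : GI} (h : CR p0 p1 p2 p3) (h12 : p1 ≠ p2)
    (he : (p3 - p0).norm = (p2 - p1).norm) :
    (p1 - p0).norm = (p3 - p2).norm ∨ (p2 - p0).norm = (p3 - p1).norm := by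
  have hb : (p2 - p1).norm ≠ 0 := (GaussianInt.norm_pos.2 (sub_ne_zero.2 h12.symm)).ne'
  unfold CR at h
  have key : (p2 - p1).norm * (2 * ((p1 - p0).norm - (p3 - p2).norm) *
      ((p2 - p0).norm - (p3 - p1).norm)) = 0 := by
    set a := p3 - p0 with ha
    set b := p2 - p1 with hb'
    set t := p1 - p0 with ht
    have e1 : p3 - p2 = a - t - b := by rw [ha, hb', ht]; ring
    have e2 : p2 - p0 = t + b := by rw [hb', ht]; ring
    have e3 : p3 - p1 = a - t := by rw [ha, ht]; ring
    have e4 : p1 - p3 = t - a := by rw [ha, ht]; ring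
    rw [e1, e2, e4] at h
    rw [e1, e2, e3]
    clear_value a b t
    obtain ⟨a1, a2⟩ := a
    obtain ⟨b1, b2⟩ := b
    obtain ⟨t1, t2⟩ := t
    simp only [norm_eq, star_mul, star_sub, star_add, Zsqrtd.im_mul, Zsqrtd.re_mul, Zsqrtd.im_sub,
      Zsqrtd.re_sub, Zsqrtd.im_add, Zsqrtd.re_add, Zsqrtd.re_star, Zsqrtd.im_star] at *
    linear_combination (2 * (a2 * b1 - a1 * b2) ^ 2 + (b1 ^ 2 - b2 ^ 2) *
      ((2 * t1 + b1 - a1) ^ 2 - (2 * t2 + b2 - a2) ^ 2) +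
      4 * b1 * b2 * (2 * t1 + b1 - a1) * (2 * t2 + b2 - a2) +
      (b1 ^ 2 + b2 ^ 2) * ((2 * t1 + b1 - a1) ^ 2 + (2 * t2 + b2 - a2) ^ 2)) * he
      + 8 * (a2 * b1 - a1 * b2) * h
  have h2 := (mul_eq_zero.1 key).resolve_left hb
  rcases mul_eq_zero.1 h2 with h3 | h3
  · left; linarith
  · right; linarith

theorem im_star_comm {v w : GI} (h : (v * star w).im = 0) : (w * star v).im = 0 := by
  simp only [Zsqrtd.im_mul, Zsqrtd.re_star, Zsqrtd.im_star] at *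
  linarith

theorem par_trans {v w1 w2 : GI} (hv : v ≠ 0) (h1 : (v * star w1).im = 0)
    (h2 : (v * star w2).im = 0) : (w1 * star w2).im = 0 := by
  have e : ((v.norm : ℤ) : GI) * (w1 * star w2) = (v * star w2) * star (v * star w1) := by
    rw [← mul_star_eq, star_mul, star_star]; ring
  have hn : v.norm ≠ 0 := (GaussianInt.norm_pos.2 hv).ne'
  apply im_zero_cancel hn
  rw [e, Zsqrtd.im_mul, Zsqrtd.im_star, h1, h2]
  simp

theorem par_add {v w1 w2 : GI} (h1 : (v * star w1).im = 0)
    (h2 : (v * star w2).im = 0) : (v * star (w1 + w2)).im = 0 := by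
  rw [star_add, mul_add, Zsqrtd.im_add, h1, h2, add_zero]

theorem par_neg {v w1 : GI} (h1 : (v * star w1).im = 0) : (v * star (-w1)).im = 0 := by
  rw [star_neg, mul_neg, Zsqrtd.im_neg, h1, neg_zero]

theorem par_self (v : GI) : (v * star v).im = 0 := by rw [mul_star_eq]; simp

theorem col_step {a b c d : GI} (h : CR a b c d) (hab : a ≠ b) (hac : a ≠ c)
    (hc : ((b - a) * star (c - b)).im = 0) : ((c - b) * star (d - c)).im = 0 := by
  have e0 : c - a = (b - a) + (c - b) := by ring
  have h1 : ((b - a) * star (c - a)).im = 0 := by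
    rw [e0]; exact par_add (par_self _) hc
  unfold CR at h
  have h2 : (b - a) * (d - c) * star ((c - a) * (b - d)) =
      ((b - a) * star (c - a)) * ((d - c) * star (b - d)) := by rw [star_mul]; ring
  have hne : (b - a) * star (c - a) ≠ 0 :=
    mul_ne_zero (sub_ne_zero.2 hab.symm) (star_ne_zero' (sub_ne_zero.2 hac.symm))
  rw [h2, Zsqrtd.im_mul, h1, zero_mul, add_zero] at h
  have hre : ((b - a) * star (c - a)).re ≠ 0 := by
    intro h0; apply hne; apply Zsqrtd.ext
    · exact h0
    · exact h1
  have h3 := (mul_eq_zero.1 h).resolve_left hre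
  have e1 : c - b = -((d - c) + (b - d)) := by ring
  apply im_star_comm
  rw [e1]
  exact par_neg (par_add (par_self _) h3)

/-- all properties follow from a few of them -/
theorem good_mk {P : Fin 4 → GI} (hne : ∀ i j, i ≠ j → P i ≠ P j)
    (hcr : CR (P 0) (P 1) (P 2) (P 3))
    (hnc : ¬ (((P 1 - P 0) * star (P 3 - P 2)).im = 0 ∧ ((P 2 - P 0) * star (P 3 - P 1)).im = 0))
    (h1 : (P 1 - P 0).norm ≠ (P 3 - P 2).norm) (h2 : (P 2 - P 0).norm ≠ (P 3 - P 1).norm) :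
    Good (fun i j => P j - P i) := by
  have hcr' : ∀ i j k l, Q4 i j k l → CR (P i) (P j) (P k) (P l) := by
    have c1230 := hcr.rot
    have c1023 := hcr.swap
    have c2301 := c1230.rot
    have c2130 := c1230.swap
    have c0231 := c1023.rot
    have c3012 := c2301.rot
    have c3201 := c2301.swap
    have c1302 := c2130.rot
    have c2310 := c0231.rot
    have c2031 := c0231.swap
    have c0312 := c3012.swap
    have c2013 := c3201.rot
    have c3021 := c1302.rot
    have c3102 := c1302.swap
    have c3210 := c2310.swap
    have c3120 := c0312.rot
    have c0132 := c2013.rot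
    have c0213 := c2013.swap
    have c0321 := c3021.swap
    have c2103 := c3210.rot
    have c1203 := c3120.rot
    have c1320 := c3120.swap
    have c1032 := c0132.swap
    intro i j k l hq
    obtain ⟨n1, n2, n3, n4, n5, n6⟩ := hq
    fin_cases i <;> fin_cases j <;> try (exact absurd rfl n1)
    all_goals fin_cases k <;> try (first | exact absurd rfl n2 | exact absurd rfl n4)
    all_goals fin_cases l <;>
      first | exact absurd rfl n3 | exact absurd rfl n5 | exact absurd rfl n6 | assumption
  have hsn : ∀ x y : GI, (x - y).norm = (y - x).norm := by
    intro x y; rw [← Zsqrtd.norm_neg]; congr 1; ring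
  have h3 : (P 3 - P 0).norm ≠ (P 2 - P 1).norm := by
    intro h; rcases third_pair hcr (hne 1 2 (by decide)) h with h | h
    · exact h1 h
    · exact h2 h
  refine ⟨fun i j k => by ring, fun i j hij => sub_ne_zero.2 (hne j i hij.symm), hcr', ?_, ?_⟩
  · intro i j k l hq h
    apply hnc
    obtain ⟨n1, n2, n3, n4, n5, n6⟩ := hq
    have hq : Q4 i j k l := ⟨n1, n2, n3, n4, n5, n6⟩
    have hv : P j - P i ≠ 0 := sub_ne_zero.2 (hne j i n1.symm)
    have hkl := col_step (hcr' i j k l hq) (hne i j n1) (hne i k n2) h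
    have hkl' : ((P j - P i) * star (P l - P k)).im = 0 :=
      par_trans (sub_ne_zero.2 (hne k j n4.symm)) (im_star_comm h) hkl
    have hall : ∀ x, ((P j - P i) * star (P x - P i)).im = 0 := by
      intro x
      rcases hq.cases x with e | e | e | e <;> rw [e]
      · simp
      · exact par_self _
      · have : P k - P i = (P j - P i) + (P k - P j) := by ring
        rw [this]; exact par_add (par_self _) h
      · have : P l - P i = (P j - P i) + (P k - P j) + (P l - P k) := by ring
        rw [this]; exact par_add (par_add (par_self _) h) hkl'
    have hall2 : ∀ x y, ((P j - P i) * star (P y - P x)).im = 0 := by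
      intro x y
      have : P y - P x = (P y - P i) + -(P x - P i) := by ring
      rw [this]; exact par_add (hall y) (par_neg (hall x))
    exact ⟨par_trans hv (hall2 0 1) (hall2 2 3), par_trans hv (hall2 0 2) (hall2 1 3)⟩
  · intro i j k l hq
    obtain ⟨n1, n2, n3, n4, n5, n6⟩ := hq
    have g : ∀ i j : Fin 4, (P j - P i).norm = (P i - P j).norm := fun i j => hsn _ _
    have g1 := g 0 1
    have g2 := g 0 2
    have g3 := g 0 3
    have g4 := g 1 2
    have g5 := g 1 3
    have g6 := g 2 3
    show (P j - P i).norm ≠ (P l - P k).norm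
    intro h
    fin_cases i <;> fin_cases j <;> try (exact absurd rfl n1)
    all_goals fin_cases k <;> try (first | exact absurd rfl n2 | exact absurd rfl n4)
    all_goals fin_cases l <;>
      first | exact absurd rfl n3 | exact absurd rfl n5 | exact absurd rfl n6 |
        (simp only [Fin.zero_eta, Fin.mk_one, Fin.reduceFinMk] at h; omega)

end ACQ


namespace ACQ

/-! ### Two nearby points of a linear graph -/

theorem close_pair {T : Set (GI × GI)} {X Y h m11 m12 m21 m22 : ℝ} (hX : 0 < X) (hY : 0 < Y)
    (h0 : 0 < h) (h1 : h ≤ 1)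
    (hlin : ∀ t ∈ T, (t.2.re : ℝ) = m11 * t.1.re + m12 * t.1.im ∧
      (t.2.im : ℝ) = m21 * t.1.re + m22 * t.1.im)
    (hb : ∀ t ∈ T, nrm t.1 ≤ 2 * X ∧ nrm t.2 ≤ 2 * Y)
    (hno : ∀ t ∈ T, ∀ t' ∈ T, nrm (t.1 - t'.1) ≤ 2 * h * X → nrm (t.2 - t'.2) ≤ 2 * h * Y →
      t = t') : Cnt T (81 / h ^ 2) := by
  set al : ℝ := 1 / X ^ 2 + (m11 ^ 2 + m21 ^ 2) / Y ^ 2 with hal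
  set be : ℝ := (m11 * m12 + m21 * m22) / Y ^ 2 with hbe
  set ga : ℝ := 1 / X ^ 2 + (m12 ^ 2 + m22 ^ 2) / Y ^ 2 with hga
  have hal0 : 0 < al := by positivity
  have hdet : 0 ≤ ga - be ^ 2 / al := by
    rw [sub_nonneg, div_le_iff₀ hal0]
    have e : ga * al - be ^ 2 = 1 / X ^ 2 * (1 / X ^ 2) + 1 / X ^ 2 * ((m11 ^ 2 + m21 ^ 2) / Y ^ 2)
        + 1 / X ^ 2 * ((m12 ^ 2 + m22 ^ 2) / Y ^ 2) + ((m11 * m22 - m12 * m21) / Y ^ 2) ^ 2 := by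
      rw [hal, hbe, hga]; ring
    have : 0 ≤ ga * al - be ^ 2 := by rw [e]; positivity
    linarith
  have hQ : ∀ p q : ℝ, (Real.sqrt al * (p + be / al * q)) ^ 2 +
      (Real.sqrt (ga - be ^ 2 / al) * q) ^ 2 = (p ^ 2 + q ^ 2) / X ^ 2 +
        ((m11 * p + m12 * q) ^ 2 + (m21 * p + m22 * q) ^ 2) / Y ^ 2 := by
    intro p q
    rw [mul_pow, mul_pow, Real.sq_sqrt hal0.le, Real.sq_sqrt hdet]
    have e : al * (p + be / al * q) ^ 2 + (ga - be ^ 2 / al) * q ^ 2 =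
        al * p ^ 2 + 2 * be * p * q + ga * q ^ 2 := by
      field_simp; ring
    rw [e, hal, hbe, hga]; ring
  set s : ℝ → ℝ → ℝ := fun p q => Real.sqrt al * (p + be / al * q) with hs
  set τ : ℝ → ℝ → ℝ := fun p q => Real.sqrt (ga - be ^ 2 / al) * q with hτ
  have hQ' : ∀ p q : ℝ, (s p q) ^ 2 + (τ p q) ^ 2 = (p ^ 2 + q ^ 2) / X ^ 2 +
        ((m11 * p + m12 * q) ^ 2 + (m21 * p + m22 * q) ^ 2) / Y ^ 2 := hQ
  have hssub : ∀ p q p' q', s (p - p') (q - q') = s p q - s p' q' := by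
    intro p q p' q'; simp only [hs]; ring
  have hτsub : ∀ p q p' q', τ (p - p') (q - q') = τ p q - τ p' q' := by
    intro p q p' q'; simp only [hτ]; ring
  have hnr : ∀ z : GI, ((z.re : ℝ)) ^ 2 + (z.im : ℝ) ^ 2 = nrm z ^ 2 := by
    intro z; rw [nrm_sq, norm_eq]; push_cast; ring
  clear_value s τ
  have hc := cnt_int_Icc (3 / h + 1) (by positivity)
  refine Cnt.of_injOn (f := fun t : GI × GI => (⌊s t.1.re t.1.im / h⌋, ⌊τ t.1.re t.1.im / h⌋))
    ((cnt_prod hc hc).mono ?_ ?_) ?_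
  · rintro _ ⟨t, ht, rfl⟩
    obtain ⟨l1, l2⟩ := hlin t ht
    obtain ⟨b1, b2⟩ := hb t ht
    have hq := hQ' t.1.re t.1.im
    rw [← l1, ← l2, hnr, hnr] at hq
    have c1 : nrm t.1 ^ 2 / X ^ 2 ≤ 4 := by
      rw [div_le_iff₀ (by positivity)]; nlinarith [nrm_nonneg t.1]
    have c2 : nrm t.2 ^ 2 / Y ^ 2 ≤ 4 := by
      rw [div_le_iff₀ (by positivity)]; nlinarith [nrm_nonneg t.2]
    have d1 : |s t.1.re t.1.im| ≤ 3 := abs_le_of_sq_le_sq (by nlinarith only [hq, c1, c2, sq_nonneg (s t.1.re t.1.im), sq_nonneg (τ t.1.re t.1.im)]) (by norm_num)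
    have d2 : |τ t.1.re t.1.im| ≤ 3 := abs_le_of_sq_le_sq (by nlinarith only [hq, c1, c2, sq_nonneg (s t.1.re t.1.im), sq_nonneg (τ t.1.re t.1.im)]) (by norm_num)
    refine ⟨floor_abs_le _ _ ?_, floor_abs_le _ _ ?_⟩
    · rw [abs_div, abs_of_pos h0]; gcongr
    · rw [abs_div, abs_of_pos h0]; gcongr
  · have e : (2 * (3 / h + 1) + 1) ≤ 9 / h := by
      have : 1 ≤ 1 / h := by rw [le_div_iff₀ h0]; linarith
      have e2 : 3 / h = 3 * (1 / h) := by ring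
      have e3 : 9 / h = 9 * (1 / h) := by ring
      rw [e2, e3]; linarith
    calc _ ≤ (9 / h) * (9 / h) := by gcongr
      _ = _ := by ring
  · rintro t ht t' ht' he
    simp only [Prod.mk.injEq] at he
    have d1 := abs_sub_lt_of_floor he.1
    have d2 := abs_sub_lt_of_floor he.2
    rw [← sub_div, ← hssub, abs_div, abs_of_pos h0, div_lt_one h0] at d1
    rw [← sub_div, ← hτsub, abs_div, abs_of_pos h0, div_lt_one h0] at d2
    have hq := hQ' (t.1.re - t'.1.re) (t.1.im - t'.1.im)
    obtain ⟨l1, l2⟩ := hlin t ht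
    obtain ⟨l1', l2'⟩ := hlin t' ht'
    have r1 : m11 * ((t.1.re : ℝ) - t'.1.re) + m12 * (t.1.im - t'.1.im) =
        (((t.2 - t'.2).re : ℤ) : ℝ) := by rw [Zsqrtd.re_sub]; push_cast; rw [l1, l1']; ring
    have r2 : m21 * ((t.1.re : ℝ) - t'.1.re) + m22 * (t.1.im - t'.1.im) =
        (((t.2 - t'.2).im : ℤ) : ℝ) := by rw [Zsqrtd.im_sub]; push_cast; rw [l2, l2']; ring
    have r3 : ((t.1.re : ℝ) - t'.1.re) = (((t.1 - t'.1).re : ℤ) : ℝ) := by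
      rw [Zsqrtd.re_sub]; push_cast; ring
    have r4 : ((t.1.im : ℝ) - t'.1.im) = (((t.1 - t'.1).im : ℤ) : ℝ) := by
      rw [Zsqrtd.im_sub]; push_cast; ring
    rw [r1, r2, hnr] at hq
    rw [r3, r4, hnr] at hq
    rw [r3, r4] at d1 d2
    have s1 : (s (((t.1 - t'.1).re : ℤ) : ℝ) (((t.1 - t'.1).im : ℤ) : ℝ)) ^ 2 ≤ h ^ 2 :=
      sq_le_sq.2 (by rw [abs_of_pos h0]; exact d1.le)
    have s2 : (τ (((t.1 - t'.1).re : ℤ) : ℝ) (((t.1 - t'.1).im : ℤ) : ℝ)) ^ 2 ≤ h ^ 2 :=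
      sq_le_sq.2 (by rw [abs_of_pos h0]; exact d2.le)
    have p1 : 0 ≤ nrm (t.1 - t'.1) ^ 2 / X ^ 2 := by positivity
    have p2 : 0 ≤ nrm (t.2 - t'.2) ^ 2 / Y ^ 2 := by positivity
    have hh2 : 0 ≤ h ^ 2 := sq_nonneg h
    have e4 : (2 * h) ^ 2 = 4 * h ^ 2 := by ring
    have k1 : nrm (t.1 - t'.1) ^ 2 / X ^ 2 ≤ (2 * h) ^ 2 := by rw [e4]; linarith only [s1, s2, hq, p2, hh2]
    have k2 : nrm (t.2 - t'.2) ^ 2 / Y ^ 2 ≤ (2 * h) ^ 2 := by rw [e4]; linarith only [s1, s2, hq, p1, hh2]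
    rw [div_le_iff₀ (by positivity), ← mul_pow] at k1 k2
    exact hno t ht t' ht' (le_of_sq_le_sq k1 (by positivity)) (le_of_sq_le_sq k2 (by positivity))

theorem line_count {q : GI} (hq : q ≠ 0) {B : ℝ} :
    Cnt {x : GI | x ≠ 0 ∧ nrm x ≤ B ∧ (q * x ^ 2).im = 0} (6 * B) ∨
    {x : GI | x ≠ 0 ∧ nrm x ≤ B ∧ (q * x ^ 2).im = 0} = ∅ := by
  rcases Set.eq_empty_or_nonempty {x : GI | x ≠ 0 ∧ nrm x ≤ B ∧ (q * x ^ 2).im = 0} with he | ⟨v, hv⟩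
  · right; exact he
  left
  obtain ⟨hv0, hvB, hvq⟩ := hv
  have hB : 1 ≤ B := (one_le_nrm hv0).trans hvB
  have line : ∀ w : GI, w ≠ 0 → Cnt {x : GI | nrm x ≤ B ∧ (x * star w).im = 0} (3 * B) := by
    intro w hw
    have hc : Cnt {n : ℤ | |(n : ℝ)| ≤ B} (3 * B) := (cnt_int_Icc B (by linarith)).le (by linarith)
    by_cases hr : w.re = 0
    · have hi : w.im ≠ 0 := by
        intro h; apply hw; apply Zsqrtd.ext
        · exact hr
        · exact h
      refine Cnt.of_injOn (f := fun x : GI => x.im) (hc.subset ?_) ?_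
      · rintro _ ⟨x, ⟨hx, -⟩, rfl⟩; exact (abs_im_le x).trans hx
      · rintro x ⟨-, hx⟩ y ⟨-, hy⟩ h
        simp only [Zsqrtd.im_mul, Zsqrtd.re_star, Zsqrtd.im_star, hr] at hx hy h
        apply Zsqrtd.ext
        · apply mul_right_cancel₀ hi; linarith
        · exact h
    · refine Cnt.of_injOn (f := fun x : GI => x.re) (hc.subset ?_) ?_
      · rintro _ ⟨x, ⟨hx, -⟩, rfl⟩; exact (abs_re_le x).trans hx
      · rintro x ⟨-, hx⟩ y ⟨-, hy⟩ h
        simp only [Zsqrtd.im_mul, Zsqrtd.re_star, Zsqrtd.im_star] at hx hy h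
        apply Zsqrtd.ext
        · exact h
        · apply mul_right_cancel₀ hr; rw [h] at hx; linarith
  have hI : (⟨0, 1⟩ : GI) ≠ 0 := by decide
  have hu := (line v hv0).union (line (⟨0, 1⟩ * v) (mul_ne_zero hI hv0))
  refine hu.mono ?_ (by linarith)
  rintro x ⟨hx0, hxB, hxq⟩
  have hqv : q * v ^ 2 ≠ 0 := mul_ne_zero hq (pow_ne_zero 2 hv0)
  have h1 : (x ^ 2 * star (v ^ 2)).im = 0 := by
    have hn : q.norm ≠ 0 := (GaussianInt.norm_pos.2 hq).ne'
    apply im_zero_cancel hn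
    have e : ((q.norm : ℤ) : GI) * (x ^ 2 * star (v ^ 2)) = (q * x ^ 2) * star (q * v ^ 2) := by
      rw [← mul_star_eq, star_mul]; ring
    rw [e, Zsqrtd.im_mul, Zsqrtd.im_star, hxq, hvq]; simp
  have h2 : (x ^ 2 * star (v ^ 2)).im = 2 * ((x * star v).re * (x * star v).im) := by
    have : x ^ 2 * star (v ^ 2) = (x * star v) * (x * star v) := by rw [star_pow]; ring
    rw [this, Zsqrtd.im_mul]; ring
  rw [h2] at h1
  have h3 : (x * star v).re * (x * star v).im = 0 := by omega
  rcases mul_eq_zero.1 h3 with h | h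
  · right
    refine ⟨hxB, ?_⟩
    simp only [star_mul, Zsqrtd.im_mul, Zsqrtd.re_mul, Zsqrtd.re_star, Zsqrtd.im_star] at h ⊢
    linarith
  · left; exact ⟨hxB, h⟩

end ACQ


namespace ACQ

/-! ### Coefficient classes -/

@[ext]
structure Cd where
  (k0 k1 k2 k3 : GI)
  (s t u v : ℤ)
  (e f : GI)

namespace Cd
def a (c : Cd) : GI := c.k2 * c.k3 * c.s
def b (c : Cd) : GI := c.k0 * c.k1 * c.t * c.e
def c' (c : Cd) : GI := c.k1 * c.k3 * c.u
def d (c : Cd) : GI := c.k0 * c.k2 * c.v * c.f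
end Cd

structure CdSz (A0 A1 A2 A3 Us Ut Uu Uv : ℝ) (c : Cd) : Prop where
  k0 : c.k0 ≠ 0
  k1 : c.k1 ≠ 0
  k2 : c.k2 ≠ 0
  k3 : c.k3 ≠ 0
  n0 : nrm c.k0 ≤ 2 * A0
  n1 : nrm c.k1 ≤ 2 * A1
  n2 : nrm c.k2 ≤ 2 * A2
  n3 : nrm c.k3 ≤ 2 * A3
  s : 0 < c.s
  t : 0 < c.t
  u : 0 < c.u
  v : 0 < c.v
  ns : |(c.s : ℝ)| ≤ 2 * Us
  nt : |(c.t : ℝ)| ≤ 2 * Ut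
  nu : |(c.u : ℝ)| ≤ 2 * Uu
  nv : |(c.v : ℝ)| ≤ 2 * Uv
  e : IsUnit c.e
  f : IsUnit c.f

theorem cd_triv {A0 A1 A2 A3 Us Ut Uu Uv : ℝ} (h0 : 1 ≤ A0) (h1 : 1 ≤ A1) (h2 : 1 ≤ A2)
    (h3 : 1 ≤ A3) (hs : 1 ≤ Us) (ht : 1 ≤ Ut) (hu : 1 ≤ Uu) (hv : 1 ≤ Uv) {C : Set Cd}
    (hC : ∀ c ∈ C, CdSz A0 A1 A2 A3 Us Ut Uu Uv c) :
    Cnt C ((36 * A0 ^ 2) * ((36 * A1 ^ 2) * ((36 * A2 ^ 2) * ((36 * A3 ^ 2) *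
      ((5 * Us) * ((5 * Ut) * ((5 * Uu) * ((5 * Uv) * (4 * 4))))))))) := by
  refine Cnt.of_injOn (f := fun c : Cd => (c.k0, c.k1, c.k2, c.k3, c.s, c.t, c.u, c.v, c.e, c.f))
    ((cnt_prod (cnt_disc2 h0) (cnt_prod (cnt_disc2 h1) (cnt_prod (cnt_disc2 h2)
    (cnt_prod (cnt_disc2 h3) (cnt_prod (cnt_int2 hs) (cnt_prod (cnt_int2 ht)
    (cnt_prod (cnt_int2 hu) (cnt_prod (cnt_int2 hv) (cnt_prod cnt_units cnt_units))))))))).subset ?_)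
    ?_
  · rintro _ ⟨c, hc, rfl⟩
    have h := hC c hc
    exact ⟨h.n0, h.n1, h.n2, h.n3, h.ns, h.nt, h.nu, h.nv, h.e, h.f⟩
  · rintro c - c' - h
    simp only [Prod.mk.injEq] at h
    obtain ⟨e0, e1, e2, e3, e4, e5, e6, e7, e8, e9⟩ := h
    exact Cd.ext e0 e1 e2 e3 e4 e5 e6 e7 e8 e9

structure CdOK (A0 A1 A2 A3 Us Ut Uu Uv Wx Wy H : ℝ) (c : Cd) (x y : GI) : Prop where
  sz : CdSz A0 A1 A2 A3 Us Ut Uu Uv c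
  ef : (c.e * star c.f).im = 0
  nab : c.a.norm ≠ c.b.norm
  ncd : c.c'.norm ≠ c.d.norm
  rel : c.a * x - c.b * star x = c.c' * y - c.d * star y
  ne : x ≠ 0 ∨ y ≠ 0
  hx : nrm x ≤ H * Wx
  hy : nrm y ≤ H * Wy

theorem zero_of_eq {a b x : GI} (h : a * x - b * star x = 0) (hn : a.norm ≠ b.norm) : x = 0 := by
  have h1 : a * x = b * star x := sub_eq_zero.1 h
  have h2 := congrArg Zsqrtd.norm h1
  rw [Zsqrtd.norm_mul, Zsqrtd.norm_mul, Zsqrtd.norm_conj] at h2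
  by_contra hx
  exact hn (mul_right_cancel₀ (GaussianInt.norm_pos.2 hx).ne' h2)

section
variable {A0 A1 A2 A3 Us Ut Uu Uv Wx Wy H : ℝ} {c : Cd} {x y : GI}

theorem CdOK.x0 (h : CdOK A0 A1 A2 A3 Us Ut Uu Uv Wx Wy H c x y) : x ≠ 0 := by
  rintro rfl
  have hr := h.rel
  simp only [star_zero, mul_zero, sub_zero] at hr
  have := zero_of_eq hr.symm h.ncd
  rcases h.ne with h1 | h1
  · exact h1 rfl
  · exact h1 this

theorem CdOK.y0 (h : CdOK A0 A1 A2 A3 Us Ut Uu Uv Wx Wy H c x y) : y ≠ 0 := by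
  rintro rfl
  have hr := h.rel
  simp only [star_zero, mul_zero, sub_zero] at hr
  exact h.x0 (zero_of_eq hr h.nab)

theorem int_ne {n : ℤ} (h : 0 < n) : (n : GI) ≠ 0 := by exact_mod_cast h.ne'

theorem CdSz.a0 (h : CdSz A0 A1 A2 A3 Us Ut Uu Uv c) : c.a ≠ 0 :=
  mul_ne_zero (mul_ne_zero h.k2 h.k3) (int_ne h.s)
theorem CdSz.b0 (h : CdSz A0 A1 A2 A3 Us Ut Uu Uv c) : c.b ≠ 0 :=
  mul_ne_zero (mul_ne_zero (mul_ne_zero h.k0 h.k1) (int_ne h.t)) h.e.ne_zero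
theorem CdSz.c0 (h : CdSz A0 A1 A2 A3 Us Ut Uu Uv c) : c.c' ≠ 0 :=
  mul_ne_zero (mul_ne_zero h.k1 h.k3) (int_ne h.u)
theorem CdSz.d0 (h : CdSz A0 A1 A2 A3 Us Ut Uu Uv c) : c.d ≠ 0 :=
  mul_ne_zero (mul_ne_zero (mul_ne_zero h.k0 h.k2) (int_ne h.v)) h.f.ne_zero

/-- the configuration attached to a class -/
def cP (c : Cd) (x y : GI) : Fin 4 → GI := ![0, c.a * x, c.c' * y, c.a * x + c.d * star y]

def cD (c : Cd) (x y : GI) : Fin 4 → Fin 4 → GI := fun i j => cP c x y j - cP c x y i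

theorem cP_good (h : CdOK A0 A1 A2 A3 Us Ut Uu Uv Wx Wy H c x y)
    (h03 : c.a * x + c.d * star y ≠ 0) (h12 : c.a * x ≠ c.c' * y)
    (hnc : ¬ ((c.k2 * c.k3 * star (c.k0 * c.k1 * c.e) * x ^ 2).im = 0 ∧
      (c.k1 * c.k3 * star (c.k0 * c.k2 * c.f) * y ^ 2).im = 0)) : Good (cD c x y) := by
  have hx := h.x0
  have hy := h.y0
  have p0 : cP c x y 0 = 0 := rfl
  have p1 : cP c x y 1 = c.a * x := rfl
  have p2 : cP c x y 2 = c.c' * y := rfl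
  have p3 : cP c x y 3 = c.a * x + c.d * star y := rfl
  have hr := h.rel
  have p23 : cP c x y 3 - cP c x y 2 = c.b * star x := by
    rw [p3, p2]; linear_combination hr
  have p13 : cP c x y 3 - cP c x y 1 = c.d * star y := by rw [p3, p1]; ring
  have hb : c.b * star x ≠ 0 := mul_ne_zero h.sz.b0 (star_ne_zero' hx)
  have hd : c.d * star y ≠ 0 := mul_ne_zero h.sz.d0 (star_ne_zero' hy)
  have ha : c.a * x ≠ 0 := mul_ne_zero h.sz.a0 hx
  have hc : c.c' * y ≠ 0 := mul_ne_zero h.sz.c0 hy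
  have e01 : cP c x y 0 ≠ cP c x y 1 := by rw [p0, p1]; exact ha.symm
  have e02 : cP c x y 0 ≠ cP c x y 2 := by rw [p0, p2]; exact hc.symm
  have e03 : cP c x y 0 ≠ cP c x y 3 := by rw [p0, p3]; exact h03.symm
  have e12 : cP c x y 1 ≠ cP c x y 2 := by rw [p1, p2]; exact h12
  have e13 : cP c x y 1 ≠ cP c x y 3 := by rw [Ne, eq_comm, ← sub_eq_zero, p13]; exact hd
  have e23 : cP c x y 2 ≠ cP c x y 3 := by rw [Ne, eq_comm, ← sub_eq_zero, p23]; exact hb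
  have hsi : ∀ n : ℤ, star (n : GI) = (n : GI) := by intro n; apply Zsqrtd.ext <;> simp
  apply good_mk
  · intro i j hij
    fin_cases i <;> fin_cases j <;> first | exact absurd rfl hij | assumption |
      (apply Ne.symm; assumption)
  · unfold CR
    have p31 : cP c x y 1 - cP c x y 3 = - (c.d * star y) := by rw [← p13]; ring
    rw [p23, p31, p0, p1, p2, sub_zero, sub_zero]
    have e : c.a * x * (c.b * star x) * star (c.c' * y * -(c.d * star y)) =
        ((-(c.s * c.t * c.u * c.v * c.k0.norm * c.k1.norm * c.k2.norm * c.k3.norm * x.norm *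
          y.norm) : ℤ) : GI) * (c.e * star c.f) := by
      push_cast
      rw [← mul_star_eq, ← mul_star_eq, ← mul_star_eq, ← mul_star_eq, ← mul_star_eq, ← mul_star_eq]
      simp only [Cd.a, Cd.b, Cd.c', Cd.d, star_mul, star_neg, star_star, hsi]
      ring
    rw [e, im_int_mul, h.ef, mul_zero]
  · rw [p23, p13, p0, p1, p2, sub_zero, sub_zero]
    rintro ⟨g1, g2⟩
    apply hnc
    constructor
    · apply im_zero_cancel (n := c.s * c.t) (mul_pos h.sz.s h.sz.t).ne'
      rw [← g1]; congr 1
      simp only [Cd.a, Cd.b, star_mul, star_star, hsi]; push_cast; ring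
    · apply im_zero_cancel (n := c.u * c.v) (mul_pos h.sz.u h.sz.v).ne'
      rw [← g2]; congr 1
      simp only [Cd.c', Cd.d, star_mul, star_star, hsi]; push_cast; ring
  · rw [p23, p0, p1, sub_zero, Zsqrtd.norm_mul, Zsqrtd.norm_mul, Zsqrtd.norm_conj]
    intro g; exact h.nab (mul_right_cancel₀ (GaussianInt.norm_pos.2 hx).ne' g)
  · rw [p13, p0, p2, sub_zero, Zsqrtd.norm_mul, Zsqrtd.norm_mul, Zsqrtd.norm_conj]
    intro g; exact h.ncd (mul_right_cancel₀ (GaussianInt.norm_pos.2 hy).ne' g)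

theorem mul3_le {a b c d A B C D : ℝ} (ha : 0 ≤ a) (hb : 0 ≤ b) (hc : 0 ≤ c) (hd : 0 ≤ d)
    (h1 : a ≤ A) (h2 : b ≤ B) (h3 : c ≤ C) (h4 : d ≤ D) : a * b * c * d ≤ A * B * C * D := by
  have : 0 ≤ A := ha.trans h1
  have : 0 ≤ B := hb.trans h2
  have : 0 ≤ C := hc.trans h3
  gcongr

theorem cD_nrm (h : CdOK A0 A1 A2 A3 Us Ut Uu Uv Wx Wy H c x y) {R : ℝ} (hH : 0 ≤ H)
    (hR : 0 ≤ R)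
    (r1 : A2 * A3 * Us * Wx ≤ R) (r2 : A0 * A1 * Ut * Wx ≤ R) (r3 : A1 * A3 * Uu * Wy ≤ R)
    (r4 : A0 * A2 * Uv * Wy ≤ R) (i j : Fin 4) : nrm (cD c x y i j) ≤ 16 * H * R := by
  have z := h.sz
  have ha : nrm (c.a * x) ≤ 8 * H * R := by
    rw [Cd.a, nrm_mul, nrm_mul, nrm_mul, nrm_int]
    refine (mul3_le (nrm_nonneg _) (nrm_nonneg _) (abs_nonneg _) (nrm_nonneg _) z.n2 z.n3 z.ns
      h.hx).trans ?_
    nlinarith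
  have hb : nrm (c.b * star x) ≤ 8 * H * R := by
    rw [Cd.b, nrm_mul, nrm_mul, nrm_mul, nrm_mul, nrm_int, isUnit_iff_nrm.1 z.e, mul_one, nrm_star]
    refine (mul3_le (nrm_nonneg _) (nrm_nonneg _) (abs_nonneg _) (nrm_nonneg _) z.n0 z.n1 z.nt
      h.hx).trans ?_
    nlinarith
  have hc : nrm (c.c' * y) ≤ 8 * H * R := by
    rw [Cd.c', nrm_mul, nrm_mul, nrm_mul, nrm_int]
    refine (mul3_le (nrm_nonneg _) (nrm_nonneg _) (abs_nonneg _) (nrm_nonneg _) z.n1 z.n3 z.nu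
      h.hy).trans ?_
    nlinarith
  have hd : nrm (c.d * star y) ≤ 8 * H * R := by
    rw [Cd.d, nrm_mul, nrm_mul, nrm_mul, nrm_mul, nrm_int, isUnit_iff_nrm.1 z.f, mul_one, nrm_star]
    refine (mul3_le (nrm_nonneg _) (nrm_nonneg _) (abs_nonneg _) (nrm_nonneg _) z.n0 z.n2 z.nv
      h.hy).trans ?_
    nlinarith
  have hHR : 0 ≤ H * R := mul_nonneg hH hR
  have key : ∀ i j : Fin 4, i < j → nrm (cP c x y j - cP c x y i) ≤ 16 * H * R := by
    intro i j hij
    have g01 : nrm (cP c x y 1 - cP c x y 0) ≤ 16 * H * R := by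
      have : cP c x y 1 - cP c x y 0 = c.a * x := by simp [cP]
      rw [this]; linarith
    have g02 : nrm (cP c x y 2 - cP c x y 0) ≤ 16 * H * R := by
      have : cP c x y 2 - cP c x y 0 = c.c' * y := by simp [cP]
      rw [this]; linarith
    have g03 : nrm (cP c x y 3 - cP c x y 0) ≤ 16 * H * R := by
      have : cP c x y 3 - cP c x y 0 = c.a * x + c.d * star y := by simp [cP]
      rw [this]; exact (nrm_add_le _ _).trans (by linarith)
    have g12 : nrm (cP c x y 2 - cP c x y 1) ≤ 16 * H * R := by
      have : cP c x y 2 - cP c x y 1 = c.c' * y - c.a * x := by simp [cP]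
      rw [this]; exact (nrm_sub_le _ _).trans (by linarith)
    have g13 : nrm (cP c x y 3 - cP c x y 1) ≤ 16 * H * R := by
      have : cP c x y 3 - cP c x y 1 = c.d * star y := by simp [cP]
      rw [this]; linarith
    have g23 : nrm (cP c x y 3 - cP c x y 2) ≤ 16 * H * R := by
      have : cP c x y 3 - cP c x y 2 = c.b * star x := by
        simp [cP]; linear_combination h.rel
      rw [this]; linarith
    fin_cases i <;> fin_cases j <;> first | (exact absurd hij (by decide)) | assumption
  rcases lt_trichotomy i j with hij | hij | hij
  · exact key i j hij
  · rw [hij, cD, sub_self, nrm_zero]; nlinarith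
  · have : cD c x y i j = -(cP c x y i - cP c x y j) := by rw [cD]; ring
    rw [this, nrm_neg]; exact key j i hij
end

end ACQ


namespace ACQ

/-- good configurations of size at most `ρ` -/
def GS (ρ : ℝ) : Set (Fin 4 → Fin 4 → GI) := {D | Good D ∧ ∀ i j, nrm (D i j) ≤ ρ}

theorem cnt_int_dvd {z : GI} {M : ℝ} (h : Cnt {d : GI | d ∣ z} M) :
    Cnt {n : ℤ | (n : GI) ∣ z} M := by
  refine Cnt.of_injOn (f := fun n : ℤ => (n : GI)) (h.subset ?_) ?_
  · rintro _ ⟨n, hn, rfl⟩; exact hn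
  · intro a _ b _ hab
    have : (a : GI) = (b : GI) := hab
    exact_mod_cast this

theorem line_count' {q : GI} (hq : q ≠ 0) {B : ℝ} (hB : 0 ≤ B) :
    Cnt {x : GI | x ≠ 0 ∧ nrm x ≤ B ∧ (q * x ^ 2).im = 0} (6 * B) := by
  rcases line_count hq (B := B) with h | h
  · exact h
  · rw [h]; exact cnt_empty (by positivity)

section
variable {A0 A1 A2 A3 Us Ut Uu Uv Wx Wy H : ℝ} {C : Set Cd} {x y : Cd → GI} {M Z : ℝ}

theorem cls_good (hC : ∀ c ∈ C, CdOK A0 A1 A2 A3 Us Ut Uu Uv Wx Wy H c (x c) (y c))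
    (hM : ∀ z : GI, z ≠ 0 → nrm z ≤ Z → Cnt {d | d ∣ z} M) (hM0 : 0 ≤ M) {ρ N : ℝ} (hρ : ρ ≤ Z)
    (hN : Cnt (GS ρ) N) (hG : ∀ c ∈ C, cD c (x c) (y c) ∈ GS ρ) :
    Cnt C (N * (M * (M * (M * (M * (M * (M * (M * (M * (4 * 4)))))))))) := by
  refine Cnt.fiber (f := fun c => cD c (x c) (y c)) (hN.subset ?_) (by positivity) ?_
  · rintro _ ⟨c, hc, rfl⟩; exact hG c hc
  rintro _ ⟨c0, hc0, rfl⟩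
  have g0 := hG c0 hc0
  have hd : ∀ i j, i ≠ j → Cnt {d : GI | d ∣ cD c0 (x c0) (y c0) i j} M := fun i j hij =>
    hM _ (g0.1.ne i j hij) ((g0.2 i j).trans hρ)
  have d01 := hd 0 1 (by decide)
  have d02 := hd 0 2 (by decide)
  have d13 := hd 1 3 (by decide)
  have d23 := hd 2 3 (by decide)
  refine Cnt.of_injOn (f := fun c : Cd => (c.k2, c.k3, c.s, c.k0, c.k1, c.t, c.u, c.v, c.e, c.f))
    ((cnt_prod d01 (cnt_prod d01 (cnt_prod (cnt_int_dvd d01) (cnt_prod d23 (cnt_prod d23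
      (cnt_prod (cnt_int_dvd d23) (cnt_prod (cnt_int_dvd d02) (cnt_prod (cnt_int_dvd d13)
      (cnt_prod cnt_units cnt_units))))))))).subset ?_) ?_
  · rintro _ ⟨c, ⟨hc, he⟩, rfl⟩
    have he' : cD c (x c) (y c) = cD c0 (x c0) (y c0) := he
    have h := hC c hc
    have e01 : cD c (x c) (y c) 0 1 = c.a * x c := by simp [cD, cP]
    have e02 : cD c (x c) (y c) 0 2 = c.c' * y c := by simp [cD, cP]
    have e13 : cD c (x c) (y c) 1 3 = c.d * star (y c) := by simp [cD, cP]
    have e23 : cD c (x c) (y c) 2 3 = c.b * star (x c) := by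
      simp [cD, cP]; linear_combination h.rel
    rw [he'] at e01 e02 e13 e23
    refine ⟨?_, ?_, ?_, ?_, ?_, ?_, ?_, ?_, h.sz.e, h.sz.f⟩
    · exact ⟨c.k3 * c.s * x c, by rw [e01, Cd.a]; ring⟩
    · exact ⟨c.k2 * c.s * x c, by rw [e01, Cd.a]; ring⟩
    · exact ⟨c.k2 * c.k3 * x c, by rw [e01, Cd.a]; ring⟩
    · exact ⟨c.k1 * c.t * c.e * star (x c), by rw [e23, Cd.b]; ring⟩
    · exact ⟨c.k0 * c.t * c.e * star (x c), by rw [e23, Cd.b]; ring⟩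
    · exact ⟨c.k0 * c.k1 * c.e * star (x c), by rw [e23, Cd.b]; ring⟩
    · exact ⟨c.k1 * c.k3 * y c, by rw [e02, Cd.c']; ring⟩
    · exact ⟨c.k0 * c.k2 * c.f * star (y c), by rw [e13, Cd.d]; ring⟩
  · rintro c - c' - h
    simp only [Prod.mk.injEq] at h
    obtain ⟨e2, e3, es, e0, e1, et, eu, ev, ee, ef⟩ := h
    exact Cd.ext e0 e1 e2 e3 es et eu ev ee ef

theorem cls_03 (h0 : 1 ≤ A0) (h1 : 1 ≤ A1) (h2 : 1 ≤ A2) (ht : 1 ≤ Ut) (hv : 1 ≤ Uv)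
    (hC : ∀ c ∈ C, CdOK A0 A1 A2 A3 Us Ut Uu Uv Wx Wy H c (x c) (y c))
    (hM : ∀ z : GI, z ≠ 0 → nrm z ≤ Z → Cnt {d | d ∣ z} M) (hM0 : 0 ≤ M)
    (hZ : (2 * A0) ^ 2 * (2 * Ut) * (2 * Uv) ≤ Z)
    (hG : ∀ c ∈ C, c.a * x c + c.d * star (y c) = 0) :
    Cnt C ((36 * A0 ^ 2) * ((36 * A1 ^ 2) * ((36 * A2 ^ 2) * ((5 * Ut) * (5 * Uv)))) *
      (M * (M * (M * (4 * 4))))) := by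
  refine Cnt.fiber (f := fun c : Cd => (c.k0, c.k1, c.k2, c.t, c.v))
    ((cnt_prod (cnt_disc2 h0) (cnt_prod (cnt_disc2 h1) (cnt_prod (cnt_disc2 h2)
    (cnt_prod (cnt_int2 ht) (cnt_int2 hv))))).subset ?_) (by positivity) ?_
  · rintro _ ⟨c, hc, rfl⟩
    have h := (hC c hc).sz
    exact ⟨h.n0, h.n1, h.n2, h.nt, h.nv⟩
  rintro _ ⟨c0, hc0, rfl⟩
  have z0 := (hC c0 hc0).sz
  have hd : Cnt {d : GI | d ∣ ((c0.k0.norm * c0.t * c0.v : ℤ) : GI)} M := by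
    apply hM
    · have := mul_pos (mul_pos (GaussianInt.norm_pos.2 z0.k0) z0.t) z0.v
      exact_mod_cast this.ne'
    · rw [nrm_int]; push_cast
      rw [← nrm_sq, abs_mul, abs_mul, abs_of_nonneg (sq_nonneg _)]
      refine le_trans ?_ hZ
      have := z0.n0
      have := z0.nt
      have := z0.nv
      have := nrm_nonneg c0.k0
      gcongr
  refine Cnt.of_injOn (f := fun c : Cd => (c.k3, c.s, c.u, c.e, c.f))
    ((cnt_prod hd (cnt_prod (cnt_int_dvd hd) (cnt_prod (cnt_int_dvd hd)
      (cnt_prod cnt_units cnt_units)))).subset ?_) ?_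
  · rintro _ ⟨c, ⟨hc, he⟩, rfl⟩
    simp only [Prod.mk.injEq] at he
    obtain ⟨e0, e1, e2, et, ev⟩ := he
    have h := hC c hc
    have q1 := hG c hc
    have q2 : c.c' * y c + c.b * star (x c) = 0 := by linear_combination q1 - h.rel
    have n1 := congrArg Zsqrtd.norm (eq_neg_of_add_eq_zero_left q1)
    have n2 := congrArg Zsqrtd.norm (eq_neg_of_add_eq_zero_left q2)
    have xp := GaussianInt.norm_pos.2 h.x0
    have yp := GaussianInt.norm_pos.2 h.y0
    have p1 := GaussianInt.norm_pos.2 h.sz.k1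
    have p2 := GaussianInt.norm_pos.2 h.sz.k2
    have p0 := GaussianInt.norm_pos.2 h.sz.k0
    have p3 := GaussianInt.norm_pos.2 h.sz.k3
    simp only [Cd.a, Cd.b, Cd.c', Cd.d, Zsqrtd.norm_neg, Zsqrtd.norm_mul, Zsqrtd.norm_conj,
      Zsqrtd.norm_intCast, isUnit_iff_norm.1 h.sz.e, isUnit_iff_norm.1 h.sz.f, mul_one] at n1 n2
    have key : (c.k3.norm * c.s * c.u) ^ 2 = (c.k0.norm * c.t * c.v) ^ 2 := by
      have hne : c.k1.norm * c.k2.norm * ((x c).norm * (y c).norm) ≠ 0 := by positivity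
      apply mul_left_cancel₀ hne
      linear_combination (c.k1.norm * c.k3.norm * (c.u * c.u) * (y c).norm) * n1 +
        (c.k0.norm * c.k2.norm * (c.v * c.v) * (y c).norm) * n2
    have s0 := h.sz.s
    have t0 := h.sz.t
    have u0 := h.sz.u
    have v0 := h.sz.v
    have key2 : c.k3.norm * c.s * c.u = c.k0.norm * c.t * c.v :=
      (sq_eq_sq₀ (by positivity) (by positivity)).1 key
    rw [e0, et, ev] at key2
    have key3 : ((c0.k0.norm * c0.t * c0.v : ℤ) : GI) = c.k3 * star c.k3 * c.s * c.u := by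
      rw [← key2]; push_cast; rw [← mul_star_eq]
    refine ⟨?_, ?_, ?_, h.sz.e, h.sz.f⟩
    · exact ⟨star c.k3 * c.s * c.u, by rw [key3]; ring⟩
    · exact ⟨c.k3 * star c.k3 * c.u, by rw [key3]; ring⟩
    · exact ⟨c.k3 * star c.k3 * c.s, by rw [key3]; ring⟩
  · rintro c ⟨-, hc⟩ c' ⟨-, hc'⟩ h
    have hh := hc.trans hc'.symm
    simp only [Prod.mk.injEq] at h hh
    obtain ⟨e3, es, eu, ee, ef⟩ := h
    obtain ⟨e0, e1, e2, et, ev⟩ := hh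
    exact Cd.ext e0 e1 e2 e3 es et eu ev ee ef

theorem cls_12 (h0 : 1 ≤ A0) (h1 : 1 ≤ A1) (h3 : 1 ≤ A3) (ht : 1 ≤ Ut) (hu : 1 ≤ Uu)
    (hC : ∀ c ∈ C, CdOK A0 A1 A2 A3 Us Ut Uu Uv Wx Wy H c (x c) (y c))
    (hM : ∀ z : GI, z ≠ 0 → nrm z ≤ Z → Cnt {d | d ∣ z} M) (hM0 : 0 ≤ M)
    (hZ : (2 * A1) ^ 2 * (2 * Ut) * (2 * Uu) ≤ Z)
    (hG : ∀ c ∈ C, c.a * x c = c.c' * y c) :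
    Cnt C ((36 * A0 ^ 2) * ((36 * A1 ^ 2) * ((36 * A3 ^ 2) * ((5 * Ut) * (5 * Uu)))) *
      (M * (M * (M * (4 * 4))))) := by
  refine Cnt.fiber (f := fun c : Cd => (c.k0, c.k1, c.k3, c.t, c.u))
    ((cnt_prod (cnt_disc2 h0) (cnt_prod (cnt_disc2 h1) (cnt_prod (cnt_disc2 h3)
    (cnt_prod (cnt_int2 ht) (cnt_int2 hu))))).subset ?_) (by positivity) ?_
  · rintro _ ⟨c, hc, rfl⟩
    have h := (hC c hc).sz
    exact ⟨h.n0, h.n1, h.n3, h.nt, h.nu⟩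
  rintro _ ⟨c0, hc0, rfl⟩
  have z0 := (hC c0 hc0).sz
  have hd : Cnt {d : GI | d ∣ ((c0.k1.norm * c0.t * c0.u : ℤ) : GI)} M := by
    apply hM
    · have := mul_pos (mul_pos (GaussianInt.norm_pos.2 z0.k1) z0.t) z0.u
      exact_mod_cast this.ne'
    · rw [nrm_int]; push_cast
      rw [← nrm_sq, abs_mul, abs_mul, abs_of_nonneg (sq_nonneg _)]
      refine le_trans ?_ hZ
      have := z0.n1
      have := z0.nt
      have := z0.nu
      have := nrm_nonneg c0.k1
      gcongr
  refine Cnt.of_injOn (f := fun c : Cd => (c.k2, c.s, c.v, c.e, c.f))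
    ((cnt_prod hd (cnt_prod (cnt_int_dvd hd) (cnt_prod (cnt_int_dvd hd)
      (cnt_prod cnt_units cnt_units)))).subset ?_) ?_
  · rintro _ ⟨c, ⟨hc, he⟩, rfl⟩
    simp only [Prod.mk.injEq] at he
    obtain ⟨e0, e1, e3, et, eu⟩ := he
    have h := hC c hc
    have q1 := hG c hc
    have q2 : c.d * star (y c) = c.b * star (x c) := by linear_combination h.rel - q1
    have n1 := congrArg Zsqrtd.norm q1
    have n2 := congrArg Zsqrtd.norm q2
    have xp := GaussianInt.norm_pos.2 h.x0
    have yp := GaussianInt.norm_pos.2 h.y0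
    have p1 := GaussianInt.norm_pos.2 h.sz.k1
    have p2 := GaussianInt.norm_pos.2 h.sz.k2
    have p0 := GaussianInt.norm_pos.2 h.sz.k0
    have p3 := GaussianInt.norm_pos.2 h.sz.k3
    simp only [Cd.a, Cd.b, Cd.c', Cd.d, Zsqrtd.norm_neg, Zsqrtd.norm_mul, Zsqrtd.norm_conj,
      Zsqrtd.norm_intCast, isUnit_iff_norm.1 h.sz.e, isUnit_iff_norm.1 h.sz.f, mul_one] at n1 n2
    have key : (c.k2.norm * c.s * c.v) ^ 2 = (c.k1.norm * c.t * c.u) ^ 2 := by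
      have hne : c.k0.norm * c.k3.norm * ((x c).norm * (y c).norm) ≠ 0 := by positivity
      apply mul_left_cancel₀ hne
      linear_combination (c.k0.norm * c.k2.norm * (c.v * c.v) * (y c).norm) * n1 +
        (c.k1.norm * c.k3.norm * (c.u * c.u) * (y c).norm) * n2
    have s0 := h.sz.s
    have t0 := h.sz.t
    have u0 := h.sz.u
    have v0 := h.sz.v
    have key2 : c.k2.norm * c.s * c.v = c.k1.norm * c.t * c.u :=
      (sq_eq_sq₀ (by positivity) (by positivity)).1 key
    rw [e1, et, eu] at key2
    have key3 : ((c0.k1.norm * c0.t * c0.u : ℤ) : GI) = c.k2 * star c.k2 * c.s * c.v := by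
      rw [← key2]; push_cast; rw [← mul_star_eq]
    refine ⟨?_, ?_, ?_, h.sz.e, h.sz.f⟩
    · exact ⟨star c.k2 * c.s * c.v, by rw [key3]; ring⟩
    · exact ⟨c.k2 * star c.k2 * c.v, by rw [key3]; ring⟩
    · exact ⟨c.k2 * star c.k2 * c.s, by rw [key3]; ring⟩
  · rintro c ⟨-, hc⟩ c' ⟨-, hc'⟩ h
    have hh := hc.trans hc'.symm
    simp only [Prod.mk.injEq] at h hh
    obtain ⟨e2, es, ev, ee, ef⟩ := h
    obtain ⟨e0, e1, e3, et, eu⟩ := hh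
    exact Cd.ext e0 e1 e2 e3 es et eu ev ee ef

theorem norm_isSquare {q x : GI} (hx : x ≠ 0) (h : (q * x ^ 2).im = 0) :
    ∃ r : ℤ, q.norm = r * r := by
  have hn : q * x ^ 2 = (((q * x ^ 2).re : ℤ) : GI) := by
    apply Zsqrtd.ext
    · simp
    · rw [h]; simp
  set n := (q * x ^ 2).re
  have h1 := congrArg Zsqrtd.norm hn
  rw [Zsqrtd.norm_mul, pow_two, Zsqrtd.norm_mul, Zsqrtd.norm_intCast] at h1
  have hp := GaussianInt.norm_pos.2 hx
  have hd : x.norm ^ 2 ∣ n ^ 2 := ⟨q.norm, by linear_combination -h1⟩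
  obtain ⟨r, hr⟩ := (Int.pow_dvd_pow_iff (by norm_num)).1 hd
  refine ⟨r, ?_⟩
  have hne : x.norm * x.norm ≠ 0 := by positivity
  apply mul_left_cancel₀ hne
  rw [hr] at h1
  linear_combination h1

theorem cls_col (h0 : 1 ≤ A0) (h1 : 1 ≤ A1) (h2 : 1 ≤ A2) (h3 : 1 ≤ A3) (ht : 1 ≤ Ut)
    (hu : 1 ≤ Uu) (hv : 1 ≤ Uv) (hwx : 1 ≤ Wx) (hwy : 1 ≤ Wy) (hH : 0 ≤ H)
    (hC : ∀ c ∈ C, CdOK A0 A1 A2 A3 Us Ut Uu Uv Wx Wy H c (x c) (y c))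
    (hM : ∀ z : GI, z ≠ 0 → nrm z ≤ Z → Cnt {d | d ∣ z} M) (hM0 : 0 ≤ M)
    (hZ : (16 * (A0 * A1 * A2 * A3)) ^ 2 ≤ Z)
    (hG : ∀ c ∈ C, (c.k2 * c.k3 * star (c.k0 * c.k1 * c.e) * x c ^ 2).im = 0 ∧
      (c.k1 * c.k3 * star (c.k0 * c.k2 * c.f) * y c ^ 2).im = 0) :
    Cnt C ((33 * (A0 * A1 * A2 * A3)) * ((M * (M * (M * M))) * ((4 * (4 * ((5 * Ut) * ((5 * Uu) *
      (5 * Uv))))) * ((6 * (H * Wx)) * (6 * (H * Wy)))))) := by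
  have hA : 1 ≤ A0 * A1 * A2 * A3 := by
    have a1 := mul_le_mul h0 h1 (by norm_num) (by linarith)
    have a2 := mul_le_mul a1 h2 (by norm_num) (by linarith)
    have a3 := mul_le_mul a2 h3 (by norm_num) (by linarith)
    linarith
  have hprod : ∀ c ∈ C, nrm (c.k0 * c.k1 * c.k2 * c.k3) ≤ 16 * (A0 * A1 * A2 * A3) := by
    intro c hc
    have z := (hC c hc).sz
    rw [nrm_mul, nrm_mul, nrm_mul]
    refine (mul3_le (nrm_nonneg _) (nrm_nonneg _) (nrm_nonneg _) (nrm_nonneg _) z.n0 z.n1 z.n2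
      z.n3).trans (by linarith)
  have hsq : ∀ c ∈ C, Int.sqrt (c.k0 * c.k1 * c.k2 * c.k3).norm *
      Int.sqrt (c.k0 * c.k1 * c.k2 * c.k3).norm = (c.k0 * c.k1 * c.k2 * c.k3).norm := by
    intro c hc
    have z := (hC c hc).sz
    obtain ⟨r, hr⟩ := norm_isSquare (hC c hc).x0 (hG c hc).1
    have e : (c.k0 * c.k1 * c.k2 * c.k3).norm = r * r := by
      rw [← hr]
      simp only [Zsqrtd.norm_mul, Zsqrtd.norm_conj, isUnit_iff_norm.1 z.e]; ring
    rw [e, Int.sqrt_eq, Int.natAbs_mul_self']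
  have hcr : Cnt {n : ℤ | |(n : ℝ)| ≤ 16 * (A0 * A1 * A2 * A3)} (33 * (A0 * A1 * A2 * A3)) :=
    (cnt_int_Icc _ (by linarith)).le (by linarith)
  have hU : (0 : ℝ) ≤ (4 * (4 * ((5 * Ut) * ((5 * Uu) * (5 * Uv))))) *
      ((6 * (H * Wx)) * (6 * (H * Wy))) := by positivity
  refine Cnt.fiber (f := fun c : Cd => Int.sqrt (c.k0 * c.k1 * c.k2 * c.k3).norm)
    (hcr.subset ?_) (by positivity) ?_
  · rintro _ ⟨c, hc, rfl⟩
    have h := hsq c hc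
    have h' : ((Int.sqrt (c.k0 * c.k1 * c.k2 * c.k3).norm : ℤ) : ℝ) ^ 2 =
        nrm (c.k0 * c.k1 * c.k2 * c.k3) ^ 2 := by
      have h3 := congrArg (fun n : ℤ => (n : ℝ)) h
      rw [Int.cast_mul] at h3
      rw [nrm_sq, pow_two]; exact h3
    have h2 := (sq_eq_sq_iff_abs_eq_abs _ _).1 h'
    rw [abs_of_nonneg (nrm_nonneg _)] at h2
    exact h2.le.trans (hprod c hc)
  rintro _ ⟨c0, hc0, rfl⟩
  simp only
  set r := Int.sqrt (c0.k0 * c0.k1 * c0.k2 * c0.k3).norm with hr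
  have z0 := (hC c0 hc0).sz
  have hP0 : c0.k0 * c0.k1 * c0.k2 * c0.k3 ≠ 0 :=
    mul_ne_zero (mul_ne_zero (mul_ne_zero z0.k0 z0.k1) z0.k2) z0.k3
  have hd : Cnt {d : GI | d ∣ ((r * r : ℤ) : GI)} M := by
    rw [hr, hsq c0 hc0]
    apply hM
    · exact_mod_cast (GaussianInt.norm_pos.2 hP0).ne'
    · rw [nrm_int, ← nrm_sq, abs_of_nonneg (sq_nonneg _)]
      refine le_trans ?_ hZ
      have := hprod c0 hc0
      have := nrm_nonneg (c0.k0 * c0.k1 * c0.k2 * c0.k3)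
      gcongr
  refine Cnt.fiber (f := fun c : Cd => (c.k0, c.k1, c.k2, c.k3))
    ((cnt_prod hd (cnt_prod hd (cnt_prod hd hd))).subset ?_) hU ?_
  · rintro _ ⟨c, ⟨hc, he⟩, rfl⟩
    have h := hsq c hc
    have key : ((r * r : ℤ) : GI) = (c.k0 * c.k1 * c.k2 * c.k3) * star (c.k0 * c.k1 * c.k2 * c.k3)
        := by rw [mul_star_eq, ← h, he]
    refine ⟨?_, ?_, ?_, ?_⟩
    · exact ⟨(c.k1 * c.k2 * c.k3) * star (c.k0 * c.k1 * c.k2 * c.k3), by rw [key]; ring⟩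
    · exact ⟨(c.k0 * c.k2 * c.k3) * star (c.k0 * c.k1 * c.k2 * c.k3), by rw [key]; ring⟩
    · exact ⟨(c.k0 * c.k1 * c.k3) * star (c.k0 * c.k1 * c.k2 * c.k3), by rw [key]; ring⟩
    · exact ⟨(c.k0 * c.k1 * c.k2) * star (c.k0 * c.k1 * c.k2 * c.k3), by rw [key]; ring⟩
  rintro _ ⟨c1, ⟨hc1, hcr1⟩, rfl⟩
  refine Cnt.fiber (f := fun c : Cd => (c.e, c.f, c.t, c.u, c.v))
    ((cnt_prod cnt_units (cnt_prod cnt_units (cnt_prod (cnt_int2 ht) (cnt_prod (cnt_int2 hu)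
      (cnt_int2 hv))))).subset ?_) (by positivity) ?_
  · rintro _ ⟨c, ⟨⟨hc, -⟩, -⟩, rfl⟩
    have h := (hC c hc).sz
    exact ⟨h.e, h.f, h.nt, h.nu, h.nv⟩
  rintro _ ⟨c2, ⟨⟨hc2, hcr2⟩, hck2⟩, rfl⟩
  have z2 := (hC c2 hc2).sz
  have q1 : c2.k2 * c2.k3 * star (c2.k0 * c2.k1 * c2.e) ≠ 0 := mul_ne_zero
    (mul_ne_zero z2.k2 z2.k3) (star_ne_zero' (mul_ne_zero (mul_ne_zero z2.k0 z2.k1) z2.e.ne_zero))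
  have q2 : c2.k1 * c2.k3 * star (c2.k0 * c2.k2 * c2.f) ≠ 0 := mul_ne_zero
    (mul_ne_zero z2.k1 z2.k3) (star_ne_zero' (mul_ne_zero (mul_ne_zero z2.k0 z2.k2) z2.f.ne_zero))
  refine Cnt.of_injOn (f := fun c : Cd => (x c, y c))
    ((cnt_prod (line_count' q1 (B := H * Wx) (by positivity))
      (line_count' q2 (B := H * Wy) (by positivity))).subset ?_) ?_
  · rintro _ ⟨c, ⟨⟨⟨hc, -⟩, hk⟩, hu⟩, rfl⟩
    have hk' := hk.trans hck2.symm
    simp only [Prod.mk.injEq] at hk' hu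
    obtain ⟨e0, e1, e2, e3⟩ := hk'
    obtain ⟨ee, ef, et, eu, ev⟩ := hu
    have h := hC c hc
    have g := hG c hc
    rw [← e0, ← e1, ← e2, ← e3, ← ee, ← ef]
    exact ⟨⟨h.x0, h.hx, g.1⟩, ⟨h.y0, h.hy, g.2⟩⟩
  · rintro c ⟨⟨⟨hc, -⟩, hk⟩, hu⟩ c' ⟨⟨⟨hc', -⟩, hk'⟩, hu'⟩ h
    have hkk := hk.trans hk'.symm
    have huu := hu.trans hu'.symm
    simp only [Prod.mk.injEq] at hkk huu h
    obtain ⟨e0, e1, e2, e3⟩ := hkk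
    obtain ⟨ee, ef, et, eu, ev⟩ := huu
    obtain ⟨ex, ey⟩ := h
    refine Cd.ext e0 e1 e2 e3 ?_ et eu ev ee ef
    have r1 := (hC c hc).rel
    have r2 := (hC c' hc').rel
    simp only [Cd.a, Cd.b, Cd.c', Cd.d] at r1 r2
    rw [← e0, ← e1, ← e2, ← e3, ← et, ← eu, ← ev, ← ee, ← ef, ← ex, ← ey] at r2
    have z := (hC c hc).sz
    have hne : c.k2 * c.k3 * x c ≠ 0 := mul_ne_zero (mul_ne_zero z.k2 z.k3) (hC c hc).x0
    have : (c.s : GI) = (c'.s : GI) := by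
      apply mul_left_cancel₀ hne
      linear_combination r1 - r2
    exact_mod_cast this
end

end ACQ


namespace ACQ

section
variable {A0 A1 A2 A3 Us Ut Uu Uv Wx Wy H : ℝ} {C : Set Cd} {x y : Cd → GI} {M Z R : ℝ}

/-- bound for the number of classes that carry a short relation -/
theorem class_bound (h0 : 1 ≤ A0) (h1 : 1 ≤ A1) (h2 : 1 ≤ A2) (h3 : 1 ≤ A3) (ht : 1 ≤ Ut)
    (hu : 1 ≤ Uu) (hv : 1 ≤ Uv) (hwx : 1 ≤ Wx) (hwy : 1 ≤ Wy) (hH : 0 ≤ H) (hR : 0 ≤ R)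
    (hC : ∀ c ∈ C, CdOK A0 A1 A2 A3 Us Ut Uu Uv Wx Wy H c (x c) (y c))
    (hM : ∀ z : GI, z ≠ 0 → nrm z ≤ Z → Cnt {d | d ∣ z} M) (hM0 : 0 ≤ M)
    (z1 : (16 * (A0 * A1 * A2 * A3)) ^ 2 ≤ Z) (z2 : (2 * A0) ^ 2 * (2 * Ut) * (2 * Uv) ≤ Z)
    (z3 : (2 * A1) ^ 2 * (2 * Ut) * (2 * Uu) ≤ Z) (z4 : 16 * H * R ≤ Z)
    (r1 : A2 * A3 * Us * Wx ≤ R) (r2 : A0 * A1 * Ut * Wx ≤ R) (r3 : A1 * A3 * Uu * Wy ≤ R)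
    (r4 : A0 * A2 * Uv * Wy ≤ R) {N : ℝ} (hN : Cnt (GS (16 * H * R)) N) :
    Cnt C (N * (M * (M * (M * (M * (M * (M * (M * (M * (4 * 4))))))))) +
      (33 * (A0 * A1 * A2 * A3)) * ((M * (M * (M * M))) * ((4 * (4 * ((5 * Ut) * ((5 * Uu) *
      (5 * Uv))))) * ((6 * (H * Wx)) * (6 * (H * Wy))))) +
      (36 * A0 ^ 2) * ((36 * A1 ^ 2) * ((36 * A2 ^ 2) * ((5 * Ut) * (5 * Uv)))) *
      (M * (M * (M * (4 * 4)))) +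
      (36 * A0 ^ 2) * ((36 * A1 ^ 2) * ((36 * A3 ^ 2) * ((5 * Ut) * (5 * Uu)))) *
      (M * (M * (M * (4 * 4))))) := by
  set Gd : Set Cd := {c | c ∈ C ∧ Good (cD c (x c) (y c))}
  set Cl : Set Cd := {c | c ∈ C ∧ ((c.k2 * c.k3 * star (c.k0 * c.k1 * c.e) * x c ^ 2).im = 0 ∧
      (c.k1 * c.k3 * star (c.k0 * c.k2 * c.f) * y c ^ 2).im = 0)}
  set C3 : Set Cd := {c | c ∈ C ∧ c.a * x c + c.d * star (y c) = 0}
  set C2 : Set Cd := {c | c ∈ C ∧ c.a * x c = c.c' * y c}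
  have b1 : Cnt Gd _ := cls_good (C := Gd) (fun c hc => hC c hc.1) hM hM0 z4 hN
    (fun c hc => ⟨hc.2, cD_nrm (hC c hc.1) hH hR r1 r2 r3 r4⟩)
  have b2 : Cnt Cl _ := cls_col (C := Cl) h0 h1 h2 h3 ht hu hv hwx hwy hH
    (fun c hc => hC c hc.1) hM hM0 z1 (fun c hc => hc.2)
  have b3 : Cnt C3 _ := cls_03 (C := C3) h0 h1 h2 ht hv
    (fun c hc => hC c hc.1) hM hM0 z2 (fun c hc => hc.2)
  have b4 : Cnt C2 _ := cls_12 (C := C2) h0 h1 h3 ht hu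
    (fun c hc => hC c hc.1) hM hM0 z3 (fun c hc => hc.2)
  refine (((b1.union b2).union b3).union b4).subset ?_
  intro c hc
  by_cases g3 : c.a * x c + c.d * star (y c) = 0
  · exact Or.inl (Or.inr ⟨hc, g3⟩)
  by_cases g2 : c.a * x c = c.c' * y c
  · exact Or.inr ⟨hc, g2⟩
  by_cases g1 : (c.k2 * c.k3 * star (c.k0 * c.k1 * c.e) * x c ^ 2).im = 0 ∧
      (c.k1 * c.k3 * star (c.k0 * c.k2 * c.f) * y c ^ 2).im = 0
  · exact Or.inl (Or.inl (Or.inr ⟨hc, g1⟩))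
  · exact Or.inl (Or.inl (Or.inl ⟨hc, cP_good (hC c hc) g3 g2 g1⟩))
end

/-- the class of a parameter -/
noncomputable def cdOf (o i j k : Fin 4) (P : Par) : Cd where
  k0 := P.κ o
  k1 := P.κ i
  k2 := P.κ j
  k3 := P.κ k
  s := cont (P.F o i)
  t := cont (P.F j k)
  u := cont (P.F o j)
  v := cont (P.F i k)
  e := prim (P.F j k) / star (prim (P.F o i))
  f := prim (P.F i k) / star (prim (P.F o j))

theorem unit_div {p q e : GI} (hq : q ≠ 0) (he : IsUnit e) (h : p = e * q) :
    IsUnit (p / q) ∧ p / q * q = p := by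
  have : p / q = e := by rw [h, mul_div_cancel_right₀ _ hq]
  rw [this]; exact ⟨he, h.symm⟩

section
variable {A : Fin 4 → ℝ} {U W : Fin 4 → Fin 4 → ℝ} {o i j k : Fin 4} {P P' : Par}

theorem cdOf_e (hq : Q4 o i j k) (hv : Valid P) : IsUnit (cdOf o i j k P).e ∧
    (cdOf o i j k P).e * star (prim (P.F o i)) = prim (P.F j k) := by
  obtain ⟨e, he, h⟩ := hv.conj o i j k hq
  have hne : o ≠ i := by unfold Q4 at hq; tauto
  exact unit_div (star_ne_zero' (prim_ne_zero (hv.Fne o i hne))) he h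

theorem cdOf_f (hq : Q4 o i j k) (hv : Valid P) : IsUnit (cdOf o i j k P).f ∧
    (cdOf o i j k P).f * star (prim (P.F o j)) = prim (P.F i k) := by
  obtain ⟨e, he, h⟩ := hv.conj o j i k (by unfold Q4 at *; tauto)
  have hne : o ≠ j := by unfold Q4 at hq; tauto
  exact unit_div (star_ne_zero' (prim_ne_zero (hv.Fne o j hne))) he h

theorem cdOf_sz (hq : Q4 o i j k) (hv : Valid P) (hb : InBox A U W P) :
    CdSz (A o) (A i) (A j) (A k) (U o i) (U j k) (U o j) (U i k) (cdOf o i j k P) := by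
  have h1 : o ≠ i := by unfold Q4 at hq; tauto
  have h2 : j ≠ k := by unfold Q4 at hq; tauto
  have h3 : o ≠ j := by unfold Q4 at hq; tauto
  have h4 : i ≠ k := by unfold Q4 at hq; tauto
  exact ⟨hv.κne _, hv.κne _, hv.κne _, hv.κne _, hb.κ2 _, hb.κ2 _, hb.κ2 _, hb.κ2 _,
    cont_pos (hv.Fne _ _ h1), cont_pos (hv.Fne _ _ h2), cont_pos (hv.Fne _ _ h3),
    cont_pos (hv.Fne _ _ h4), int_mem hb h1, int_mem hb h2, int_mem hb h3, int_mem hb h4,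
    (cdOf_e hq hv).1, (cdOf_f hq hv).1⟩

theorem cdOf_rel (hq : Q4 o i j k) (hv : Valid P) :
    (cdOf o i j k P).a * prim (P.F o i) - (cdOf o i j k P).b * star (prim (P.F o i)) =
    (cdOf o i j k P).c' * prim (P.F o j) - (cdOf o i j k P).d * star (prim (P.F o j)) := by
  have e1 := (cdOf_e hq hv).2
  have e2 := (cdOf_f hq hv).2
  have t1 := hv.tri j o i k (by unfold Q4 at *; tauto)
  have t2 := hv.tri i o j k (by unfold Q4 at *; tauto)
  have c1 := cont_mul_prim (P.F o i)
  have c2 := cont_mul_prim (P.F o j)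
  have c3 := cont_mul_prim (P.F j k)
  have c4 := cont_mul_prim (P.F i k)
  have ea : (cdOf o i j k P).a = P.κ j * P.κ k * cont (P.F o i) := rfl
  have eb : (cdOf o i j k P).b = P.κ o * P.κ i * cont (P.F j k) * (cdOf o i j k P).e := rfl
  have ec : (cdOf o i j k P).c' = P.κ i * P.κ k * cont (P.F o j) := rfl
  have ed : (cdOf o i j k P).d = P.κ o * P.κ j * cont (P.F i k) * (cdOf o i j k P).f := rfl
  rw [ea, eb, ec, ed]
  linear_combination P.κ j * t1 - P.κ i * t2 + P.κ j * P.κ k * c1 - P.κ i * P.κ k * c2 -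
    P.κ o * P.κ i * c3 + P.κ o * P.κ j * c4 - P.κ o * P.κ i * cont (P.F j k) * e1 +
    P.κ o * P.κ j * cont (P.F i k) * e2

theorem cdOf_ef (hq : Q4 o i j k) (hv : Valid P) :
    ((cdOf o i j k P).e * star (cdOf o i j k P).f).im = 0 := by
  have e1 := (cdOf_e hq hv).2
  have e2 := (cdOf_f hq hv).2
  have h1 : o ≠ i := by unfold Q4 at hq; tauto
  have h2 : j ≠ k := by unfold Q4 at hq; tauto
  have h3 : o ≠ j := by unfold Q4 at hq; tauto
  have h4 : i ≠ k := by unfold Q4 at hq; tauto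
  have hc := hv.cross o i j k hq
  have hsi : ∀ n : ℤ, star (n : GI) = (n : GI) := by intro n; apply Zsqrtd.ext <;> simp
  set e := (cdOf o i j k P).e
  set f := (cdOf o i j k P).f
  have p1 := cont_pos (hv.Fne _ _ h1)
  have p2 := cont_pos (hv.Fne _ _ h2)
  have p3 := cont_pos (hv.Fne _ _ h3)
  have p4 := cont_pos (hv.Fne _ _ h4)
  have n1 := GaussianInt.norm_pos.2 (prim_ne_zero (hv.Fne _ _ h1))
  have n2 := GaussianInt.norm_pos.2 (prim_ne_zero (hv.Fne _ _ h3))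
  have hpos : 0 < cont (P.F o i) * cont (P.F j k) * cont (P.F o j) * cont (P.F i k) *
    (prim (P.F o i)).norm * (prim (P.F o j)).norm := by positivity
  apply im_zero_cancel (n := -(cont (P.F o i) * cont (P.F j k) * cont (P.F o j) * cont (P.F i k) *
    (prim (P.F o i)).norm * (prim (P.F o j)).norm)) (by omega)
  rw [← hc]
  congr 1
  rw [hv.anti i k]
  conv_rhs => rw [← cont_mul_prim (P.F o i), ← cont_mul_prim (P.F j k), ← cont_mul_prim (P.F o j),
    ← cont_mul_prim (P.F i k), ← e1, ← e2]
  push_cast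
  rw [← mul_star_eq, ← mul_star_eq]
  simp only [star_mul, star_neg, star_star, hsi]
  ring

theorem cdOf_nab (hq : Q4 o i j k) (hv : Valid P) :
    (cdOf o i j k P).a.norm ≠ (cdOf o i j k P).b.norm := by
  have e1 := (cdOf_e hq hv)
  have h1 : o ≠ i := by unfold Q4 at hq; tauto
  have n1 := GaussianInt.norm_pos.2 (prim_ne_zero (hv.Fne _ _ h1))
  have ha := hv.asym o i j k hq
  intro h
  apply ha
  have ea : (cdOf o i j k P).a = P.κ j * P.κ k * cont (P.F o i) := rfl
  have eb : (cdOf o i j k P).b = P.κ o * P.κ i * cont (P.F j k) * (cdOf o i j k P).e := rfl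
  rw [ea, eb] at h
  have m1 := congrArg Zsqrtd.norm (cont_mul_prim (P.F j k))
  have m2 := congrArg Zsqrtd.norm (cont_mul_prim (P.F o i))
  have m3 := congrArg Zsqrtd.norm e1.2
  simp only [Zsqrtd.norm_mul, Zsqrtd.norm_conj, isUnit_iff_norm.1 e1.1] at h m1 m2 m3 ⊢
  rw [← m1, ← m2, ← m3]
  linear_combination -(prim (P.F o i)).norm * h

theorem cdOf_ncd (hq : Q4 o i j k) (hv : Valid P) :
    (cdOf o i j k P).c'.norm ≠ (cdOf o i j k P).d.norm := by
  have e1 := (cdOf_f hq hv)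
  have ha := hv.asym o j i k (by unfold Q4 at *; tauto)
  intro h
  apply ha
  have ea : (cdOf o i j k P).c' = P.κ i * P.κ k * cont (P.F o j) := rfl
  have eb : (cdOf o i j k P).d = P.κ o * P.κ j * cont (P.F i k) * (cdOf o i j k P).f := rfl
  rw [ea, eb] at h
  have m1 := congrArg Zsqrtd.norm (cont_mul_prim (P.F i k))
  have m2 := congrArg Zsqrtd.norm (cont_mul_prim (P.F o j))
  have m3 := congrArg Zsqrtd.norm e1.2
  simp only [Zsqrtd.norm_mul, Zsqrtd.norm_conj, isUnit_iff_norm.1 e1.1] at h m1 m2 m3 ⊢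
  rw [← m1, ← m2, ← m3]
  linear_combination -(prim (P.F o j)).norm * h

theorem cdOf_inj (hq : Q4 o i j k) (hv : Valid P) (hv' : Valid P')
    (hc : cdOf o i j k P = cdOf o i j k P') (hx : prim (P.F o i) = prim (P'.F o i))
    (hy : prim (P.F o j) = prim (P'.F o j)) : P = P' := by
  have k0 : P.κ o = P'.κ o := congrArg Cd.k0 hc
  have k1 : P.κ i = P'.κ i := congrArg Cd.k1 hc
  have k2 : P.κ j = P'.κ j := congrArg Cd.k2 hc
  have k3 : P.κ k = P'.κ k := congrArg Cd.k3 hc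
  have s : cont (P.F o i) = cont (P'.F o i) := congrArg Cd.s hc
  have t : cont (P.F j k) = cont (P'.F j k) := congrArg Cd.t hc
  have u : cont (P.F o j) = cont (P'.F o j) := congrArg Cd.u hc
  have v : cont (P.F i k) = cont (P'.F i k) := congrArg Cd.v hc
  have f1 : P.F o i = P'.F o i := eq_of_cont_prim s hx
  have f2 : P.F o j = P'.F o j := eq_of_cont_prim u hy
  have f3 : P.F j k = P'.F j k := by
    refine eq_of_cont_prim t ?_
    rw [← (cdOf_e hq hv).2, ← (cdOf_e hq hv').2, hc, hx]
  have f4 : P.F i k = P'.F i k := by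
    refine eq_of_cont_prim v ?_
    rw [← (cdOf_f hq hv).2, ← (cdOf_f hq hv').2, hc, hy]
  have f4' : P.F k i = P'.F k i := by rw [hv.anti, hv'.anti, f4]
  have f5 : P.F o k = P'.F o k := by
    have t1 := hv.tri j o i k (by unfold Q4 at *; tauto)
    have t2 := hv'.tri j o i k (by unfold Q4 at *; tauto)
    rw [← k0, ← k1, ← k3, ← f1, ← f4] at t2
    have : P.F k o = P'.F k o := by
      apply mul_left_cancel₀ (hv.κne i); linear_combination t1 - t2
    rw [hv.anti, hv'.anti, this]
  have f6 : P.F i j = P'.F i j := by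
    have t1 := hv.tri k o i j (by unfold Q4 at *; tauto)
    have t2 := hv'.tri k o i j (by unfold Q4 at *; tauto)
    rw [hv.anti o j] at t1
    rw [hv'.anti o j, ← k0, ← k1, ← k2, ← f1, ← f2] at t2
    apply mul_left_cancel₀ (hv.κne o); linear_combination t1 - t2
  exact par_ext hv hv' hq k0 k1 k2 k3 f1 f2 f5 f6 f3 f4'
end

theorem lin_of_rel {a b c d : GI} (hn : c.norm ≠ d.norm) : ∃ m11 m12 m21 m22 : ℝ,
    ∀ x y : GI, a * x - b * star x = c * y - d * star y →
      (y.re : ℝ) = m11 * x.re + m12 * x.im ∧ (y.im : ℝ) = m21 * x.re + m22 * x.im := by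
  have hD : ((c.norm : ℝ) - d.norm) ≠ 0 := by
    rw [sub_ne_zero]; exact_mod_cast hn
  set p : GI := star c * a - d * star b
  set q : GI := d * star a - star c * b
  refine ⟨(p.re + q.re) / (c.norm - d.norm), (q.im - p.im) / (c.norm - d.norm),
    (p.im + q.im) / (c.norm - d.norm), (p.re - q.re) / (c.norm - d.norm), ?_⟩
  intro x y h
  have h' := congrArg star h
  simp only [star_sub, star_mul, star_star] at h'
  have key : ((c.norm - d.norm : ℤ) : GI) * y = p * x + q * star x := by
    push_cast
    rw [← mul_star_eq, ← mul_star_eq]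
    linear_combination (-star c) * h - d * h'
  have k1 := congrArg Zsqrtd.re key
  have k2 := congrArg Zsqrtd.im key
  simp only [Zsqrtd.re_mul, Zsqrtd.im_mul, Zsqrtd.re_intCast, Zsqrtd.im_intCast, Zsqrtd.re_add,
    Zsqrtd.im_add, Zsqrtd.re_star, Zsqrtd.im_star] at k1 k2
  have k1' : ((c.norm : ℝ) - d.norm) * y.re = (p.re + q.re) * x.re + (q.im - p.im) * x.im := by
    have := congrArg (fun n : ℤ => (n : ℝ)) k1
    push_cast at this; linarith
  have k2' : ((c.norm : ℝ) - d.norm) * y.im = (p.im + q.im) * x.re + (p.re - q.re) * x.im := by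
    have := congrArg (fun n : ℤ => (n : ℝ)) k2
    push_cast at this; linarith
  constructor
  · field_simp; linarith
  · field_simp; linarith

end ACQ


namespace ACQ

section
variable {A : Fin 4 → ℝ} {U W : Fin 4 → Fin 4 → ℝ} {o i j k : Fin 4} {S : Set Par}

/-- the fibre of the class map -/
def fib (o i j k : Fin 4) (S : Set Par) (c : Cd) : Set Par := {P | P ∈ S ∧ cdOf o i j k P = c}

theorem fib_map_inj (hq : Q4 o i j k) (hS : Cls A U W S) (c : Cd) :
    Set.InjOn (fun P : Par => (prim (P.F o i), prim (P.F o j))) (fib o i j k S c) := by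
  rintro P ⟨hP, hc⟩ P' ⟨hP', hc'⟩ h
  simp only [Prod.mk.injEq] at h
  exact cdOf_inj hq (hS P hP).1 (hS P' hP').1 (hc.trans hc'.symm) h.1 h.2

theorem fib_cnt (bx : Bx A U W) (hq : Q4 o i j k) (hS : Cls A U W S) (c : Cd) :
    Cnt (fib o i j k S c) ((36 * W o i ^ 2) * (36 * W o j ^ 2)) := by
  have h1 : o ≠ i := by unfold Q4 at hq; tauto
  have h3 : o ≠ j := by unfold Q4 at hq; tauto
  refine Cnt.of_injOn (f := fun P : Par => (prim (P.F o i), prim (P.F o j)))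
    ((cnt_prod (cnt_disc2 (bx.W1 o i)) (cnt_disc2 (bx.W1 o j))).subset ?_) (fib_map_inj hq hS c)
  rintro _ ⟨P, ⟨hP, -⟩, rfl⟩
  exact ⟨(hS P hP).2.w2 o i h1, (hS P hP).2.w2 o j h3⟩

theorem fib_pair (bx : Bx A U W) (hq : Q4 o i j k) (hS : Cls A U W S) (c : Cd) {n : ℕ}
    (hn : 4 ≤ n) (hc : (4 : ℝ) ^ n < (fib o i j k S c).ncard) :
    ∃ x y : GI, CdOK (A o) (A i) (A j) (A k) (U o i) (U j k) (U o j) (U i k) (W o i) (W o j)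
      (20 / 2 ^ n) c x y := by
  have h1 : o ≠ i := by unfold Q4 at hq; tauto
  have h3 : o ≠ j := by unfold Q4 at hq; tauto
  have hq16 : (16 : ℝ) ≤ 2 ^ n := by
    calc (16 : ℝ) = 2 ^ 4 := by norm_num
      _ ≤ 2 ^ n := pow_le_pow_right₀ (by norm_num) hn
  have h4 : (4 : ℝ) ^ n = (2 ^ n) ^ 2 := by rw [← pow_mul, mul_comm, pow_mul]; norm_num
  set q : ℝ := 2 ^ n with hqdef
  have hne : (fib o i j k S c).Nonempty := by
    by_contra h
    rw [Set.not_nonempty_iff_eq_empty] at h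
    rw [h, Set.ncard_empty, h4] at hc
    push_cast at hc
    nlinarith
  obtain ⟨P0, hP0, hc0⟩ := hne
  have v0 := (hS P0 hP0).1
  have sz : CdSz (A o) (A i) (A j) (A k) (U o i) (U j k) (U o j) (U i k) c := by
    rw [← hc0]; exact cdOf_sz hq v0 (hS P0 hP0).2
  have ef : (c.e * star c.f).im = 0 := by rw [← hc0]; exact cdOf_ef hq v0
  have nab : c.a.norm ≠ c.b.norm := by rw [← hc0]; exact cdOf_nab hq v0
  have ncd : c.c'.norm ≠ c.d.norm := by rw [← hc0]; exact cdOf_ncd hq v0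
  set T := (fun P : Par => (prim (P.F o i), prim (P.F o j))) '' fib o i j k S c with hT
  have hrel : ∀ t ∈ T, c.a * t.1 - c.b * star t.1 = c.c' * t.2 - c.d * star t.2 := by
    rintro _ ⟨P, ⟨hP, hPc⟩, rfl⟩
    rw [← hPc]; exact cdOf_rel hq (hS P hP).1
  have hbd : ∀ t ∈ T, nrm t.1 ≤ 2 * W o i ∧ nrm t.2 ≤ 2 * W o j := by
    rintro _ ⟨P, ⟨hP, hPc⟩, rfl⟩
    exact ⟨(hS P hP).2.w2 o i h1, (hS P hP).2.w2 o j h3⟩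
  by_contra hno
  push Not at hno
  obtain ⟨m11, m12, m21, m22, hm⟩ := lin_of_rel (a := c.a) (b := c.b) ncd
  have hw1 := bx.W1 o i
  have hw2 := bx.W1 o j
  have hcp : Cnt T (81 / (10 / q) ^ 2) := by
    refine close_pair (X := W o i) (Y := W o j) (by linarith) (by linarith) (by positivity)
      ((div_le_one (by linarith)).2 (by linarith)) (fun t ht => hm t.1 t.2 (hrel t ht)) hbd ?_
    intro t ht t' ht' hx hy
    by_contra htt
    apply hno (t.1 - t'.1) (t.2 - t'.2)
    refine ⟨sz, ef, nab, ncd, ?_, ?_, ?_, ?_⟩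
    · rw [star_sub, star_sub]; linear_combination hrel t ht - hrel t' ht'
    · by_contra hz
      push Not at hz
      exact htt (Prod.ext (sub_eq_zero.1 hz.1) (sub_eq_zero.1 hz.2))
    · refine hx.trans (le_of_eq ?_); ring
    · refine hy.trans (le_of_eq ?_); ring
  have hnc : (T.ncard : ℝ) = (fib o i j k S c).ncard := by
    rw [hT, (fib_map_inj hq hS c).ncard_image]
  have h5 := hcp.2
  rw [hnc] at h5
  have h6 : 81 / (10 / q) ^ 2 = 81 / 100 * q ^ 2 := by field_simp; norm_num
  rw [h6] at h5
  rw [h4] at hc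
  nlinarith

theorem optB (bx : Bx A U W) (hq : Q4 o i j k) (hS : Cls A U W S)
    (hW : ∀ i j k l, Q4 i j k l → W k l = W i j) {R M Z Λ E Wm : ℝ} {J : ℕ}
    (hbox : ∀ i j k l, Q4 i j k l → A i * A j * U k l * W k l ≤ R)
    (hM : ∀ z : GI, z ≠ 0 → nrm z ≤ Z → Cnt {d | d ∣ z} M) (hM0 : 0 ≤ M) (hZ : 320 * R ^ 4 ≤ Z)
    (hΛ : 400 ≤ Λ) (hJ : 1296 * R ^ 4 ≤ 4 ^ J) (hWm : Wm = W o i ∨ Wm = W o j) (hE : 0 ≤ E)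
    (hG : ∀ n : ℕ, Λ < 4 ^ (n + 1) → ∃ N, Cnt (GS (320 * R / 2 ^ n)) N ∧ 4 ^ (n + 1) * N ≤ E) :
    Cnt S ((36 * A o ^ 2) * ((36 * A i ^ 2) * ((36 * A j ^ 2) * ((36 * A k ^ 2) *
      ((5 * U o i) * ((5 * U j k) * ((5 * U o j) * ((5 * U i k) * (4 * 4)))))))) * Λ +
      J * (E * (M * (M * (M * (M * (M * (M * (M * (M * (4 * 4))))))))) +
      1600 * ((33 * (A o * A i * A j * A k)) * ((M * (M * (M * M))) * ((4 * (4 * ((5 * U j k) *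
        ((5 * U o j) * (5 * U i k))))) * ((6 * W o i) * (6 * W o j))))) +
      (1600 * Wm ^ 2) * ((36 * A o ^ 2) * ((36 * A i ^ 2) * ((36 * A j ^ 2) * ((5 * U j k) *
        (5 * U i k)))) * (M * (M * (M * (4 * 4))))) +
      (1600 * Wm ^ 2) * ((36 * A o ^ 2) * ((36 * A i ^ 2) * ((36 * A k ^ 2) * ((5 * U j k) *
        (5 * U o j)))) * (M * (M * (M * (4 * 4))))))) := by
  have a0 := bx.A1 o
  have a1 := bx.A1 i
  have a2 := bx.A1 j
  have a3 := bx.A1 k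
  have u1 := bx.U1 o i
  have u2 := bx.U1 j k
  have u3 := bx.U1 o j
  have u4 := bx.U1 i k
  have w1 := bx.W1 o i
  have w2 := bx.W1 o j
  have q1 : Q4 j k o i := by unfold Q4 at *; tauto
  have q2 : Q4 i k o j := by unfold Q4 at *; tauto
  have q3 : Q4 o j i k := by unfold Q4 at *; tauto
  have r1 := hbox j k o i q1
  have r2 := hbox o i j k hq
  have r3 := hbox i k o j q2
  have r4 := hbox o j i k q3
  rw [hW o i j k hq] at r2
  rw [hW o j i k q3] at r4
  have mm : ∀ a b c d : ℝ, 1 ≤ a → 1 ≤ b → 1 ≤ c → 1 ≤ d → a * b * c ≤ a * b * c * d := by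
    intro a b c d ha hb hc hd
    exact le_mul_of_one_le_right (by positivity) hd
  have m2 : ∀ a b c : ℝ, 1 ≤ a → 1 ≤ b → 1 ≤ c → a * b ≤ a * b * c := by
    intro a b c ha hb hc
    exact le_mul_of_one_le_right (by positivity) hc
  have p1 := (mm _ _ _ _ a2 a3 u1 w1).trans r1
  have p2 := (mm _ _ _ _ a0 a1 u2 w1).trans r2
  have p4 := (mm _ _ _ _ a0 a2 u4 w2).trans r4
  have p3 := (mm _ _ _ _ a1 a3 u3 w2).trans r3
  have s1 := (m2 _ _ _ a2 a3 u1).trans p1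
  have s2 := (m2 _ _ _ a0 a1 u2).trans p2
  have hR1 : 1 ≤ R := by
    have := one_le_mul_of_one_le_of_one_le a0 a1
    linarith
  have hwR : ∀ a b c d : ℝ, 1 ≤ a → 1 ≤ b → 1 ≤ c → 1 ≤ d → d ≤ a * b * c * d := by
    intro a b c d ha hb hc hd
    exact le_mul_of_one_le_left (by linarith) (one_le_mul_of_one_le_of_one_le
      (one_le_mul_of_one_le_of_one_le ha hb) hc)
  have hwx : W o i ≤ R := (hwR _ _ _ _ a2 a3 u1 w1).trans r1
  have hwy : W o j ≤ R := (hwR _ _ _ _ a1 a3 u3 w2).trans r3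
  have hR24 : R ^ 2 ≤ R ^ 4 := pow_le_pow_right₀ hR1 (by norm_num)
  have hR14 : R ≤ R ^ 4 := le_self_pow₀ hR1 (by norm_num)
  have hR4 : 0 ≤ R ^ 4 := by positivity
  have z1 : (16 * (A o * A i * A j * A k)) ^ 2 ≤ Z := by
    have h : (A o * A i) * (A j * A k) ≤ R * R := mul_le_mul s2 s1 (by positivity) (by linarith)
    have h' : (0 : ℝ) ≤ (A o * A i) * (A j * A k) := by positivity
    calc (16 * (A o * A i * A j * A k)) ^ 2 = 256 * ((A o * A i) * (A j * A k)) ^ 2 := by ring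
      _ ≤ 256 * (R * R) ^ 2 := by gcongr
      _ = 256 * R ^ 4 := by ring
      _ ≤ Z := by linarith
  have z2 : (2 * A o) ^ 2 * (2 * U j k) * (2 * U i k) ≤ Z := by
    have h : (A o * A i * U j k) * (A o * A j * U i k) ≤ R * R :=
      mul_le_mul p2 p4 (by positivity) (by linarith)
    have h2 : A o ^ 2 * U j k * U i k ≤ (A o ^ 2 * U j k * U i k) * (A i * A j) :=
      le_mul_of_one_le_right (by positivity) (one_le_mul_of_one_le_of_one_le a1 a2)
    nlinarith only [h, h2, hZ, hR24, hR4]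
  have z3 : (2 * A i) ^ 2 * (2 * U j k) * (2 * U o j) ≤ Z := by
    have h : (A o * A i * U j k) * (A i * A k * U o j) ≤ R * R :=
      mul_le_mul p2 p3 (by positivity) (by linarith)
    have h2 : A i ^ 2 * U j k * U o j ≤ (A i ^ 2 * U j k * U o j) * (A o * A k) :=
      le_mul_of_one_le_right (by positivity) (one_le_mul_of_one_le_of_one_le a0 a3)
    nlinarith only [h, h2, hZ, hR24, hR4]
  set nc : Par → ℕ := fun P => (fib o i j k S (cdOf o i j k P)).ncard with hncdef
  set Lo : Set Par := {P | P ∈ S ∧ (nc P : ℝ) ≤ Λ} with hLo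
  set Lv : ℕ → Set Par := fun n => {P | P ∈ S ∧ Λ < nc P ∧ (4 : ℝ) ^ n < nc P ∧
    (nc P : ℝ) ≤ 4 ^ (n + 1)} with hLv
  have hfin : ∀ P, (fib o i j k S (cdOf o i j k P)).Finite := fun P => (fib_cnt bx hq hS _).1
  have low : Cnt Lo ((36 * A o ^ 2) * ((36 * A i ^ 2) * ((36 * A j ^ 2) * ((36 * A k ^ 2) *
      ((5 * U o i) * ((5 * U j k) * ((5 * U o j) * ((5 * U i k) * (4 * 4)))))))) * Λ) := by
    refine Cnt.fiber (f := cdOf o i j k) (cd_triv a0 a1 a2 a3 u1 u2 u3 u4 ?_) (by linarith) ?_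
    · rintro _ ⟨P, hP, rfl⟩
      exact cdOf_sz hq (hS P hP.1).1 (hS P hP.1).2
    · rintro _ ⟨P, hP, rfl⟩
      have hb : Cnt (fib o i j k S (cdOf o i j k P)) Λ := ⟨hfin P, hP.2⟩
      refine hb.subset ?_
      rintro P' ⟨hP', he⟩
      exact ⟨hP'.1, he⟩
  set T1 : ℝ := (33 * (A o * A i * A j * A k)) * ((M * (M * (M * M))) * ((4 * (4 * ((5 * U j k) *
        ((5 * U o j) * (5 * U i k))))) * ((6 * W o i) * (6 * W o j)))) with hT1
  set T2 : ℝ := (36 * A o ^ 2) * ((36 * A i ^ 2) * ((36 * A j ^ 2) * ((5 * U j k) *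
        (5 * U i k)))) * (M * (M * (M * (4 * 4)))) with hT2
  set T3 : ℝ := (36 * A o ^ 2) * ((36 * A i ^ 2) * ((36 * A k ^ 2) * ((5 * U j k) *
        (5 * U o j)))) * (M * (M * (M * (4 * 4)))) with hT3
  set M8 : ℝ := (M * (M * (M * (M * (M * (M * (M * (M * (4 * 4))))))))) with hM8
  have t1 : 0 ≤ T1 := by positivity
  have t2 : 0 ≤ T2 := by positivity
  have t3 : 0 ≤ T3 := by positivity
  have m8 : 0 ≤ M8 := by positivity
  have level : ∀ n, Cnt (Lv n) (E * M8 + 1600 * T1 + (1600 * Wm ^ 2) * T2 +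
      (1600 * Wm ^ 2) * T3) := by
    intro n
    rcases (Lv n).eq_empty_or_nonempty with hemp | ⟨P0, hP0⟩
    · rw [hemp]; exact cnt_empty (by positivity)
    have hΛn : Λ < 4 ^ (n + 1) := lt_of_lt_of_le hP0.2.1 hP0.2.2.2
    have hn4 : 4 ≤ n := by
      by_contra h
      have : (4 : ℝ) ^ (n + 1) ≤ 4 ^ 4 := pow_le_pow_right₀ (by norm_num) (by omega)
      norm_num at this
      linarith
    obtain ⟨N, hN, hNE⟩ := hG n hΛn
    have hpair : ∀ c ∈ cdOf o i j k '' Lv n, ∃ x y : GI, CdOK (A o) (A i) (A j) (A k) (U o i)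
        (U j k) (U o j) (U i k) (W o i) (W o j) (20 / 2 ^ n) c x y := by
      rintro _ ⟨P, hP, rfl⟩
      exact fib_pair bx hq hS _ hn4 hP.2.2.1
    have hpair' : ∀ c : Cd, ∃ x y : GI, c ∈ cdOf o i j k '' Lv n → CdOK (A o) (A i) (A j) (A k)
        (U o i) (U j k) (U o j) (U i k) (W o i) (W o j) (20 / 2 ^ n) c x y := by
      intro c
      by_cases hc : c ∈ cdOf o i j k '' Lv n
      · obtain ⟨x, y, h⟩ := hpair c hc; exact ⟨x, y, fun _ => h⟩
      · exact ⟨0, 0, fun h => absurd h hc⟩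
    choose x y hxy using hpair'
    have hq0 : (0 : ℝ) < 2 ^ n := by positivity
    have hq16 : (1 : ℝ) ≤ 2 ^ n := one_le_pow₀ (by norm_num)
    have h4 : (4 : ℝ) ^ (n + 1) = 4 * (2 ^ n) ^ 2 := by
      rw [pow_succ, ← pow_mul, mul_comm n 2, pow_mul]; norm_num; ring
    have e320 : 16 * (20 / 2 ^ n) * R = 320 * R / 2 ^ n := by ring
    have hcl := class_bound (C := cdOf o i j k '' Lv n) (x := x) (y := y) (N := N) a0 a1 a2 a3 u2 u3
      u4 w1 w2 (H := 20 / 2 ^ n) (by positivity) (R := R) (by linarith) (fun c hc => hxy c hc)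
      hM hM0 z1 z2 z3 (by
        rw [e320]
        refine (div_le_self (by linarith) hq16).trans (by linarith)) r1 r2 r3 r4 (by rw [e320]; exact hN)
    have hfb : ∀ c ∈ cdOf o i j k '' Lv n, Cnt {P | P ∈ Lv n ∧ cdOf o i j k P = c} (4 ^ (n + 1)) := by
      rintro _ ⟨P, hP, rfl⟩
      have hb : Cnt (fib o i j k S (cdOf o i j k P)) (4 ^ (n + 1)) := ⟨hfin P, hP.2.2.2⟩
      refine hb.subset ?_
      rintro P' ⟨hP', he⟩
      exact ⟨hP'.1, he⟩
    refine (Cnt.fiber (f := cdOf o i j k) hcl (by positivity) hfb).le ?_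
    have hWn : (4 : ℝ) ^ (n + 1) ≤ 1600 * Wm ^ 2 := by
      have hc0 := hxy _ ⟨P0, hP0, rfl⟩
      have g1 := (one_le_nrm hc0.x0).trans hc0.hx
      have g2 := (one_le_nrm hc0.y0).trans hc0.hy
      have g : 1 ≤ 20 / 2 ^ n * Wm := by rcases hWm with h | h <;> rw [h] <;> assumption
      have g' : 2 ^ n ≤ 20 * Wm := by
        rw [div_mul_eq_mul_div, le_div_iff₀ hq0, one_mul] at g; exact g
      rw [h4]
      calc 4 * ((2 : ℝ) ^ n) ^ 2 ≤ 4 * (20 * Wm) ^ 2 := by gcongr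
        _ = 1600 * Wm ^ 2 := by ring
    have e1 : (33 * (A o * A i * A j * A k)) * ((M * (M * (M * M))) * ((4 * (4 * ((5 * U j k) *
        ((5 * U o j) * (5 * U i k))))) * ((6 * (20 / 2 ^ n * W o i)) * (6 * (20 / 2 ^ n * W o j)))))
        * 4 ^ (n + 1) = 1600 * T1 := by
      rw [hT1, h4]; field_simp; ring
    have e2 := mul_le_mul_of_nonneg_left hWn t2
    have e3 := mul_le_mul_of_nonneg_left hWn t3
    have e4 := mul_le_mul_of_nonneg_left hNE m8
    rw [add_mul, add_mul, add_mul, e1]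
    linarith only [e2, e3, e4]
  have hIJ : Cnt {n : ℕ | n < J} (J : ℝ) := by
    refine ⟨Set.finite_lt_nat J, ?_⟩
    have : {n : ℕ | n < J} = (Finset.range J : Set ℕ) := by ext; simp
    rw [this, Set.ncard_coe_finset, Finset.card_range]
  have hun := cnt_biUnion (S := Lv) hIJ (by positivity) (fun n _ => level n)
  refine (low.union hun).subset ?_
  intro P hP
  by_cases hlow : (nc P : ℝ) ≤ Λ
  · exact Or.inl ⟨hP, hlow⟩
  push Not at hlow
  right
  have hn1 : 400 < nc P := by
    have : (400 : ℝ) < nc P := by linarith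
    exact_mod_cast this
  have hb1 := Nat.pow_log_le_self 4 (x := nc P - 1) (by omega)
  have hb2 := Nat.lt_pow_succ_log_self (b := 4) (by norm_num) (nc P - 1)
  set n := Nat.log 4 (nc P - 1)
  have hb1' : 4 ^ n < nc P := by omega
  have hb2' : nc P ≤ 4 ^ (n + 1) := by rw [Nat.succ_eq_add_one] at hb2; omega
  have c1 : (4 : ℝ) ^ n < nc P := by exact_mod_cast hb1'
  have c2 : (nc P : ℝ) ≤ 4 ^ (n + 1) := by exact_mod_cast hb2'
  have hnJ : n < J := by
    have h1 : (nc P : ℝ) ≤ 36 * W o i ^ 2 * (36 * W o j ^ 2) := (fib_cnt bx hq hS _).2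
    have h2 : 36 * W o i ^ 2 * (36 * W o j ^ 2) ≤ 1296 * R ^ 4 := by
      calc 36 * W o i ^ 2 * (36 * W o j ^ 2) ≤ 36 * R ^ 2 * (36 * R ^ 2) := by gcongr
        _ = 1296 * R ^ 4 := by ring
    have h3 : (4 : ℝ) ^ n < 4 ^ J := by linarith
    exact (pow_lt_pow_iff_right₀ (by norm_num)).1 h3
  exact Set.mem_biUnion (show n ∈ {n : ℕ | n < J} from hnJ) ⟨hP, hlow, c1, c2⟩
end

end ACQ


set_option linter.unusedSimpArgs false

namespace ACQ

/-! ### The linear programme -/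

theorem lp_core {a0 a1 a2 a3 w0 w1 w2 u01 u23 u02 u13 u03 u12 l : ℝ} (hl : 0 < l)
    (na0 : 0 ≤ a0) (na1 : 0 ≤ a1) (na2 : 0 ≤ a2) (na3 : 0 ≤ a3)
    (nw0 : 0 ≤ w0) (nw1 : 0 ≤ w1) (nw2 : 0 ≤ w2) (nu01 : 0 ≤ u01) (nu23 : 0 ≤ u23)
    (nu02 : 0 ≤ u02) (nu13 : 0 ≤ u13) (nu03 : 0 ≤ u03) (nu12 : 0 ≤ u12)
    (b0 : a0 + a1 + w0 + u23 ≤ l)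
    (b1 : a0 + a2 + w1 + u13 ≤ l)
    (b2 : a0 + a3 + w2 + u12 ≤ l)
    (b3 : a1 + a2 + w2 + u03 ≤ l)
    (b4 : a1 + a3 + w1 + u02 ≤ l)
    (b5 : a2 + a3 + w0 + u01 ≤ l)
    (o0 : a1 ≤ a0)
    (o1 : a2 ≤ a1)
    (o2 : a3 ≤ a2)
    (h0 : 2615 / 1000 * l < 2 * a0 + 2 * a1 + 2 * a2 + 2 * a3 + u01 + u23 + u02 + u13 ∨
      2615 / 1000 * l < a0 + a1 + a2 + a3 + w0 + w1 + u23 + u02 + u13 ∨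
      2615 / 1000 * l < 2 * a0 + 2 * a1 + 2 * a2 + 2 * w1 + u23 + u13 ∨
      2615 / 1000 * l < 2 * a0 + 2 * a1 + 2 * a3 + 2 * w1 + u23 + u02)
    (h1 : 2615 / 1000 * l < 2 * a0 + 2 * a2 + 2 * a3 + 2 * w0 + 2 * w1 + 2 * w2 ∨
      2615 / 1000 * l < 2 * a0 + 2 * a2 + 2 * a3 + 2 * w0 + 2 * w1 + u01 + u13 - u03)
    (h2 : 2615 / 1000 * l < 2 * w0 + 2 * w1 + u01 + u23 + u02 + u13 ∨
      2615 / 1000 * l < 2 * a1 + 2 * a2 + 2 * w0 + 2 * w1 - 2 * w2 + u01 + u23 + u02 + u13 - 2 * u12)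
    (h3 : 2615 / 1000 * l < 2 * a1 + 2 * a2 + 2 * a3 + u23 + u13 + u12 ∨
      2615 / 1000 * l < 2 * a1 + 2 * a2 + 2 * a3 - 2 * w0 + u02 + u13 + u03 + u12 ∨
      2615 / 1000 * l < 2 * a1 + 2 * a2 + 2 * w0 + 2 * w1 + u23 + u13 - u12 ∨
      2615 / 1000 * l < 2 * a1 + 2 * a2 + 2 * w1 + u02 + u13 + u03 - u12)
    (h4 : 2615 / 1000 * l < 2 * a0 + 2 * a1 + 2 * a2 + u01 + u02 + u12 ∨
      2615 / 1000 * l < 2 * a0 + 2 * a1 + 2 * a2 - 2 * w1 + u01 + u23 + u03 + u12 ∨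
      2615 / 1000 * l < 2 * a0 + 2 * a1 + 2 * w1 + 2 * w2 - u01 + u02 + u12 ∨
      2615 / 1000 * l < 2 * a0 + 2 * a1 + 2 * w2 - u01 + u23 + u03 + u12)
    (h5 : 2615 / 1000 * l < 2 * a0 + 2 * a1 + 2 * a2 + 2 * a3 + u02 + u13 + u03 + u12 ∨
      2615 / 1000 * l < a0 + a1 + a2 + a3 + w1 + w2 + u02 + u03 + u12 ∨
      2615 / 1000 * l < 2 * a1 + 2 * a2 + 2 * a3 + 2 * w1 + u02 + u03 ∨
      2615 / 1000 * l < 2 * a0 + 2 * a1 + 2 * a3 + 2 * w1 + u02 + u12)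
    (h6 : 2615 / 1000 * l < 2 * a0 + 2 * a1 + 2 * a2 + 2 * a3 + u01 + u23 + u03 + u12 ∨
      2615 / 1000 * l < a0 + a1 + a2 + a3 + w0 + w2 + u01 + u23 + u12 ∨
      2615 / 1000 * l < 2 * a0 + 2 * a1 + 2 * a3 + 2 * w2 + u23 + u12 ∨
      2615 / 1000 * l < 2 * a0 + 2 * a2 + 2 * a3 + 2 * w2 + u01 + u12)
    (h7 : 2615 / 1000 * l < 2 * a1 + 2 * a2 + 2 * a3 + u23 + u13 + u12 ∨
      2615 / 1000 * l < 2 * a1 + 2 * a2 + 2 * a3 - 2 * w1 + u01 + u23 + u03 + u12 ∨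
      2615 / 1000 * l < 2 * a1 + 2 * a3 + 2 * w0 + 2 * w2 + u23 - u13 + u12 ∨
      2615 / 1000 * l < 2 * a1 + 2 * a3 + 2 * w0 - 2 * w1 + 2 * w2 + u01 + u23 - 2 * u13 + u03 + u12)
    (h8 : 2615 / 1000 * l < 2 * w0 + 2 * w2 + u01 + u23 + u03 + u12 ∨
      2615 / 1000 * l < 2 * a1 + 2 * a3 + 2 * w0 - 2 * w1 + 2 * w2 + u01 + u23 - 2 * u13 + u03 + u12)
    (h9 : 2615 / 1000 * l < 2 * a1 + 2 * a2 + 2 * a3 + u23 + u13 + u12 ∨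
      2615 / 1000 * l < 2 * a1 + 2 * a2 + 2 * a3 - 2 * w1 + u01 + u23 + u03 + u12 ∨
      2615 / 1000 * l < 2 * a1 + 2 * a2 + 2 * w0 + 2 * w1 + u23 + u13 - u12 ∨
      2615 / 1000 * l < 2 * a1 + 2 * a2 + 2 * w0 + u01 + u23 + u03 - u12)
    (h10 : 2615 / 1000 * l < 2 * w1 + 2 * w2 + u02 + u13 + u03 + u12 ∨
      2615 / 1000 * l < 2 * a0 + 2 * a1 - 2 * w0 + 2 * w1 + 2 * w2 - 2 * u01 + u02 + u13 + u03 + u12)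
    (h11 : 2615 / 1000 * l < 2 * a0 + 2 * a1 + 2 * a2 + 2 * a3 + u01 + u23 + u02 + u13 ∨
      2615 / 1000 * l < a0 + a1 + a2 + a3 + w0 + w1 + u01 + u23 + u13 ∨
      2615 / 1000 * l < 2 * a0 + 2 * a1 + 2 * a2 + 2 * w1 + u23 + u13 ∨
      2615 / 1000 * l < 2 * a0 + 2 * a2 + 2 * a3 + 2 * w1 + u01 + u13)
    (h12 : 2615 / 1000 * l < 2 * a0 + 2 * a1 + 2 * a2 + 2 * w0 + 2 * w1 + 2 * w2 ∨
      2615 / 1000 * l < 2 * a0 + 2 * a1 + 2 * a2 + 2 * w0 + 2 * w2 + u23 - u02 + u03)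
    (h13 : 2615 / 1000 * l < 2 * a0 + 2 * a1 + 2 * a3 + u01 + u13 + u03 ∨
      2615 / 1000 * l < 2 * a0 + 2 * a1 + 2 * a3 - 2 * w0 + u02 + u13 + u03 + u12 ∨
      2615 / 1000 * l < 2 * a1 + 2 * a3 + 2 * w0 + 2 * w2 + u01 - u13 + u03 ∨
      2615 / 1000 * l < 2 * a1 + 2 * a3 + 2 * w2 + u02 - u13 + u03 + u12)
    (h14 : 2615 / 1000 * l < 2 * a0 + 2 * a1 + 2 * a2 + 2 * a3 + u01 + u23 + u03 + u12 ∨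
      2615 / 1000 * l < a0 + a1 + a2 + a3 + w0 + w2 + u23 + u03 + u12 ∨
      2615 / 1000 * l < 2 * a0 + 2 * a1 + 2 * a3 + 2 * w2 + u23 + u12 ∨
      2615 / 1000 * l < 2 * a0 + 2 * a1 + 2 * a2 + 2 * w2 + u23 + u03)
    (h15 : 2615 / 1000 * l < 2 * a0 + 2 * a1 + 2 * a2 + 2 * w0 + 2 * w1 + 2 * w2 ∨
      2615 / 1000 * l < 2 * a0 + 2 * a1 + 2 * a2 + 2 * w1 + 2 * w2 - u01 + u13 + u03)
    (h16 : 2615 / 1000 * l < 2 * a0 + 2 * a1 + 2 * a3 + 2 * w0 + 2 * w1 + 2 * w2 ∨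
      2615 / 1000 * l < 2 * a0 + 2 * a1 + 2 * a3 + 2 * w1 + 2 * w2 - u01 + u02 + u12)
    (h17 : 2615 / 1000 * l < 2 * a0 + 2 * a1 + 2 * a2 + 2 * a3 + u01 + u23 + u03 + u12 ∨
      2615 / 1000 * l < a0 + a1 + a2 + a3 + w0 + w2 + u01 + u23 + u03 ∨
      2615 / 1000 * l < 2 * a0 + 2 * a1 + 2 * a2 + 2 * w2 + u23 + u03 ∨
      2615 / 1000 * l < 2 * a1 + 2 * a2 + 2 * a3 + 2 * w2 + u01 + u03)
    (h18 : 2615 / 1000 * l < 2 * a1 + 2 * a2 + 2 * a3 + 2 * w0 + 2 * w1 + 2 * w2 ∨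
      2615 / 1000 * l < 2 * a1 + 2 * a2 + 2 * a3 + 2 * w0 + 2 * w1 + u01 + u02 - u12)
    (h19 : 2615 / 1000 * l < 2 * a0 + 2 * a1 + 2 * a2 + 2 * a3 + u01 + u23 + u02 + u13 ∨
      2615 / 1000 * l < a0 + a1 + a2 + a3 + w0 + w1 + u23 + u02 + u13 ∨
      2615 / 1000 * l < 2 * a0 + 2 * a1 + 2 * a2 + 2 * w0 + u23 + u13 ∨
      2615 / 1000 * l < 2 * a0 + 2 * a1 + 2 * a3 + 2 * w0 + u23 + u02)
    (h20 : 2615 / 1000 * l < 2 * a1 + 2 * a2 + 2 * a3 + u23 + u13 + u12 ∨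
      2615 / 1000 * l < 2 * a1 + 2 * a2 + 2 * a3 - 2 * w1 + u01 + u23 + u03 + u12 ∨
      2615 / 1000 * l < 2 * a2 + 2 * a3 + 2 * w1 + 2 * w2 - u23 + u13 + u12 ∨
      2615 / 1000 * l < 2 * a2 + 2 * a3 + 2 * w2 + u01 - u23 + u03 + u12)
    (h21 : 2615 / 1000 * l < 2 * a0 + 2 * a1 + 2 * a2 + 2 * a3 + u02 + u13 + u03 + u12 ∨
      2615 / 1000 * l < a0 + a1 + a2 + a3 + w1 + w2 + u13 + u03 + u12 ∨
      2615 / 1000 * l < 2 * a0 + 2 * a2 + 2 * a3 + 2 * w1 + u13 + u12 ∨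
      2615 / 1000 * l < 2 * a0 + 2 * a1 + 2 * a2 + 2 * w1 + u13 + u03)
    (h22 : 2615 / 1000 * l < 2 * w0 + 2 * w2 + u01 + u23 + u03 + u12 ∨
      2615 / 1000 * l < 2 * a0 + 2 * a2 + 2 * w0 - 2 * w1 + 2 * w2 + u01 + u23 - 2 * u02 + u03 + u12)
    (h23 : 2615 / 1000 * l < 2 * a0 + 2 * a1 + 2 * a2 + 2 * w0 + 2 * w1 + 2 * w2 ∨
      2615 / 1000 * l < 2 * a0 + 2 * a1 + 2 * a2 + 2 * w0 + 2 * w1 + u23 + u13 - u12)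
    (h24 : 2615 / 1000 * l < 2 * a1 + 2 * a2 + 2 * a3 + u23 + u13 + u12 ∨
      2615 / 1000 * l < 2 * a1 + 2 * a2 + 2 * a3 - 2 * w2 + u01 + u23 + u02 + u13 ∨
      2615 / 1000 * l < 2 * a1 + 2 * a3 + 2 * w0 + 2 * w2 + u23 - u13 + u12 ∨
      2615 / 1000 * l < 2 * a1 + 2 * a3 + 2 * w0 + u01 + u23 + u02 - u13)
    : False := by
  rcases h0 with g0 | g0 | g0 | g0
  · rcases h1 with g1 | g1
    · rcases h2 with g2 | g2
      · rcases h3 with g3 | g3 | g3 | g3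
        · linarith only [hl, b0, b1, b2, b4, b5, o0, o1, o2, g1, g2, g3]
        · linarith only [hl, b0, b1, b2, b3, b4, b5, o0, o1, o2, g1, g2, g3]
        · rcases h4 with g4 | g4 | g4 | g4
          · linarith only [hl, b0, b1, b4, b5, o0, o1, g2, g3, g4, na3]
          · linarith only [hl, b0, b1, b3, b4, b5, o0, o1, g1, g2, g3, g4, na3]
          · rcases h5 with g5 | g5 | g5 | g5
            · rcases h6 with g6 | g6 | g6 | g6
              · linarith only [hl, b0, b1, b3, b4, b5, o0, o1, g0, g2, g3, g4, g5, g6]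
              · linarith only [hl, b0, b1, b2, b3, b4, b5, o0, o1, g3, g5, g6]
              · linarith only [hl, b0, b1, b2, b3, b4, o0, o1, g2, g3, g4, g5, g6, nu12]
              · linarith only [hl, b0, b1, b2, b3, b4, b5, o1, g2, g3, g4, g5, g6, nu03]
            · linarith only [hl, b0, b1, b3, b4, b5, o0, o1, g0, g3, g5]
            · linarith only [hl, b0, b1, b2, b3, b4, o0, o1, g0, g2, g3, g4, g5, nu13]
            · linarith only [hl, b0, b1, b4, b5, o0, g0, g2, g3, g5, nu02, nu13]
          · linarith only [hl, b0, b1, b2, b3, b4, o0, o1, g0, g3, g4, nu12]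
        · rcases h7 with g4 | g4 | g4 | g4
          · linarith only [hl, b0, b1, b3, b4, b5, o0, o1, o2, g1, g2, g3, g4]
          · linarith only [hl, b0, b1, b3, b4, b5, o0, o1, o2, g1, g2, g3, g4]
          · linarith only [hl, b0, b1, b3, b4, b5, o0, o1, g0, g3, g4, nu12]
          · linarith only [hl, b0, b3, b4, b5, o0, o1, g0, g1, g2, g3, g4, na3, nu12]
      · rcases h7 with g3 | g3 | g3 | g3
        · linarith only [hl, b0, b1, b4, b5, o0, o1, o2, g1, g2, g3, nw2, nu12]
        · linarith only [hl, b0, b1, b3, b4, b5, o0, o1, g1, g2, g3, nw2, nu12]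
        · linarith only [hl, b0, b1, b4, b5, o0, o1, g0, g2, g3, nu12]
        · linarith only [hl, b0, b3, b4, b5, o0, o1, g0, g1, g2, g3, nw1, nu13, nu12]
    · rcases h8 with g2 | g2
      · rcases h9 with g3 | g3 | g3 | g3
        · linarith only [hl, b0, b1, b2, b5, o0, o1, o2, g1, g2, g3, nw2, nu03]
        · linarith only [hl, b0, b1, b2, b5, o0, o1, o2, g1, g2, g3, nw2, nu03]
        · rcases h5 with g4 | g4 | g4 | g4
          · rcases h6 with g5 | g5 | g5 | g5
            · linarith only [hl, b0, b1, b3, b4, b5, o0, o1, o2, g0, g1, g2, g3, g4, g5]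
            · linarith only [hl, b0, b1, b2, b3, b4, b5, o0, o1, g3, g4, g5]
            · linarith only [hl, b0, b1, b2, b3, b4, b5, o0, o1, o2, g2, g3, g4, g5, nu12]
            · linarith only [hl, b0, b1, b2, b3, b4, b5, o0, o1, g2, g3, g4, g5, nu03, nu12]
          · linarith only [hl, b0, b1, b3, b4, b5, o0, o1, g0, g3, g4]
          · linarith only [hl, b0, b1, b3, b4, b5, o0, o1, o2, g0, g1, g2, g3, g4, nw0]
          · linarith only [hl, b0, b1, b2, b3, b4, b5, o0, g0, g2, g3, g4, nu02, nu13]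
        · linarith only [hl, b0, b1, b3, b4, b5, o0, o1, g0, g1, g2, g3, na3, nu12]
      · rcases h10 with g3 | g3
        · linarith only [hl, b0, b2, b3, b4, b5, g0, g1, g2, g3, nu03, nu12]
        · linarith only [hl, b0, b2, b3, b4, o0, g0, g1, g2, g3, nu01, nu23, nu13, nu03, nu12]
  · rcases h5 with g1 | g1 | g1 | g1
    · rcases h11 with g2 | g2 | g2 | g2
      · rcases h12 with g3 | g3
        · rcases h13 with g4 | g4 | g4 | g4
          · linarith only [hl, b0, b1, b3, b4, b5, o2, g0, g3, g4, na2, nw1]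
          · linarith only [hl, b0, b1, b2, b3, b4, g0, g3, g4, nw1]
          · rcases h14 with g5 | g5 | g5 | g5
            · linarith only [hl, b0, b2, b3, b4, b5, o2, g0, g4, g5]
            · linarith only [hl, b0, b2, b3, b4, b5, o0, o1, o2, g0, g2, g3, g4, g5, nw1]
            · linarith only [hl, b0, b1, b2, b3, b4, b5, o0, o2, g0, g1, g4, g5, nw1, nu12]
            · linarith only [hl, b0, b1, b2, b3, b4, b5, g0, g1, g4, g5, nw1, nu12]
          · linarith only [hl, b0, b2, b3, b4, b5, o0, o1, g0, g1, g2, g3, g4, nw1]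
        · rcases h13 with g4 | g4 | g4 | g4
          · linarith only [hl, b0, b1, b3, b4, b5, o2, g0, g3, g4, nw1]
          · linarith only [hl, b0, b1, b2, b3, b4, o0, o1, o2, g0, g3, g4, nw1]
          · rcases h14 with g5 | g5 | g5 | g5
            · linarith only [hl, b0, b2, b3, b4, b5, o2, g0, g4, g5]
            · linarith only [hl, b0, b2, b3, b4, b5, o0, o1, o2, g0, g2, g3, g4, g5, nw1]
            · linarith only [hl, b0, b1, b2, b3, b4, b5, o0, o2, g0, g1, g4, g5, nw1, nu12]
            · linarith only [hl, b0, b1, b2, b3, b4, b5, g0, g1, g4, g5, nw1, nu12]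
          · linarith only [hl, b0, b2, b3, b4, b5, o0, o1, o2, g0, g1, g2, g3, g4, nw1]
      · rcases h15 with g3 | g3
        · linarith only [hl, b0, b1, b2, b3, b4, b5, o0, g0, g1, g2, g3, nw1]
        · linarith only [hl, b0, b1, b2, b3, b4, o0, o1, o2, g0, g1, g2, g3, nu12]
      · linarith only [hl, b0, b1, b4, o0, o1, g0, g2, nw0]
      · linarith only [hl, b0, b1, b4, b5, o1, o2, g0, g2, nw0]
    · rcases h16 with g2 | g2
      · rcases h17 with g3 | g3 | g3 | g3
        · linarith only [hl, b0, b1, b2, b3, b4, b5, o1, o2, g0, g1, g2, g3, nu01]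
        · linarith only [hl, b0, b1, b2, b3, b4, b5, g0, g1, g2, g3, na1, na2]
        · linarith only [hl, b0, b1, b2, b3, b4, o1, g0, g1, g2, g3, na1, na3, nw1]
        · linarith only [hl, b0, b1, b2, b3, b4, b5, g0, g1, g2, g3, na1]
      · rcases h6 with g3 | g3 | g3 | g3
        · rcases h18 with g4 | g4
          · linarith only [hl, b0, b1, b2, b3, b4, o0, o1, o2, g0, g1, g2, g3, g4, nu01]
          · linarith only [hl, b0, b1, b2, b3, b4, o1, g0, g1, g2, g3, g4, nu01]
        · linarith only [hl, b0, b1, b2, b3, b4, o1, g0, g1, g2, g3, na0, na3]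
        · linarith only [hl, b0, b2, b3, b4, g1, g3, nw0]
        · linarith only [hl, b0, b1, b2, b3, b4, o1, g0, g1, g2, g3, na1, na3, nw1]
    · linarith only [hl, b0, b1, b3, b4, o0, o1, o2, g0, g1, nw2]
    · linarith only [hl, b0, b1, b2, b4, g0, g1, nw2]
  · rcases h8 with g1 | g1
    · rcases h19 with g2 | g2 | g2 | g2
      · rcases h20 with g3 | g3 | g3 | g3
        · rcases h16 with g4 | g4
          · linarith only [hl, b0, b1, b2, b3, b5, o0, o1, o2, g1, g3, g4]
          · linarith only [hl, b0, b1, b2, b3, b4, o0, o1, o2, g0, g1, g2, g3, g4, nw0]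
        · rcases h16 with g4 | g4
          · linarith only [hl, b0, b2, b3, b5, o0, o2, g1, g3, g4]
          · linarith only [hl, b0, b2, b3, b4, o0, o1, o2, g1, g3, g4, nw0, nu01]
        · rcases h21 with g4 | g4 | g4 | g4
          · linarith only [hl, b0, b1, b2, b3, b4, b5, o0, o1, o2, g0, g1, g2, g3, g4]
          · linarith only [hl, b1, b2, b3, b4, b5, o0, o1, o2, g0, g1, g2, g3, g4, nw0]
          · linarith only [hl, b1, b2, b3, b4, b5, o0, o1, o2, g1, g2, g3, g4, nw0, nu02]
          · linarith only [hl, b1, b2, b3, b4, b5, o0, g1, g2, g3, g4, nw0, nu02, nu13]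
        · linarith only [hl, b1, b2, b3, b4, b5, o0, o1, g0, g1, g2, g3, na3, nw0]
      · linarith only [hl, b0, b1, b4, o0, o1, g0, g2, nw0]
      · linarith only [hl, b0, b1, b2, b3, b5, o0, o1, g0, g1, g2, na3]
      · linarith only [hl, b0, b1, b2, b3, b4, b5, g0, g1, g2]
    · linarith only [hl, b0, b2, b3, b5, o0, g0, g1, nw0, nu13]
  · rcases h22 with g1 | g1
    · rcases h19 with g2 | g2 | g2 | g2
      · rcases h20 with g3 | g3 | g3 | g3
        · rcases h23 with g4 | g4
          · linarith only [hl, b0, b1, b2, b3, b5, o0, o1, o2, g1, g3, g4]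
          · linarith only [hl, b0, b1, b2, b3, b5, o0, o1, o2, g1, g3, g4]
        · rcases h15 with g4 | g4
          · linarith only [hl, b0, b2, b3, b5, o0, o1, g1, g3, g4, na3]
          · linarith only [hl, b0, b1, b2, b3, o0, o1, o2, g1, g3, g4, nw0, nu01]
        · rcases h21 with g4 | g4 | g4 | g4
          · linarith only [hl, b0, b1, b2, b3, b4, b5, o0, o1, o2, g0, g1, g2, g3, g4]
          · linarith only [hl, b1, b2, b3, b4, b5, o0, o1, o2, g0, g1, g2, g3, g4, nw0]
          · linarith only [hl, b1, b2, b3, b4, b5, o0, o1, o2, g1, g2, g3, g4, nw0, nu02]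
          · linarith only [hl, b1, b2, b3, b4, b5, o0, g1, g2, g3, g4, nw0, nu02, nu13]
        · linarith only [hl, b1, b2, b3, b4, b5, g0, g1, g2, g3, na1, na2, nw0]
      · linarith only [hl, b0, b1, b4, o1, o2, g0, g2, nw0]
      · linarith only [hl, b0, b1, b2, b3, b4, b5, g0, g1, g2]
      · rcases h9 with g3 | g3 | g3 | g3
        · linarith only [hl, b0, b1, b2, b3, b4, b5, o1, o2, g0, g1, g2, g3, nw0, nw2]
        · rcases h15 with g4 | g4
          · linarith only [hl, b0, b2, b3, b4, b5, g0, g1, g2, g3, g4]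
          · linarith only [hl, b0, b1, b2, b3, b4, b5, o1, o2, g0, g1, g2, g3, g4]
        · linarith only [hl, b0, b1, b2, b3, b4, b5, o1, o2, g0, g1, g2, g3, nu13, nu12]
        · linarith only [hl, b0, b3, b4, b5, g0, g1, g2, g3, na1, na2]
    · rcases h24 with g2 | g2 | g2 | g2
      · linarith only [hl, b0, b1, b2, b3, b5, o1, o2, g0, g1, g2, nw0, nw1, nw2, nu02]
      · linarith only [hl, b0, b1, b2, b3, b5, o1, o2, g0, g1, g2, nw0, nw1, nw2, nu02]
      · linarith only [hl, b0, b2, b3, b5, g0, g1, g2, na1, nw0, nu02, nu13, nu12]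
      · linarith only [hl, b0, b2, b3, b5, o2, g0, g1, g2, nw0, nu13]

theorem imp2 {p q p1 q1 : Prop} (h : p ∨ q) (hp : p → p1) (hq : q → q1) : p1 ∨ q1 :=
  h.imp hp hq

theorem imp4 {p q r s p1 q1 r1 s1 : Prop} (h : p ∨ q ∨ r ∨ s) (hp : p → p1) (hq : q → q1)
    (hr : r → r1) (hs : s → s1) : p1 ∨ q1 ∨ r1 ∨ s1 :=
  h.imp hp (fun h => h.imp hq (fun h => h.imp hr hs))

section
variable {a : Fin 4 → ℝ} {u w : Fin 4 → Fin 4 → ℝ} {l : ℝ}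

theorem lp_sorted (hl : 0 < l) (na : ∀ i, 0 ≤ a i) (nu : ∀ i j, 0 ≤ u i j)
    (nw : ∀ i j, 0 ≤ w i j) (us : ∀ i j, u j i = u i j) (ws : ∀ i j, w j i = w i j)
    (hw : ∀ i j k l, Q4 i j k l → w k l = w i j)
    (hb : ∀ i j k m, Q4 i j k m → a i + a j + u k m + w k m ≤ l)
    (o0 : a 1 ≤ a 0) (o1 : a 2 ≤ a 1) (o2 : a 3 ≤ a 2)
    (hF : ∀ o i j k, Q4 o i j k → 2615 / 1000 * l < 2 * (a i + a j + a k) + 2 * (w i j + w j k + w k i) ∨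
      2615 / 1000 * l < 2 * (a i + a j + a k) + 2 * (w i j + w j k + w k i) +
        (u o i + u o j - u i j - 2 * w i j))
    (hE1 : ∀ o i j k, Q4 o i j k → 2615 / 1000 * l < 2 * (a i + a j + a k) + (u i j + u j k + u k i) ∨
      2615 / 1000 * l < 2 * (a i + a j + a k) + (u i j + u j k + u k i) +
        (u o i + u o j - u i j - 2 * w i j) ∨
      2615 / 1000 * l < 2 * (a i + a j + a k) + (u i j + u j k + u k i) +
        2 * (w i j + w j k - a j - u k i) ∨
      2615 / 1000 * l < 2 * (a i + a j + a k) + (u i j + u j k + u k i) +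
        2 * (w i j + w j k - a j - u k i) + (u o i + u o j - u i j - 2 * w i j))
    (hE2 : ∀ o i j k, Q4 o i j k → 2615 / 1000 * l < 2 * (a i + a j + a k) + (u i j + u j k + u k i) ∨
      2615 / 1000 * l < 2 * (a i + a j + a k) + (u i j + u j k + u k i) +
        (u o k + u o i - u k i - 2 * w k i) ∨
      2615 / 1000 * l < 2 * (a i + a j + a k) + (u i j + u j k + u k i) +
        2 * (w i j + w j k - a j - u k i) ∨
      2615 / 1000 * l < 2 * (a i + a j + a k) + (u i j + u j k + u k i) +
        2 * (w i j + w j k - a j - u k i) + (u o k + u o i - u k i - 2 * w k i))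
    (hX : ∀ o i j k, Q4 o i j k → 2615 / 1000 * l < u o i + u j k + u o j + u k i + 2 * w o i + 2 * w o j ∨
      2615 / 1000 * l < u o i + u j k + u o j + u k i + 2 * w o i + 2 * w o j +
        2 * (a i + a j - u i j - w i j))
    (hB : ∀ o i j k, Q4 o i j k → ∀ m, (m = w o i ∨ m = w o j) →
      2615 / 1000 * l < 2 * (a o + a i + a j + a k) + (u o i + u j k + u o j + u i k) ∨
      2615 / 1000 * l < a o + a i + a j + a k + (u j k + u o j + u i k) + (w o i + w o j) ∨
      2615 / 1000 * l < 2 * (a o + a i + a j) + (u j k + u i k) + 2 * m ∨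
      2615 / 1000 * l < 2 * (a o + a i + a k) + (u j k + u o j) + 2 * m) : False := by
  have u10 := us 0 1
  have w10 := ws 0 1
  have u20 := us 0 2
  have w20 := ws 0 2
  have u30 := us 0 3
  have w30 := ws 0 3
  have u21 := us 1 2
  have w21 := ws 1 2
  have u31 := us 1 3
  have w31 := ws 1 3
  have u32 := us 2 3
  have w32 := ws 2 3
  have w23 := hw 0 1 2 3 (by unfold Q4; decide)
  have w13 := hw 0 2 1 3 (by unfold Q4; decide)
  have w12 := hw 0 3 1 2 (by unfold Q4; decide)
  have b0 := hb 0 1 2 3 (by unfold Q4; decide)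
  have b1 := hb 0 2 1 3 (by unfold Q4; decide)
  have b2 := hb 0 3 1 2 (by unfold Q4; decide)
  have b3 := hb 1 2 0 3 (by unfold Q4; decide)
  have b4 := hb 1 3 0 2 (by unfold Q4; decide)
  have b5 := hb 2 3 0 1 (by unfold Q4; decide)
  have h0 := hB 0 1 2 3 (by unfold Q4; decide) (w 0 2) (Or.inr rfl)
  have h1 := hF 1 0 3 2 (by unfold Q4; decide)
  have h2 := hX 0 1 2 3 (by unfold Q4; decide)
  have h3 := hE1 0 2 3 1 (by unfold Q4; decide)
  have h4 := hE1 3 0 2 1 (by unfold Q4; decide)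
  have h5 := hB 1 3 2 0 (by unfold Q4; decide) (w 1 3) (Or.inl rfl)
  have h6 := hB 0 3 1 2 (by unfold Q4; decide) (w 0 3) (Or.inl rfl)
  have h7 := hE2 0 1 2 3 (by unfold Q4; decide)
  have h8 := hX 0 1 3 2 (by unfold Q4; decide)
  have h9 := hE1 0 1 3 2 (by unfold Q4; decide)
  have h10 := hX 2 0 1 3 (by unfold Q4; decide)
  have h11 := hB 0 2 1 3 (by unfold Q4; decide) (w 0 2) (Or.inl rfl)
  have h12 := hF 3 0 2 1 (by unfold Q4; decide)
  have h13 := hE1 2 1 0 3 (by unfold Q4; decide)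
  have h14 := hB 0 1 3 2 (by unfold Q4; decide) (w 0 3) (Or.inr rfl)
  have h15 := hF 3 0 1 2 (by unfold Q4; decide)
  have h16 := hF 2 0 1 3 (by unfold Q4; decide)
  have h17 := hB 1 2 0 3 (by unfold Q4; decide) (w 1 2) (Or.inl rfl)
  have h18 := hF 0 1 2 3 (by unfold Q4; decide)
  have h19 := hB 0 1 2 3 (by unfold Q4; decide) (w 0 1) (Or.inl rfl)
  have h20 := hE1 0 3 1 2 (by unfold Q4; decide)
  have h21 := hB 0 2 3 1 (by unfold Q4; decide) (w 0 2) (Or.inl rfl)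
  have h22 := hX 1 0 2 3 (by unfold Q4; decide)
  have h23 := hF 3 1 2 0 (by unfold Q4; decide)
  have h24 := hE1 0 1 2 3 (by unfold Q4; decide)
  simp only [u10, u20, u30, u21, u31, u32, w10, w20, w30, w21, w31, w32, w23, w13, w12] at b0 b1 b2 b3 b4 b5
  simp only [u10, u20, u30, u21, u31, u32, w10, w20, w30, w21, w31, w32, w23, w13, w12] at h0 h1 h2 h3 h4 h5 h6 h7
  simp only [u10, u20, u30, u21, u31, u32, w10, w20, w30, w21, w31, w32, w23, w13, w12] at h8 h9 h10 h11 h12 h13 h14 h15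
  simp only [u10, u20, u30, u21, u31, u32, w10, w20, w30, w21, w31, w32, w23, w13, w12] at h16 h17 h18 h19 h20 h21 h22 h23
  simp only [u10, u20, u30, u21, u31, u32, w10, w20, w30, w21, w31, w32, w23, w13, w12] at h24
  refine lp_core (w0 := w 0 1) (w1 := w 0 2) (w2 := w 0 3) (u01 := u 0 1) (u23 := u 2 3)
    (u02 := u 0 2) (u13 := u 1 3) (u03 := u 0 3) (u12 := u 1 2) hl (na 0) (na 1) (na 2) (na 3)
    (nw _ _) (nw _ _) (nw _ _) (nu _ _) (nu _ _) (nu _ _) (nu _ _) (nu _ _) (nu _ _)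
    (by linarith only [b0]) (by linarith only [b1]) (by linarith only [b2]) (by linarith only [b3])
    (by linarith only [b4]) (by linarith only [b5]) o0 o1 o2
    (imp4 h0 (fun h => by linarith only [h]) (fun h => by linarith only [h])
      (fun h => by linarith only [h]) (fun h => by linarith only [h]))
    (imp2 h1 (fun h => by linarith only [h]) (fun h => by linarith only [h]))
    (imp2 h2 (fun h => by linarith only [h]) (fun h => by linarith only [h]))
    (imp4 h3 (fun h => by linarith only [h]) (fun h => by linarith only [h])
      (fun h => by linarith only [h]) (fun h => by linarith only [h]))
    (imp4 h4 (fun h => by linarith only [h]) (fun h => by linarith only [h])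
      (fun h => by linarith only [h]) (fun h => by linarith only [h]))
    (imp4 h5 (fun h => by linarith only [h]) (fun h => by linarith only [h])
      (fun h => by linarith only [h]) (fun h => by linarith only [h]))
    (imp4 h6 (fun h => by linarith only [h]) (fun h => by linarith only [h])
      (fun h => by linarith only [h]) (fun h => by linarith only [h]))
    (imp4 h7 (fun h => by linarith only [h]) (fun h => by linarith only [h])
      (fun h => by linarith only [h]) (fun h => by linarith only [h]))
    (imp2 h8 (fun h => by linarith only [h]) (fun h => by linarith only [h]))
    (imp4 h9 (fun h => by linarith only [h]) (fun h => by linarith only [h])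
      (fun h => by linarith only [h]) (fun h => by linarith only [h]))
    (imp2 h10 (fun h => by linarith only [h]) (fun h => by linarith only [h]))
    (imp4 h11 (fun h => by linarith only [h]) (fun h => by linarith only [h])
      (fun h => by linarith only [h]) (fun h => by linarith only [h]))
    (imp2 h12 (fun h => by linarith only [h]) (fun h => by linarith only [h]))
    (imp4 h13 (fun h => by linarith only [h]) (fun h => by linarith only [h])
      (fun h => by linarith only [h]) (fun h => by linarith only [h]))
    (imp4 h14 (fun h => by linarith only [h]) (fun h => by linarith only [h])
      (fun h => by linarith only [h]) (fun h => by linarith only [h]))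
    (imp2 h15 (fun h => by linarith only [h]) (fun h => by linarith only [h]))
    (imp2 h16 (fun h => by linarith only [h]) (fun h => by linarith only [h]))
    (imp4 h17 (fun h => by linarith only [h]) (fun h => by linarith only [h])
      (fun h => by linarith only [h]) (fun h => by linarith only [h]))
    (imp2 h18 (fun h => by linarith only [h]) (fun h => by linarith only [h]))
    (imp4 h19 (fun h => by linarith only [h]) (fun h => by linarith only [h])
      (fun h => by linarith only [h]) (fun h => by linarith only [h]))
    (imp4 h20 (fun h => by linarith only [h]) (fun h => by linarith only [h])
      (fun h => by linarith only [h]) (fun h => by linarith only [h]))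
    (imp4 h21 (fun h => by linarith only [h]) (fun h => by linarith only [h])
      (fun h => by linarith only [h]) (fun h => by linarith only [h]))
    (imp2 h22 (fun h => by linarith only [h]) (fun h => by linarith only [h]))
    (imp2 h23 (fun h => by linarith only [h]) (fun h => by linarith only [h]))
    (imp4 h24 (fun h => by linarith only [h]) (fun h => by linarith only [h])
      (fun h => by linarith only [h]) (fun h => by linarith only [h]))

theorem lp (hl : 0 < l) (na : ∀ i, 0 ≤ a i) (nu : ∀ i j, 0 ≤ u i j)
    (nw : ∀ i j, 0 ≤ w i j) (us : ∀ i j, u j i = u i j) (ws : ∀ i j, w j i = w i j)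
    (hw : ∀ i j k l, Q4 i j k l → w k l = w i j)
    (hb : ∀ i j k m, Q4 i j k m → a i + a j + u k m + w k m ≤ l)
    (hF : ∀ o i j k, Q4 o i j k → 2615 / 1000 * l < 2 * (a i + a j + a k) + 2 * (w i j + w j k + w k i) ∨
      2615 / 1000 * l < 2 * (a i + a j + a k) + 2 * (w i j + w j k + w k i) +
        (u o i + u o j - u i j - 2 * w i j))
    (hE1 : ∀ o i j k, Q4 o i j k → 2615 / 1000 * l < 2 * (a i + a j + a k) + (u i j + u j k + u k i) ∨
      2615 / 1000 * l < 2 * (a i + a j + a k) + (u i j + u j k + u k i) +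
        (u o i + u o j - u i j - 2 * w i j) ∨
      2615 / 1000 * l < 2 * (a i + a j + a k) + (u i j + u j k + u k i) +
        2 * (w i j + w j k - a j - u k i) ∨
      2615 / 1000 * l < 2 * (a i + a j + a k) + (u i j + u j k + u k i) +
        2 * (w i j + w j k - a j - u k i) + (u o i + u o j - u i j - 2 * w i j))
    (hE2 : ∀ o i j k, Q4 o i j k → 2615 / 1000 * l < 2 * (a i + a j + a k) + (u i j + u j k + u k i) ∨
      2615 / 1000 * l < 2 * (a i + a j + a k) + (u i j + u j k + u k i) +
        (u o k + u o i - u k i - 2 * w k i) ∨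
      2615 / 1000 * l < 2 * (a i + a j + a k) + (u i j + u j k + u k i) +
        2 * (w i j + w j k - a j - u k i) ∨
      2615 / 1000 * l < 2 * (a i + a j + a k) + (u i j + u j k + u k i) +
        2 * (w i j + w j k - a j - u k i) + (u o k + u o i - u k i - 2 * w k i))
    (hX : ∀ o i j k, Q4 o i j k → 2615 / 1000 * l < u o i + u j k + u o j + u k i + 2 * w o i + 2 * w o j ∨
      2615 / 1000 * l < u o i + u j k + u o j + u k i + 2 * w o i + 2 * w o j +
        2 * (a i + a j - u i j - w i j))
    (hB : ∀ o i j k, Q4 o i j k → ∀ m, (m = w o i ∨ m = w o j) →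
      2615 / 1000 * l < 2 * (a o + a i + a j + a k) + (u o i + u j k + u o j + u i k) ∨
      2615 / 1000 * l < a o + a i + a j + a k + (u j k + u o j + u i k) + (w o i + w o j) ∨
      2615 / 1000 * l < 2 * (a o + a i + a j) + (u j k + u i k) + 2 * m ∨
      2615 / 1000 * l < 2 * (a o + a i + a k) + (u j k + u o j) + 2 * m) : False := by
  set σ := Tuple.sort (fun i => - a i)
  have hm := Tuple.monotone_sort (fun i => - a i)
  have hq : ∀ i j k m, Q4 i j k m → Q4 (σ i) (σ j) (σ k) (σ m) := by
    intro i j k m h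
    unfold Q4 at *
    simpa [σ.injective.ne_iff] using h
  have h01 : a (σ 1) ≤ a (σ 0) := by
    have := hm (show (0 : Fin 4) ≤ 1 by decide); simp only [Function.comp] at this; linarith
  have h12 : a (σ 2) ≤ a (σ 1) := by
    have := hm (show (1 : Fin 4) ≤ 2 by decide); simp only [Function.comp] at this; linarith
  have h23 : a (σ 3) ≤ a (σ 2) := by
    have := hm (show (2 : Fin 4) ≤ 3 by decide); simp only [Function.comp] at this; linarith
  exact lp_sorted (a := fun i => a (σ i)) (u := fun i j => u (σ i) (σ j))
    (w := fun i j => w (σ i) (σ j)) hl (fun i => na _) (fun i j => nu _ _) (fun i j => nw _ _)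
    (fun i j => us _ _) (fun i j => ws _ _) (fun i j k m h => hw _ _ _ _ (hq _ _ _ _ h))
    (fun i j k m h => hb _ _ _ _ (hq _ _ _ _ h)) h01 h12 h23
    (fun o i j k h => hF _ _ _ _ (hq _ _ _ _ h)) (fun o i j k h => hE1 _ _ _ _ (hq _ _ _ _ h))
    (fun o i j k h => hE2 _ _ _ _ (hq _ _ _ _ h)) (fun o i j k h => hX _ _ _ _ (hq _ _ _ _ h))
    (fun o i j k h => hB _ _ _ _ (hq _ _ _ _ h))
end

end ACQ


namespace ACQ

/-! ### The bound for one box -/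

open Real in
theorem numS {X s T c : ℝ} (h1 : X ≤ T) (h2 : X + s ≤ T) (hc : 0 ≤ c) :
    c * exp X * (800 * (1 + exp s)) ≤ 1600 * c * exp T := by
  have e1 : exp X ≤ exp T := exp_le_exp.2 h1
  have e2 : exp X * exp s ≤ exp T := by rw [← exp_add]; exact exp_le_exp.2 h2
  have := mul_le_mul_of_nonneg_left (add_le_add e1 e2) hc
  linarith only [this]

theorem sq_one_add (x : ℝ) : (1 + x) ^ 2 ≤ 2 * (1 + x ^ 2) := by nlinarith [sq_nonneg (1 - x)]

open Real in
theorem numX {X e T c : ℝ} (h1 : X ≤ T) (h2 : X + 2 * e ≤ T) (hc : 0 ≤ c) :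
    c * exp X * (4000 * (1 + exp e) ^ 2) ≤ 16000 * c * exp T := by
  have e1 : exp X ≤ exp T := exp_le_exp.2 h1
  have e2 : exp X * exp e ^ 2 ≤ exp T := by
    rw [pow_two, ← exp_add, ← exp_add]; exact exp_le_exp.2 (by linarith)
  have h3 := mul_le_mul_of_nonneg_left (add_le_add e1 e2) hc
  have h4 : c * exp X * (1 + exp e) ^ 2 ≤ c * exp X * (2 * (1 + exp e ^ 2)) :=
    mul_le_mul_of_nonneg_left (sq_one_add _) (by positivity)
  linarith only [h3, h4]

open Real in
theorem numE {X s e T c : ℝ} (h1 : X ≤ T) (h2 : X + s ≤ T) (h3 : X + 2 * e ≤ T)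
    (h4 : X + 2 * e + s ≤ T) (hc : 0 ≤ c) :
    c * exp X * ((4000 * (1 + exp e) ^ 2) * (800 * (1 + exp s))) ≤ 25600000 * c * exp T := by
  have e1 := numX h1 h3 hc
  have e2 := numX h2 (by linarith : X + s + 2 * e ≤ T) hc
  rw [exp_add] at e2
  linarith only [e1, e2]

section
variable {A : Fin 4 → ℝ} {U W : Fin 4 → Fin 4 → ℝ} {S : Set Par}

set_option maxHeartbeats 800000 in
theorem box_bound (bx : Bx A U W) (hS : Cls A U W S)
    (hUs : ∀ i j, U j i = U i j) (hWs : ∀ i j, W j i = W i j)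
    (hW : ∀ i j k l, Q4 i j k l → W k l = W i j) {R M Z Λ E : ℝ} {J : ℕ} (hR : 1 < R)
    (hbox : ∀ i j k l, Q4 i j k l → A i * A j * U k l * W k l ≤ R)
    (hM : ∀ z : GI, z ≠ 0 → nrm z ≤ Z → Cnt {d | d ∣ z} M) (hM1 : 1 ≤ M) (hZ : 320 * R ^ 4 ≤ Z)
    (hΛ : 400 ≤ Λ) (hJ : 1296 * R ^ 4 ≤ 4 ^ J) (hE : 0 ≤ E)
    (hG : ∀ n : ℕ, Λ < 4 ^ (n + 1) → ∃ N, Cnt (GS (320 * R / 2 ^ n)) N ∧ 4 ^ (n + 1) * N ≤ E) :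
    Cnt S (10 ^ 16 * (Λ * J * M ^ 8) * R ^ ((2615 : ℝ) / 1000) + J * (E * (16 * M ^ 8))) := by
  by_contra hcon
  have hM0 : 0 ≤ M := by linarith
  have hJ1 : (1 : ℝ) ≤ J := by
    rcases Nat.eq_zero_or_pos J with h | h
    · subst h
      have : 1 ≤ R ^ 4 := one_le_pow₀ hR.le
      norm_num at hJ; linarith
    · exact_mod_cast h
  obtain ⟨a, ha⟩ : ∃ a : Fin 4 → ℝ, ∀ i, A i = Real.exp (a i) :=
    ⟨fun i => Real.log (A i), fun i => (Real.exp_log (by have := bx.A1 i; linarith)).symm⟩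
  obtain ⟨u, hu⟩ : ∃ u : Fin 4 → Fin 4 → ℝ, ∀ i j, U i j = Real.exp (u i j) :=
    ⟨fun i j => Real.log (U i j), fun i j => (Real.exp_log (by have := bx.U1 i j; linarith)).symm⟩
  obtain ⟨w, hw⟩ : ∃ w : Fin 4 → Fin 4 → ℝ, ∀ i j, W i j = Real.exp (w i j) :=
    ⟨fun i j => Real.log (W i j), fun i j => (Real.exp_log (by have := bx.W1 i j; linarith)).symm⟩
  obtain ⟨l, rfl⟩ : ∃ l, R = Real.exp l := ⟨Real.log R, (Real.exp_log (by linarith)).symm⟩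
  have hl : 0 < l := by rwa [← Real.exp_zero, Real.exp_lt_exp] at hR
  have hY : Real.exp l ^ ((2615 : ℝ) / 1000) = Real.exp (2615 / 1000 * l) := by
    rw [← Real.exp_mul]; ring_nf
  rw [hY] at hcon
  set T := 2615 / 1000 * l with hT
  set Y := Real.exp T with hYd
  have hY0 : 0 < Y := Real.exp_pos _
  have hM8 : 1 ≤ M ^ 8 := one_le_pow₀ hM1
  have hLJ : 1 ≤ Λ * J := by nlinarith
  have hQ1 : 1 ≤ Λ * J * M ^ 8 := by nlinarith
  have hQM : M ≤ Λ * J * M ^ 8 := by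
    have : M ≤ M ^ 8 := le_self_pow₀ hM1 (by norm_num)
    nlinarith
  have hG0 : 0 ≤ J * (E * (16 * M ^ 8)) := by positivity
  have key1 : ∀ c : ℝ, c ≤ 10 ^ 16 → ¬ Cnt S (c * Y) := by
    intro c hc h
    refine hcon (h.le ?_)
    have : c * Y ≤ 10 ^ 16 * (Λ * J * M ^ 8) * Y := by
      gcongr
      nlinarith
    linarith
  have hfix1 : ∀ o i j k, Q4 o i j k → ∀ S' ⊆ S, Fixed o S' →
      Cnt S' (800 * (1 + Real.exp (u o i + u o j - u i j - 2 * w i j))) := by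
    intro o i j k hq S' hs hf
    have := optS2 bx (hS.sub hs) hq hf
    simp only [hu, hw] at this
    convert this using 4
    rw [two_mul]
    simp only [Real.exp_sub, Real.exp_add]
    field_simp
  refine lp (a := a) (u := u) (w := w) hl ?_ ?_ ?_ ?_ ?_ ?_ ?_ ?_ ?_ ?_ ?_ ?_
  · intro i; have := bx.A1 i; rw [ha, ← Real.exp_zero, Real.exp_le_exp] at this; exact this
  · intro i j; have := bx.U1 i j; rw [hu, ← Real.exp_zero, Real.exp_le_exp] at this; exact this
  · intro i j; have := bx.W1 i j; rw [hw, ← Real.exp_zero, Real.exp_le_exp] at this; exact this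
  · intro i j; have := hUs i j; rw [hu, hu] at this; exact Real.exp_injective this
  · intro i j; have := hWs i j; rw [hw, hw] at this; exact Real.exp_injective this
  · intro i j k m hq; have := hW i j k m hq; rw [hw, hw] at this; exact Real.exp_injective this
  · intro i j k m hq
    have := hbox i j k m hq
    rw [ha, ha, hu, hw, ← Real.exp_add, ← Real.exp_add, ← Real.exp_add, Real.exp_le_exp] at this
    exact this
  · -- option F
    intro o i j k hq
    by_contra hc
    push Not at hc
    obtain ⟨c1, c2⟩ := hc
    have h := optF bx hS hq (by positivity) (hfix1 o i j k hq)
    refine key1 (1600 * 36 ^ 6) (by norm_num) (h.le ?_)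
    refine le_trans (le_of_eq ?_) (numS c1 c2 (by norm_num : (0 : ℝ) ≤ 36 ^ 6))
    congr 1
    simp only [ha, hw, mul_add, two_mul, Real.exp_add]
    ring
  · intro o i j k hq
    by_contra hc
    push Not at hc
    obtain ⟨c1, c2, c3, c4⟩ := hc
    have h := optE bx hS hq (by positivity) (hfix1 o i j k hq)
    refine key1 (25600000 * (36 ^ 3 * 5 ^ 3)) (by norm_num) (h.le ?_)
    refine le_trans (le_of_eq ?_) (numE c1 c2 c3 c4 (by norm_num : (0 : ℝ) ≤ 36 ^ 3 * 5 ^ 3))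
    congr 1
    · simp only [ha, hu, mul_add, two_mul, Real.exp_add]
      ring
    · congr 4
      simp only [ha, hu, hw, Real.exp_sub, Real.exp_add]
      field_simp
  · intro o i j k hq
    by_contra hc
    push Not at hc
    obtain ⟨c1, c2, c3, c4⟩ := hc
    have hq2 : Q4 o k i j := by unfold Q4 at *; tauto
    have h := optE bx hS hq (by positivity) (hfix1 o k i j hq2)
    refine key1 (25600000 * (36 ^ 3 * 5 ^ 3)) (by norm_num) (h.le ?_)
    refine le_trans (le_of_eq ?_) (numE c1 c2 c3 c4 (by norm_num : (0 : ℝ) ≤ 36 ^ 3 * 5 ^ 3))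
    congr 1
    · simp only [ha, hu, mul_add, two_mul, Real.exp_add]
      ring
    · congr 4
      simp only [ha, hu, hw, Real.exp_sub, Real.exp_add]
      field_simp
  · intro o i j k hq
    by_contra hc
    push Not at hc
    obtain ⟨c1, c2⟩ := hc
    have hF : ∀ P ∈ S, ∀ x y, x ≠ y → nrm (P.F x y) ≤ 4 * Real.exp l := by
      intro P hP x y hxy
      obtain ⟨v, hb⟩ := hS P hP
      obtain ⟨p, q, hpq⟩ := exists_Q4' x y hxy
      have h1 := hb.u2 x y hxy
      have h2 := hb.w2 x y hxy
      have h3 := hbox p q x y (by unfold Q4 at *; tauto)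
      have h4 := bx.A1 p
      have h5 := bx.A1 q
      have h6 := bx.U1 x y
      have h7 := bx.W1 x y
      have h8 : (0 : ℝ) ≤ cont (P.F x y) := by exact_mod_cast cont_nonneg _
      rw [← cont_mul_prim (P.F x y), nrm_mul, nrm_int, abs_of_nonneg h8]
      have h9 : (cont (P.F x y) : ℝ) * nrm (prim (P.F x y)) ≤ (2 * U x y) * (2 * W x y) :=
        mul_le_mul h1 h2 (nrm_nonneg _) (by positivity)
      have h10 : 1 * (U x y * W x y) ≤ A p * A q * (U x y * W x y) :=
        mul_le_mul_of_nonneg_right (by nlinarith) (by positivity)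
      linarith
    have h := optX bx hS hq hM0 hF (fun z hz hn => hM z hz (hn.trans (le_trans ?_ hZ)))
    · refine hcon (h.le ?_)
      have h2 := numX c1 c2 (by positivity : (0 : ℝ) ≤ 5 ^ 4 * 36 ^ 2 * 16 * M)
      have h3 : 16000 * (5 ^ 4 * 36 ^ 2 * 16 * M) * Real.exp T ≤
          10 ^ 16 * (Λ * J * M ^ 8) * Y := by
        refine mul_le_mul_of_nonneg_right ?_ hY0.le
        linarith
      refine le_trans (le_trans (le_of_eq ?_) (h2.trans h3)) (by linarith)
      have e1 : A i * A j / (U i j * W i j) = Real.exp (a i + a j - u i j - w i j) := by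
        simp only [ha, hu, hw, Real.exp_sub, Real.exp_add]
        field_simp
      rw [e1]
      simp only [hu, hw, two_mul, Real.exp_add]
      ring
    · have : (Real.exp l) ^ 2 ≤ (Real.exp l) ^ 4 := pow_le_pow_right₀ hR.le (by norm_num)
      nlinarith
  · intro o i j k hq m hm
    by_contra hc
    push Not at hc
    obtain ⟨c1, c2, c3, c4⟩ := hc
    have hWm : Real.exp m = W o i ∨ Real.exp m = W o j := by
      rcases hm with h | h
      · left; rw [h, hw]
      · right; rw [h, hw]
    have h := optB bx hq hS hW hbox hM hM0 hZ hΛ hJ hWm hE hG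
    refine hcon (h.le ?_)
    have d1 := Real.exp_le_exp.2 c1
    have d2 := Real.exp_le_exp.2 c2
    have d3 := Real.exp_le_exp.2 c3
    have d4 := Real.exp_le_exp.2 c4
    have m3 : M ^ 3 ≤ M ^ 8 := pow_le_pow_right₀ hM1 (by norm_num)
    have m4 : M ^ 4 ≤ M ^ 8 := pow_le_pow_right₀ hM1 (by norm_num)
    simp only [mul_add, two_mul, Real.exp_add, ← ha, ← hu, ← hw] at d1 d2 d3 d4
    rw [← hYd] at d1 d2 d3 d4
    have hJL : (J : ℝ) ≤ Λ * J := le_mul_of_one_le_left (by linarith) (by linarith)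
    have f1 : (36 ^ 4 * 5 ^ 4 * 16) * (A o * A o * (A i * A i) * (A j * A j) * (A k * A k) *
        (U o i * U j k * U o j * U i k)) * Λ ≤ (36 ^ 4 * 5 ^ 4 * 16) * Y * (Λ * J * M ^ 8) := by
      have : Λ ≤ Λ * J * M ^ 8 := by
        have h1 : Λ * 1 ≤ Λ * J := by gcongr
        have h2 : Λ * J * 1 ≤ Λ * J * M ^ 8 := by gcongr
        linarith only [h1, h2]
      have d1' : A o * A o * (A i * A i) * (A j * A j) * (A k * A k) *
        (U o i * U j k * U o j * U i k) ≤ Y := by linarith only [d1]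
      gcongr
    have f2 : J * ((1600 * 33 * 16 * 125 * 36) * (A o * A i * A j * A k * (U j k * U o j * U i k) *
        (W o i * W o j)) * M ^ 4) ≤ (1600 * 33 * 16 * 125 * 36) * Y * (Λ * J * M ^ 8) := by
      have d1' : A o * A i * A j * A k * (U j k * U o j * U i k) * (W o i * W o j) ≤ Y := by
        linarith only [d2]
      calc _ ≤ J * ((1600 * 33 * 16 * 125 * 36) * Y * M ^ 8) := by gcongr
        _ = (1600 * 33 * 16 * 125 * 36) * Y * (J * M ^ 8) := by ring
        _ ≤ _ := by gcongr
    have f3 : J * ((1600 * 36 ^ 3 * 25 * 16) * (A o * A o * (A i * A i) * (A j * A j) *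
        (U j k * U i k) * (Real.exp m * Real.exp m)) * M ^ 3) ≤
        (1600 * 36 ^ 3 * 25 * 16) * Y * (Λ * J * M ^ 8) := by
      have d1' : A o * A o * (A i * A i) * (A j * A j) *
        (U j k * U i k) * (Real.exp m * Real.exp m) ≤ Y := by linarith only [d3]
      calc _ ≤ J * ((1600 * 36 ^ 3 * 25 * 16) * Y * M ^ 8) := by gcongr
        _ = (1600 * 36 ^ 3 * 25 * 16) * Y * (J * M ^ 8) := by ring
        _ ≤ _ := by gcongr
    have f4 : J * ((1600 * 36 ^ 3 * 25 * 16) * (A o * A o * (A i * A i) * (A k * A k) *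
        (U j k * U o j) * (Real.exp m * Real.exp m)) * M ^ 3) ≤
        (1600 * 36 ^ 3 * 25 * 16) * Y * (Λ * J * M ^ 8) := by
      have d1' : A o * A o * (A i * A i) * (A k * A k) *
        (U j k * U o j) * (Real.exp m * Real.exp m) ≤ Y := by linarith only [d4]
      calc _ ≤ J * ((1600 * 36 ^ 3 * 25 * 16) * Y * M ^ 8) := by gcongr
        _ = (1600 * 36 ^ 3 * 25 * 16) * Y * (J * M ^ 8) := by ring
        _ ≤ _ := by gcongr
    have hYQ : 0 ≤ Y * (Λ * J * M ^ 8) := by positivity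
    linarith only [f1, f2, f3, f4, hYQ]

end

end ACQ


namespace ACQ

/-! ### Primitive configurations: summing over dyadic boxes -/

noncomputable def eL (x : ℝ) : ℕ := Nat.log 2 ⌊x⌋₊

theorem eL_le {x : ℝ} (hx : 1 ≤ x) : (2 : ℝ) ^ eL x ≤ x := by
  have h0 : ⌊x⌋₊ ≠ 0 := by
    have := (Nat.one_le_floor_iff x).2 hx
    omega
  have h1 : 2 ^ eL x ≤ ⌊x⌋₊ := Nat.pow_log_le_self 2 h0
  have h2 : ((2 ^ eL x : ℕ) : ℝ) ≤ (⌊x⌋₊ : ℝ) := by exact_mod_cast h1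
  push_cast at h2
  exact h2.trans (Nat.floor_le (by linarith))

theorem le_eL (x : ℝ) : x ≤ 2 * (2 : ℝ) ^ eL x := by
  have h1 : ⌊x⌋₊ < 2 ^ (eL x + 1) := Nat.lt_pow_succ_log_self (by norm_num) _
  have h2 : ((⌊x⌋₊ : ℕ) : ℝ) + 1 ≤ ((2 ^ (eL x + 1) : ℕ) : ℝ) := by exact_mod_cast h1
  push_cast at h2
  have := Nat.lt_floor_add_one x
  rw [pow_succ] at h2
  linarith

theorem eL_lt {x : ℝ} {L : ℕ} (hx : 1 ≤ x) (h : x < 2 ^ (L + 1)) : eL x < L + 1 := by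
  have h1 := eL_le hx
  have h2 : (2 : ℝ) ^ eL x < 2 ^ (L + 1) := by linarith
  exact (pow_lt_pow_iff_right₀ (by norm_num : (1 : ℝ) < 2)).1 h2

abbrev Ix := Fin 4 ⊕ (Fin 4 × Fin 4) ⊕ (Fin 4 × Fin 4)

noncomputable def key (P : Par) : Ix → ℕ
  | .inl i => eL (nrm (P.κ i))
  | .inr (.inl p) => if p.1 = p.2 then 0 else eL (cont (P.F p.1 p.2))
  | .inr (.inr p) => if p.1 = p.2 then 0 else eL (nrm (prim (P.F p.1 p.2)))

theorem cnt_pi (L : ℕ) : Cnt {f : Ix → ℕ | ∀ x, f x < L + 1} (((L : ℝ) + 1) ^ 36) := by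
  have h : {f : Ix → ℕ | ∀ x, f x < L + 1} =
      ((Fintype.piFinset (fun _ : Ix => Finset.range (L + 1)) : Finset (Ix → ℕ)) :
        Set (Ix → ℕ)) := by
    ext f; simp
  rw [h]
  refine ⟨Finset.finite_toSet _, ?_⟩
  rw [Set.ncard_coe_finset, Fintype.card_piFinset]
  have hc : Fintype.card Ix = 36 := rfl
  simp only [Finset.card_range, Finset.prod_const, Finset.card_univ, hc, Nat.cast_pow,
    Nat.cast_add, Nat.cast_one, le_refl]

/-- primitive configurations -/
def GSp (ρ : ℝ) : Set (Fin 4 → Fin 4 → GI) :=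
  {D | D ∈ GS ρ ∧ ∀ g : GI, (∀ i j, g ∣ D i j) → IsUnit g}

def PS (ρ : ℝ) : Set Par :=
  {P | Valid P ∧ ∀ i j k l, Q4 i j k l → nrm (P.κ i * P.κ j * P.F k l) ≤ ρ}

theorem gsp_ps {ρ m : ℝ} (h : Cnt (PS ρ) m) : Cnt (GSp ρ) m := by
  classical
  let rec1 : Par → (Fin 4 → Fin 4 → GI) := fun P k l =>
    if hkl : k = l then 0 else
      P.κ (exists_Q4' k l hkl).choose * P.κ (exists_Q4' k l hkl).choose_spec.choose * P.F k l
  refine (h.image rec1).subset ?_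
  rintro D ⟨⟨hg, hn⟩, hp⟩
  obtain ⟨P, hv, hP⟩ := exists_par hg hp
  refine ⟨P, ⟨hv, ?_⟩, ?_⟩
  · intro i j k l hq
    rw [← hP i j k l hq]
    exact hn k l
  · funext k l
    by_cases hkl : k = l
    · subst hkl
      simp only [rec1, dif_pos]
      exact (coc_self hg.coc k).symm
    · simp only [rec1, dif_neg hkl]
      have hq := (exists_Q4' k l hkl).choose_spec.choose_spec
      refine (hP _ _ k l ?_).symm
      unfold Q4 at *
      tauto

theorem ps_bounds {P : Par} {ρ : ℝ} (hP : P ∈ PS ρ) {i j k l : Fin 4} (hq : Q4 i j k l) :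
    nrm (P.κ i) ≤ ρ ∧ (cont (P.F k l) : ℝ) ≤ ρ ∧ nrm (prim (P.F k l)) ≤ ρ ∧
    nrm (P.κ i) * nrm (P.κ j) * cont (P.F k l) * nrm (prim (P.F k l)) ≤ ρ := by
  obtain ⟨hv, hn⟩ := hP
  have h := hn i j k l hq
  have hf := hv.Fne k l hq.2.2.2.2.2
  have h1 := one_le_nrm (hv.κne i)
  have h2 := one_le_nrm (hv.κne j)
  have h3 := one_le_cont hf
  have h4 := one_le_nrm (prim_ne_zero hf)
  rw [nrm_mul, nrm_mul, nrm_cont_prim (P.F k l), ← mul_assoc] at h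
  set x := nrm (P.κ i)
  set y := nrm (P.κ j)
  set z := (cont (P.F k l) : ℝ)
  set t := nrm (prim (P.F k l))
  have hxy : 1 ≤ x * y := one_le_mul_of_one_le_of_one_le h1 h2
  have hzt : 1 ≤ z * t := one_le_mul_of_one_le_of_one_le h3 h4
  have e : x * y * z * t = (x * y) * (z * t) := by ring
  refine ⟨?_, ?_, ?_, h⟩ <;> rw [e] at h <;> refine le_trans ?_ h
  · have : x * 1 ≤ x * y := by gcongr
    nlinarith
  · have : z * 1 ≤ z * t := by gcongr
    nlinarith
  · have : 1 * t ≤ z * t := by gcongr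
    nlinarith

theorem prim_bound {R M Z Λ E : ℝ} {J L : ℕ} (hR : 1 < R) (hL : R < 2 ^ (L + 1))
    (hM : ∀ z : GI, z ≠ 0 → nrm z ≤ Z → Cnt {d | d ∣ z} M) (hM1 : 1 ≤ M) (hZ : 320 * R ^ 4 ≤ Z)
    (hΛ : 400 ≤ Λ) (hJ : 1296 * R ^ 4 ≤ 4 ^ J) (hE : 0 ≤ E)
    (hG : ∀ n : ℕ, Λ < 4 ^ (n + 1) → ∃ N, Cnt (GS (320 * R / 2 ^ n)) N ∧ 4 ^ (n + 1) * N ≤ E) :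
    Cnt (GSp R) (((L : ℝ) + 1) ^ 36 *
      (10 ^ 16 * (Λ * J * M ^ 8) * R ^ ((2615 : ℝ) / 1000) + J * (E * (16 * M ^ 8)))) := by
  refine gsp_ps ?_
  have hR0 : 0 < R := by linarith
  refine Cnt.fiber (f := key) ((cnt_pi L).subset ?_) (by positivity) ?_
  · rintro _ ⟨P, hP, rfl⟩
    intro x
    rcases x with i | p | p
    · obtain ⟨j, k, l, hq⟩ := exists_Q4 i
      exact eL_lt (one_le_nrm (hP.1.κne i)) ((ps_bounds hP hq).1.trans_lt hL)
    · by_cases hp : p.1 = p.2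
      · simp [key, hp]
      · simp only [key, if_neg hp]
        obtain ⟨k, l, hq⟩ := exists_Q4' _ _ hp
        have hq2 : Q4 k l p.1 p.2 := by unfold Q4 at *; tauto
        exact eL_lt (one_le_cont (hP.1.Fne _ _ hp)) ((ps_bounds hP hq2).2.1.trans_lt hL)
    · by_cases hp : p.1 = p.2
      · simp [key, hp]
      · simp only [key, if_neg hp]
        obtain ⟨k, l, hq⟩ := exists_Q4' _ _ hp
        have hq2 : Q4 k l p.1 p.2 := by unfold Q4 at *; tauto
        exact eL_lt (one_le_nrm (prim_ne_zero (hP.1.Fne _ _ hp)))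
          ((ps_bounds hP hq2).2.2.1.trans_lt hL)
  rintro _ ⟨P0, hP0, rfl⟩
  have one2 : ∀ n : ℕ, (1 : ℝ) ≤ 2 ^ n := fun n => one_le_pow₀ (by norm_num)
  refine box_bound (A := fun i => 2 ^ key P0 (.inl i))
    (U := fun k l => 2 ^ key P0 (.inr (.inl (k, l))))
    (W := fun k l => 2 ^ key P0 (.inr (.inr (k, l)))) ⟨fun i => one2 _, fun k l => one2 _,
      fun k l => one2 _⟩ ?_ ?_ ?_ ?_ hR ?_ hM hM1 hZ hΛ hJ hE hG
  · rintro P ⟨hP, hk⟩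
    refine ⟨hP.1, ?_⟩
    rw [← hk]
    constructor
    · intro i; exact eL_le (one_le_nrm (hP.1.κne i))
    · intro i; exact le_eL _
    · intro k l hkl
      simp only [key, if_neg hkl]
      exact eL_le (one_le_cont (hP.1.Fne _ _ hkl))
    · intro k l hkl
      simp only [key, if_neg hkl]
      exact le_eL _
    · intro k l hkl
      simp only [key, if_neg hkl]
      exact eL_le (one_le_nrm (prim_ne_zero (hP.1.Fne _ _ hkl)))
    · intro k l hkl
      simp only [key, if_neg hkl]
      exact le_eL _
  · intro i j
    by_cases h : i = j
    · rw [h]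
    · have h' : ¬ j = i := fun e => h e.symm
      simp only [key, if_neg h, if_neg h']
      rw [hP0.1.anti i j, cont_neg]
  · intro i j
    by_cases h : i = j
    · rw [h]
    · have h' : ¬ j = i := fun e => h e.symm
      simp only [key, if_neg h, if_neg h']
      rw [hP0.1.anti i j, prim_neg _ (hP0.1.Fne _ _ h), nrm_neg]
  · intro i j k l hq
    have h : ¬ i = j := hq.1
    have h' : ¬ k = l := hq.2.2.2.2.2
    simp only [key, if_neg h, if_neg h']
    obtain ⟨e, he, h2⟩ := hP0.1.conj i j k l hq
    rw [h2, nrm_mul, isUnit_iff_nrm.1 he, one_mul, nrm_star]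
  · intro i j k l hq
    have h' : ¬ k = l := hq.2.2.2.2.2
    simp only [key, if_neg h']
    have hf := hP0.1.Fne k l h'
    refine le_trans ?_ (ps_bounds hP0 hq).2.2.2
    have h1 := eL_le (one_le_nrm (hP0.1.κne i))
    have h2 := eL_le (one_le_nrm (hP0.1.κne j))
    have h3 := eL_le (one_le_cont hf)
    have h4 := eL_le (one_le_nrm (prim_ne_zero hf))
    have n1 := nrm_nonneg (P0.κ i)
    have n2 := nrm_nonneg (P0.κ j)
    have n3 : (0 : ℝ) ≤ cont (P0.F k l) := by linarith [one_le_cont hf]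
    gcongr

end ACQ


namespace ACQ

/-! ### The induction on the size -/

theorem exists_dyadic {R : ℝ} (hR : 1 ≤ R) : ∃ L : ℕ, (2 : ℝ) ^ L ≤ R ∧ R < 2 ^ (L + 1) := by
  refine ⟨eL R, eL_le hR, ?_⟩
  have h1 : ⌊R⌋₊ < 2 ^ (eL R + 1) := Nat.lt_pow_succ_log_self (by norm_num) _
  have h2 : ((⌊R⌋₊ : ℕ) : ℝ) + 1 ≤ ((2 ^ (eL R + 1) : ℕ) : ℝ) := by exact_mod_cast h1
  push_cast at h2
  have := Nat.lt_floor_add_one R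
  linarith

theorem log_count {ε : ℝ} (hε : 0 < ε) {R : ℝ} (hR : 1 ≤ R) {L : ℕ} (hL : (2 : ℝ) ^ L ≤ R) :
    (L : ℝ) + 1 ≤ (2 / ε + 1) * R ^ ε := by
  have h1 : Real.log R ≤ R ^ ε / ε := Real.log_le_rpow_div (by linarith) hε
  have h2 : (L : ℝ) * Real.log 2 ≤ Real.log R := by
    rw [← Real.log_pow]
    exact Real.log_le_log (by positivity) hL
  have h3 : (1 / 2 : ℝ) ≤ Real.log 2 := by linarith [Real.log_two_gt_d9]
  have h4 : (L : ℝ) * (1 / 2) ≤ L * Real.log 2 := by gcongr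
  have h5 : 1 ≤ R ^ ε := Real.one_le_rpow hR hε.le
  have h6 : (2 / ε + 1) * R ^ ε = 2 * (R ^ ε / ε) + R ^ ε := by ring
  linarith

theorem fudge (δ : ℝ) (hδ : 0 < δ) : ∃ C : ℝ, 1 ≤ C ∧ ∀ R : ℝ, 1 ≤ R → ∃ L J : ℕ, ∃ M : ℝ,
    R < 2 ^ (L + 1) ∧ 1 ≤ M ∧
    (∀ z : GI, z ≠ 0 → nrm z ≤ 320 * R ^ 4 → Cnt {d | d ∣ z} M) ∧
    1296 * R ^ 4 ≤ 4 ^ J ∧ ((L : ℝ) + 1) ^ 36 * (10 ^ 16 * (J * M ^ 8)) ≤ C * R ^ δ := by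
  set ε := δ / 69 with hε
  have hε0 : 0 < ε := by positivity
  obtain ⟨C, hC, hdiv⟩ := divisor_bound ε hε0
  set c := 2 / ε + 1
  have hc1 : 1 ≤ c := by
    have : 0 ≤ 2 / ε := by positivity
    linarith
  have h320 : (1 : ℝ) ≤ 320 ^ ε := Real.one_le_rpow (by norm_num) hε0.le
  refine ⟨10 ^ 16 * (8 * (c ^ 37 * (C * 320 ^ ε) ^ 8)), ?_, ?_⟩
  · have h1 : 1 ≤ C * 320 ^ ε := one_le_mul_of_one_le_of_one_le hC h320
    have h2 : 1 ≤ c ^ 37 * (C * 320 ^ ε) ^ 8 :=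
      one_le_mul_of_one_le_of_one_le (one_le_pow₀ hc1) (one_le_pow₀ h1)
    linarith
  intro R hR
  have hR0 : 0 < R := by linarith
  obtain ⟨L, hL1, hL2⟩ := exists_dyadic hR
  have hRe : 1 ≤ R ^ ε := Real.one_le_rpow hR hε0.le
  have hMeq : C * (320 * R ^ 4) ^ ε = C * 320 ^ ε * (R ^ ε) ^ 4 := by
    rw [Real.mul_rpow (by norm_num) (by positivity), ← Real.rpow_natCast, ← Real.rpow_natCast,
      ← Real.rpow_mul hR0.le, ← Real.rpow_mul hR0.le]
    ring_nf
  refine ⟨L, 2 * L + 8, C * (320 * R ^ 4) ^ ε, hL2, ?_, ?_, ?_, ?_⟩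
  · rw [hMeq]
    exact one_le_mul_of_one_le_of_one_le (one_le_mul_of_one_le_of_one_le hC h320)
      (one_le_pow₀ hRe)
  · intro z hz hn
    refine (hdiv z hz).le ?_
    have := nrm_nonneg z
    gcongr
  · have h1 : R ^ 4 ≤ (2 ^ (L + 1)) ^ 4 := pow_le_pow_left₀ hR0.le hL2.le 4
    have h2 : (4 : ℝ) ^ (2 * L + 8) = 4 ^ 6 * (2 ^ (L + 1)) ^ 4 := by
      rw [show (4 : ℝ) = 2 ^ 2 by norm_num, ← pow_mul, ← pow_mul, ← pow_mul, ← pow_add]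
      ring_nf
    rw [h2]
    exact mul_le_mul (by norm_num) h1 (by positivity) (by norm_num)
  · have h1 := log_count hε0 hR hL1
    have hJ : ((2 * L + 8 : ℕ) : ℝ) ≤ 8 * ((L : ℝ) + 1) := by
      push_cast
      have : (0 : ℝ) ≤ L := Nat.cast_nonneg _
      linarith
    have hRd : R ^ δ = (R ^ ε) ^ 69 := by
      rw [← Real.rpow_natCast, ← Real.rpow_mul hR0.le, hε]
      norm_num
    rw [hMeq, hRd]
    calc ((L : ℝ) + 1) ^ 36 * (10 ^ 16 * (((2 * L + 8 : ℕ) : ℝ) * (C * 320 ^ ε * (R ^ ε) ^ 4) ^ 8))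
        ≤ ((L : ℝ) + 1) ^ 36 * (10 ^ 16 * ((8 * ((L : ℝ) + 1)) *
          (C * 320 ^ ε * (R ^ ε) ^ 4) ^ 8)) := by
          have : 0 ≤ C := by linarith
          gcongr
      _ = 10 ^ 16 * (8 * (((L : ℝ) + 1) ^ 37 * ((C * 320 ^ ε) ^ 8 * (R ^ ε) ^ 32))) := by ring
      _ ≤ 10 ^ 16 * (8 * ((c * R ^ ε) ^ 37 * ((C * 320 ^ ε) ^ 8 * (R ^ ε) ^ 32))) := by
          have : 0 ≤ C := by linarith
          gcongr
      _ = _ := by ring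

theorem gs_empty {ρ : ℝ} (h : ρ < 1) : GS ρ = ∅ := by
  ext D
  simp only [Set.mem_empty_iff_false, iff_false]
  rintro ⟨hg, hn⟩
  have h1 := one_le_nrm (hg.ne 0 1 (by decide))
  linarith [hn 0 1]

theorem gs_mono {ρ ρ' : ℝ} (h : ρ ≤ ρ') : GS ρ ⊆ GS ρ' := fun _ hD =>
  ⟨hD.1, fun i j => (hD.2 i j).trans h⟩

theorem gs_trivial {R : ℝ} (hR : 1 ≤ R) : Cnt (GS R) ((9 * R ^ 2) ^ 3) := by
  refine Cnt.of_injOn (f := fun D : Fin 4 → Fin 4 → GI => (D 0 1, D 0 2, D 0 3))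
    ((cnt_prod (cnt_disc R hR) (cnt_prod (cnt_disc R hR) (cnt_disc R hR))).mono ?_
      (le_of_eq (by ring))) ?_
  · rintro _ ⟨D, hD, rfl⟩
    exact ⟨hD.2 0 1, hD.2 0 2, hD.2 0 3⟩
  · intro D hD D' hD' h
    simp only [Prod.mk.injEq] at h
    obtain ⟨h1, h2, h3⟩ := h
    have key : ∀ j, D 0 j = D' 0 j := by
      intro j
      have q : Q4 0 1 2 3 := by unfold Q4; decide
      rcases q.cases j with h | h | h | h <;> rw [h]
      · rw [coc_self hD.1.coc, coc_self hD'.1.coc]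
      · exact h1
      · exact h2
      · exact h3
    funext i j
    rw [coc_add hD.1.coc i 0 j, coc_add hD'.1.coc i 0 j, coc_anti hD.1.coc 0 i,
      coc_anti hD'.1.coc 0 i, key, key]

theorem prim_step : ∃ C : ℝ, 1 ≤ C ∧ ∀ K R : ℝ, 1 ≤ K → 1 ≤ R →
    (∀ ρ, 1 ≤ ρ → ρ ≤ R / 2 → Cnt (GS ρ) (K * ρ ^ ((262 : ℝ) / 100))) →
    Cnt (GSp R) (C * K * R ^ ((26199 : ℝ) / 10000)) := by
  obtain ⟨C, hC, hf⟩ := fudge (1 / 10000) (by norm_num)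
  obtain ⟨R0, hR0⟩ : ∃ R0 : ℝ, ∀ R ≥ R0, 64 ≤ R ^ ((1 : ℝ) / 2000) := by
    have h := (tendsto_rpow_atTop (by norm_num : (0 : ℝ) < 1 / 2000)).eventually_ge_atTop 64
    exact Filter.eventually_atTop.1 h
  set R1 := max R0 2
  have hR1 : 2 ≤ R1 := le_max_right _ _
  set B := C * (400 + 64 * 320 ^ 3)
  set T := (9 * R1 ^ 2) ^ 3
  have hT : 0 ≤ T := by positivity
  have hB : 1 ≤ B := by
    have : 1 ≤ C * (400 + 64 * 320 ^ 3) := by nlinarith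
    exact this
  refine ⟨B + T, by linarith, ?_⟩
  intro K R hK hR hind
  have hR0' : 0 < R := by linarith
  have hRp : 1 ≤ R ^ ((26199 : ℝ) / 10000) := Real.one_le_rpow hR (by norm_num)
  rcases lt_or_ge R R1 with hlt | hge
  · refine (gs_trivial (R := R1) (by linarith)).mono ?_ ?_
    · exact fun D hD => gs_mono hlt.le hD.1
    · have h1 : T ≤ (B + T) * K := by nlinarith
      have h2 : 0 ≤ (B + T) * K := by linarith
      nlinarith
  have h64 := hR0 R (le_trans (le_max_left _ _) hge)
  obtain ⟨L, J, M, hL, hM1, hM, hJ, hbd⟩ := hf R hR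
  set s := R ^ ((1 : ℝ) / 2000) with hs
  have hs2 : s ^ 2 = R ^ ((1 : ℝ) / 1000) := by
    rw [hs, ← Real.rpow_natCast, ← Real.rpow_mul hR0'.le]; norm_num
  set E := 4 * K * 320 ^ 3 * R ^ ((261969 : ℝ) / 100000) with hE
  have hE0 : 0 ≤ E := by positivity
  have h := prim_bound (R := R) (M := M) (Z := 320 * R ^ 4) (Λ := 400 * s ^ 2) (E := E) (J := J)
    (L := L) (by linarith) hL hM hM1 le_rfl (by nlinarith) hJ hE0 ?_
  · refine h.le ?_
    have e1 : ((L : ℝ) + 1) ^ 36 * (10 ^ 16 * (400 * s ^ 2 * J * M ^ 8) * R ^ ((2615 : ℝ) / 1000) +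
        J * (E * (16 * M ^ 8))) ≤ ((L : ℝ) + 1) ^ 36 * (10 ^ 16 * (J * M ^ 8)) *
        (400 * s ^ 2 * R ^ ((2615 : ℝ) / 1000) + 16 * E) := by
      have h1 : 0 ≤ ((L : ℝ) + 1) ^ 36 * (J * (E * (16 * M ^ 8))) := by
        have : 0 ≤ M := by linarith
        positivity
      have h2 : ((L : ℝ) + 1) ^ 36 * (10 ^ 16 * (J * M ^ 8)) *
        (400 * s ^ 2 * R ^ ((2615 : ℝ) / 1000) + 16 * E) =
        ((L : ℝ) + 1) ^ 36 * (10 ^ 16 * (400 * s ^ 2 * J * M ^ 8) * R ^ ((2615 : ℝ) / 1000)) +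
        10 ^ 16 * (((L : ℝ) + 1) ^ 36 * (J * (E * (16 * M ^ 8)))) := by ring
      rw [h2, mul_add]
      linarith
    refine e1.trans ?_
    have e2 : s ^ 2 * R ^ ((2615 : ℝ) / 1000) ≤ R ^ ((261969 : ℝ) / 100000) := by
      rw [hs2, ← Real.rpow_add hR0']
      exact Real.rpow_le_rpow_of_exponent_le hR (by norm_num)
    have e3 : R ^ ((1 : ℝ) / 10000) * R ^ ((261969 : ℝ) / 100000) ≤
        R ^ ((26199 : ℝ) / 10000) := by
      rw [← Real.rpow_add hR0']
      exact Real.rpow_le_rpow_of_exponent_le hR (by norm_num)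
    set X := R ^ ((261969 : ℝ) / 100000) with hX
    have hX0 : 0 ≤ X := by positivity
    have e4 : 400 * s ^ 2 * R ^ ((2615 : ℝ) / 1000) + 16 * E ≤ (400 + 64 * 320 ^ 3) * K * X := by
      have : X ≤ K * X := le_mul_of_one_le_left hX0 hK
      rw [hE]
      nlinarith
    have hJ0 : 0 ≤ 400 * s ^ 2 * R ^ ((2615 : ℝ) / 1000) + 16 * E := by positivity
    calc _ ≤ (C * R ^ ((1 : ℝ) / 10000)) * ((400 + 64 * 320 ^ 3) * K * X) := by
            apply mul_le_mul hbd e4 hJ0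
            positivity
      _ = B * K * (R ^ ((1 : ℝ) / 10000) * X) := by ring
      _ ≤ B * K * R ^ ((26199 : ℝ) / 10000) := by gcongr
      _ ≤ _ := by
            gcongr
            linarith
  · intro n hn
    have hn2 : 10 * s < 2 ^ n := by
      have h1 : (20 * s) ^ 2 < ((2 : ℝ) ^ (n + 1)) ^ 2 := by
        rw [← pow_mul, mul_comm (n + 1) 2, pow_mul]
        norm_num
        linarith
      have h2 := lt_of_pow_lt_pow_left₀ 2 (by positivity) h1
      rw [pow_succ] at h2
      linarith
    have h2n : (0 : ℝ) < 2 ^ n := by positivity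
    rcases lt_or_ge (320 * R / 2 ^ n) 1 with hlt | hge1
    · refine ⟨0, ?_, by simpa using hE0⟩
      rw [gs_empty hlt]
      exact cnt_empty le_rfl
    · refine ⟨_, hind _ hge1 ?_, ?_⟩
      · rw [div_le_div_iff₀ h2n (by norm_num)]
        nlinarith
      · rw [Real.div_rpow (by positivity) h2n.le, Real.mul_rpow (by norm_num) hR0'.le]
        have p1 : (320 : ℝ) ^ ((262 : ℝ) / 100) ≤ 320 ^ 3 := by
          rw [← Real.rpow_natCast]
          exact Real.rpow_le_rpow_of_exponent_le (by norm_num) (by norm_num)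
        have p2 : R ^ ((262 : ℝ) / 100) =
            R ^ ((261969 : ℝ) / 100000) * R ^ ((31 : ℝ) / 100000) := by
          rw [← Real.rpow_add hR0']; norm_num
        have p3 : ((2 : ℝ) ^ n) ^ ((262 : ℝ) / 100) =
            ((2 : ℝ) ^ n) ^ 2 * ((2 : ℝ) ^ n) ^ ((62 : ℝ) / 100) := by
          rw [← Real.rpow_natCast _ 2, ← Real.rpow_add h2n]; norm_num
        have p4 : R ^ ((31 : ℝ) / 100000) ≤ ((2 : ℝ) ^ n) ^ ((62 : ℝ) / 100) := by
          have : R ^ ((31 : ℝ) / 100000) = s ^ ((62 : ℝ) / 100) := by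
            rw [hs, ← Real.rpow_mul hR0'.le]; norm_num
          rw [this]
          refine Real.rpow_le_rpow (by positivity) ?_ (by norm_num)
          linarith
        have p5 : (4 : ℝ) ^ (n + 1) = 4 * ((2 : ℝ) ^ n) ^ 2 := by
          rw [pow_succ, ← pow_mul, mul_comm n 2, pow_mul]; norm_num [mul_comm]
        rw [p2, p3, p5]
        set t := ((2 : ℝ) ^ n) ^ ((62 : ℝ) / 100)
        have ht : 0 < t := by positivity
        set X := R ^ ((261969 : ℝ) / 100000) with hX
        have hX0 : 0 ≤ X := by positivity
        have : 4 * ((2 : ℝ) ^ n) ^ 2 * (K * ((320 : ℝ) ^ ((262 : ℝ) / 100) *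
            (X * R ^ ((31 : ℝ) / 100000)) / (((2 : ℝ) ^ n) ^ 2 * t))) =
            4 * K * (320 : ℝ) ^ ((262 : ℝ) / 100) * X * (R ^ ((31 : ℝ) / 100000) / t) := by
          field_simp
        rw [this]
        have p6 : R ^ ((31 : ℝ) / 100000) / t ≤ 1 := (div_le_one ht).2 p4
        calc _ ≤ 4 * K * (320 : ℝ) ^ 3 * X * 1 := by gcongr
          _ = E := by rw [hE]; ring

end ACQ


namespace ACQ

/-! ### From primitive configurations to all configurations -/

theorem good_of_mul {g : GI} (hg : g ≠ 0) {D : Fin 4 → Fin 4 → GI}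
    (h : Good (fun i j => g * D i j)) : Good D := by
  have hn : g.norm ≠ 0 := (GaussianInt.norm_pos.2 hg).ne'
  have hgs := mul_star_eq g
  constructor
  · intro i j k
    have := h.coc i j k
    have h2 : g * (D i j + D j k + D k i) = 0 := by linear_combination this
    exact (mul_eq_zero.1 h2).resolve_left hg
  · intro i j hij h0
    exact h.ne i j hij (by rw [h0, mul_zero])
  · intro i j k l hq
    have h1 := h.cross i j k l hq
    have e : g * D i j * (g * D k l) * star (g * D i k * (g * D l j)) =
        ((g.norm * g.norm : ℤ) : GI) * (D i j * D k l * star (D i k * D l j)) := by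
      push_cast
      rw [← hgs]
      simp only [star_mul']
      ring
    beta_reduce at h1
    rw [e] at h1
    exact im_zero_cancel (mul_ne_zero hn hn) h1
  · intro i j k l hq h0
    refine h.ncol i j k l hq ?_
    have e : g * D i j * star (g * D j k) =
        ((g.norm : ℤ) : GI) * (D i j * star (D j k)) := by
      rw [← hgs]
      simp only [star_mul']
      ring
    beta_reduce
    rw [e, im_int_mul, h0, mul_zero]
  · intro i j k l hq h0
    refine h.asym i j k l hq ?_
    simp only [Zsqrtd.norm_mul, h0]

theorem exists_gcd {D : Fin 4 → Fin 4 → GI} (hD : Good D) :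
    ∃ g : GI, g ≠ 0 ∧ ∃ D' : Fin 4 → Fin 4 → GI, D = (fun i j => g * D' i j) ∧ Good D' ∧
      ∀ h : GI, (∀ i j, h ∣ D' i j) → IsUnit h := by
  set g := EuclideanDomain.gcd (D 0 1) (EuclideanDomain.gcd (D 0 2) (D 0 3)) with hg
  have g1 : g ∣ D 0 1 := EuclideanDomain.gcd_dvd_left _ _
  have g23 : g ∣ EuclideanDomain.gcd (D 0 2) (D 0 3) := EuclideanDomain.gcd_dvd_right _ _
  have g2 : g ∣ D 0 2 := g23.trans (EuclideanDomain.gcd_dvd_left _ _)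
  have g3 : g ∣ D 0 3 := g23.trans (EuclideanDomain.gcd_dvd_right _ _)
  have hg0 : g ≠ 0 := by
    intro h0
    rw [h0] at g1
    exact hD.ne 0 1 (by decide) (zero_dvd_iff.1 g1)
  have hd0 : ∀ j, g ∣ D 0 j := by
    intro j
    have q : Q4 0 1 2 3 := by unfold Q4; decide
    rcases q.cases j with h | h | h | h <;> rw [h]
    · rw [coc_self hD.coc]; exact dvd_zero _
    · exact g1
    · exact g2
    · exact g3
  have hd : ∀ i j, g ∣ D i j := by
    intro i j
    rw [coc_add hD.coc i 0 j, coc_anti hD.coc 0 i]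
    exact dvd_add (hd0 i).neg_right (hd0 j)
  choose D' hD' using hd
  have he : D = (fun i j => g * D' i j) := by funext i j; exact hD' i j
  refine ⟨g, hg0, D', he, good_of_mul hg0 (he ▸ hD), ?_⟩
  intro h hh
  have k : ∀ i j, g * h ∣ D i j := by
    intro i j; rw [hD' i j]; exact mul_dvd_mul_left g (hh i j)
  have k2 : g * h ∣ g * 1 := by
    rw [mul_one]
    exact EuclideanDomain.dvd_gcd (k 0 1) (EuclideanDomain.dvd_gcd (k 0 2) (k 0 3))
  exact isUnit_of_dvd_one ((mul_dvd_mul_iff_left hg0).1 k2)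

theorem gs_step : ∃ C : ℝ, 1 ≤ C ∧ ∀ K R : ℝ, 1 ≤ K → 1 ≤ R →
    (∀ ρ, 1 ≤ ρ → ρ ≤ R / 2 → Cnt (GS ρ) (K * ρ ^ ((262 : ℝ) / 100))) →
    Cnt (GS R) (C * K * R ^ ((261995 : ℝ) / 100000)) := by
  obtain ⟨C, hC, hp⟩ := prim_step
  set c := 2 / ((5 : ℝ) / 100000) + 1 with hc
  have hc1 : 1 ≤ c := by rw [hc]; norm_num
  refine ⟨c * (36 * C), by nlinarith, ?_⟩
  intro K R hK hR hind
  have hR0 : 0 < R := by linarith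
  obtain ⟨L, hL1, hL2⟩ := exists_dyadic hR
  have hlog := log_count (ε := 5 / 100000) (by norm_num) hR hL1
  have hI : Cnt {j : ℕ | j < L + 1} ((L : ℝ) + 1) := by
    have : {j : ℕ | j < L + 1} = ((Finset.range (L + 1) : Finset ℕ) : Set ℕ) := by ext; simp
    rw [this]
    refine ⟨Finset.finite_toSet _, ?_⟩
    rw [Set.ncard_coe_finset, Finset.card_range]
    push_cast
    exact le_rfl
  set m := 36 * C * K * R ^ ((26199 : ℝ) / 10000) with hm
  have hm0 : 0 ≤ m := by
    have : 0 ≤ C := by linarith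
    positivity
  have hU : Cnt (⋃ j ∈ {j : ℕ | j < L + 1}, (fun p : GI × (Fin 4 → Fin 4 → GI) =>
      (fun i k => p.1 * p.2 i k)) '' ({z : GI | nrm z ≤ 2 * 2 ^ j} ×ˢ GSp (R / 2 ^ j)))
      (((L : ℝ) + 1) * m) := by
    refine cnt_biUnion hI hm0 ?_
    intro j hj
    have hj' : j < L + 1 := hj
    have h2j : (1 : ℝ) ≤ 2 ^ j := one_le_pow₀ (by norm_num)
    have h2j0 : (0 : ℝ) < 2 ^ j := by linarith
    have hjR : (2 : ℝ) ^ j ≤ R := le_trans (pow_le_pow_right₀ (by norm_num) (by omega)) hL1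
    have h1 : 1 ≤ R / 2 ^ j := (one_le_div h2j0).2 hjR
    have h2 : R / 2 ^ j ≤ R := div_le_self hR0.le h2j
    have h3 := hp K (R / 2 ^ j) hK h1 (fun ρ a b => hind ρ a (by linarith))
    refine ((cnt_prod (cnt_disc2 h2j) h3).image _).le ?_
    rw [Real.div_rpow hR0.le h2j0.le]
    have h4 : ((2 : ℝ) ^ j) ^ 2 ≤ ((2 : ℝ) ^ j) ^ ((26199 : ℝ) / 10000) := by
      rw [← Real.rpow_natCast _ 2]
      exact Real.rpow_le_rpow_of_exponent_le h2j (by norm_num)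
    set t := ((2 : ℝ) ^ j) ^ ((26199 : ℝ) / 10000)
    have ht : 0 < t := by positivity
    have e : 36 * ((2 : ℝ) ^ j) ^ 2 * (C * K * (R ^ ((26199 : ℝ) / 10000) / t)) =
        m * (((2 : ℝ) ^ j) ^ 2 / t) := by rw [hm]; ring
    rw [e]
    exact mul_le_of_le_one_right hm0 ((div_le_one ht).2 h4)
  refine hU.mono ?_ ?_
  · rintro D ⟨hD, hn⟩
    obtain ⟨g, hg0, D', he, hG, hpr⟩ := exists_gcd hD
    have hg1 := one_le_nrm hg0
    have hbnd : ∀ i j, nrm g * nrm (D' i j) ≤ R := by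
      intro i j
      have := hn i j
      rw [he] at this
      simpa only [nrm_mul] using this
    have hgR : nrm g ≤ R := by
      have h1 := one_le_nrm (hG.ne 0 1 (by decide))
      have h2 := hbnd 0 1
      nlinarith
    have hlt : eL (nrm g) < L + 1 := eL_lt hg1 (hgR.trans_lt hL2)
    simp only [Set.mem_iUnion]
    refine ⟨eL (nrm g), hlt, (g, D'), ⟨le_eL _, ⟨hG, ?_⟩, hpr⟩, he.symm⟩
    intro i j
    rw [le_div_iff₀ (by positivity)]
    have h1 := eL_le hg1
    have h2 := nrm_nonneg (D' i j)
    have h3 := hbnd i j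
    nlinarith
  · have e : R ^ ((261995 : ℝ) / 100000) =
        R ^ ((5 : ℝ) / 100000) * R ^ ((26199 : ℝ) / 10000) := by
      rw [← Real.rpow_add hR0]; norm_num
    rw [e]
    calc ((L : ℝ) + 1) * m ≤ (c * R ^ ((5 : ℝ) / 100000)) * m := by gcongr
      _ = _ := by rw [hm]; ring

theorem gs_bound : ∃ K : ℝ, 1 ≤ K ∧ ∀ R : ℝ, 1 ≤ R → Cnt (GS R) (K * R ^ ((262 : ℝ) / 100)) := by
  obtain ⟨C, hC, hs⟩ := gs_step
  obtain ⟨R0, hR0⟩ : ∃ R0 : ℝ, ∀ R ≥ R0, C ≤ R ^ ((5 : ℝ) / 100000) := by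
    have h := (tendsto_rpow_atTop (by norm_num : (0 : ℝ) < 5 / 100000)).eventually_ge_atTop C
    exact Filter.eventually_atTop.1 h
  set R1 := max R0 2
  have hR1 : 2 ≤ R1 := le_max_right _ _
  have hK : 1 ≤ (9 * R1 ^ 2) ^ 3 := one_le_pow₀ (by nlinarith)
  refine ⟨(9 * R1 ^ 2) ^ 3, hK, ?_⟩
  set K := (9 * R1 ^ 2) ^ 3
  have main : ∀ n : ℕ, ∀ R : ℝ, 1 ≤ R → R ≤ 2 ^ n → Cnt (GS R) (K * R ^ ((262 : ℝ) / 100)) := by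
    intro n
    have small : ∀ R : ℝ, 1 ≤ R → R < R1 → Cnt (GS R) (K * R ^ ((262 : ℝ) / 100)) := by
      intro R hR hlt
      refine (gs_trivial (R := R1) (by linarith)).mono (gs_mono hlt.le) ?_
      exact le_mul_of_one_le_right (by linarith) (Real.one_le_rpow hR (by norm_num))
    induction n with
    | zero =>
      intro R hR h1
      refine small R hR ?_
      rw [pow_zero] at h1
      linarith
    | succ n ih =>
      intro R hR h1
      rcases lt_or_ge R R1 with hlt | hge
      · exact small R hR hlt
      have hR0' : 0 < R := by linarith
      have h2 := hs K R hK hR (fun ρ a b => ih ρ a (by rw [pow_succ] at h1; linarith))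
      refine h2.le ?_
      have h3 := hR0 R (le_trans (le_max_left _ _) hge)
      have e : R ^ ((262 : ℝ) / 100) =
          R ^ ((5 : ℝ) / 100000) * R ^ ((261995 : ℝ) / 100000) := by
        rw [← Real.rpow_add hR0']; norm_num
      rw [e]
      calc C * K * R ^ ((261995 : ℝ) / 100000)
          ≤ R ^ ((5 : ℝ) / 100000) * K * R ^ ((261995 : ℝ) / 100000) := by gcongr
        _ = _ := by ring
  intro R hR
  obtain ⟨n, hn⟩ := pow_unbounded_of_one_lt R (by norm_num : (1 : ℝ) < 2)
  exact main n R hR hn.le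

end ACQ

namespace ACQ

/-! ### The geometric reduction -/

abbrev E2 := EuclideanSpace ℝ (Fin 2)

theorem mem_span_of_det {v y : E2} (hv : v ≠ 0) (h : v 0 * y 1 = v 1 * y 0) :
    y ∈ Submodule.span ℝ {v} := by
  have hpos : v 0 ^ 2 + v 1 ^ 2 ≠ 0 := by
    intro h0
    apply hv
    ext i
    fin_cases i
    · have : v 0 = 0 := by nlinarith [sq_nonneg (v 0), sq_nonneg (v 1)]
      simpa using this
    · have : v 1 = 0 := by nlinarith [sq_nonneg (v 0), sq_nonneg (v 1)]
      simpa using this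
  rw [Submodule.mem_span_singleton]
  refine ⟨(v 0 * y 0 + v 1 * y 1) / (v 0 ^ 2 + v 1 ^ 2), ?_⟩
  ext i
  fin_cases i
  · simp only [PiLp.smul_apply, smul_eq_mul, Fin.zero_eta]
    field_simp
    linear_combination (v 1) * h
  · simp only [PiLp.smul_apply, smul_eq_mul, Fin.mk_one]
    field_simp
    linear_combination (-(v 0)) * h

theorem mem_orth_of_dot {v y : E2} (h : v 0 * y 0 + v 1 * y 1 = 0) :
    y ∈ (Submodule.span ℝ {v})ᗮ := by
  rw [Submodule.mem_orthogonal_singleton_iff_inner_right, PiLp.inner_apply, Fin.sum_univ_two]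
  simp only [RCLike.inner_apply, conj_trivial]
  linarith

theorem exists_refl (c v : E2) (hv : v ≠ 0) :
    ∃ φ : E2 ≃ᵃⁱ[ℝ] E2, IsLineReflection φ ∧ ∀ x y : E2,
      v 0 * (x 1 + y 1 - 2 * c 1) = v 1 * (x 0 + y 0 - 2 * c 0) →
      v 0 * (x 0 - y 0) + v 1 * (x 1 - y 1) = 0 → φ x = y ∧ φ y = x := by
  set L : AffineSubspace ℝ E2 := AffineSubspace.mk' c (Submodule.span ℝ {v}) with hL
  have hd : L.direction = Submodule.span ℝ {v} := AffineSubspace.direction_mk' _ _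
  have : Nonempty L := ⟨⟨c, AffineSubspace.self_mem_mk' _ _⟩⟩
  have hswap : ∀ x y : E2,
      v 0 * (x 1 + y 1 - 2 * c 1) = v 1 * (x 0 + y 0 - 2 * c 0) →
      v 0 * (x 0 - y 0) + v 1 * (x 1 - y 1) = 0 → EuclideanGeometry.reflection L x = y := by
    intro x y h1 h2
    set m : E2 := (1 / 2 : ℝ) • (x + y) with hm
    set w : E2 := (1 / 2 : ℝ) • (x - y) with hw
    have hmL : m ∈ L := by
      rw [hL, AffineSubspace.mem_mk']
      apply mem_span_of_det hv
      simp only [hm, vsub_eq_sub, PiLp.sub_apply, PiLp.smul_apply, PiLp.add_apply, smul_eq_mul]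
      linarith
    have hwd : w ∈ L.directionᗮ := by
      rw [hd]
      apply mem_orth_of_dot
      simp only [hw, PiLp.sub_apply, PiLp.smul_apply, smul_eq_mul]
      linarith
    have hr := EuclideanGeometry.reflection_orthogonal_vadd hmL hwd
    have e1 : w +ᵥ m = x := by
      rw [vadd_eq_add, hm, hw]; module
    have e2 : -w +ᵥ m = y := by
      rw [vadd_eq_add, hm, hw]; module
    rwa [e1, e2] at hr
  refine ⟨EuclideanGeometry.reflection L, ⟨L, ?_, fun x => ?_⟩, fun x y h1 h2 => ⟨hswap x y h1 h2, ?_⟩⟩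
  · rw [hd]; exact finrank_span_singleton hv
  · exact EuclideanGeometry.reflection_eq_self_iff x
  · exact hswap y x (by linarith) (by linarith)

theorem exists_refl_swap {c p q s t : E2} {r : ℝ} (hr : 0 < r)
    (hp : (p 0 - c 0) ^ 2 + (p 1 - c 1) ^ 2 = r) (hq : (q 0 - c 0) ^ 2 + (q 1 - c 1) ^ 2 = r)
    (hs : (s 0 - c 0) ^ 2 + (s 1 - c 1) ^ 2 = r) (ht : (t 0 - c 0) ^ 2 + (t 1 - c 1) ^ 2 = r)
    (hpt : p ≠ t)
    (hre : (p 0 - c 0) * (q 0 - c 0) + (p 1 - c 1) * (q 1 - c 1) =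
      (s 0 - c 0) * (t 0 - c 0) + (s 1 - c 1) * (t 1 - c 1))
    (him : (p 0 - c 0) * (q 1 - c 1) - (p 1 - c 1) * (q 0 - c 0) =
      (s 0 - c 0) * (t 1 - c 1) - (s 1 - c 1) * (t 0 - c 0)) :
    ∃ φ : E2 ≃ᵃⁱ[ℝ] E2, IsLineReflection φ ∧ φ p = t ∧ φ t = p ∧ φ q = s ∧ φ s = q := by
  have hv : (!₂[-(p 1 - t 1), p 0 - t 0] : E2) ≠ 0 := by
    intro h
    have h0 := congrArg (fun x : E2 => x 0) h
    have h1 := congrArg (fun x : E2 => x 1) h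
    simp at h0 h1
    apply hpt
    ext i
    fin_cases i
    · simp; linarith
    · simp; linarith
  obtain ⟨φ, hφ, hsw⟩ := exists_refl c _ hv
  simp only [Matrix.cons_val_zero, Matrix.cons_val_one] at hsw
  have a := hsw p t (by nlinarith only [hp, ht]) (by ring)
  -- second pair of relations
  have hre2 : (q 0 - c 0) * (t 0 - c 0) + (q 1 - c 1) * (t 1 - c 1) =
      (p 0 - c 0) * (s 0 - c 0) + (p 1 - c 1) * (s 1 - c 1) := by
    apply mul_left_cancel₀ hr.ne'
    generalize p 0 - c 0 = p0 at *
    generalize p 1 - c 1 = p1 at *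
    generalize q 0 - c 0 = q0 at *
    generalize q 1 - c 1 = q1 at *
    generalize s 0 - c 0 = s0 at *
    generalize s 1 - c 1 = s1 at *
    generalize t 0 - c 0 = t0 at *
    generalize t 1 - c 1 = t1 at *
    linear_combination (p0 * t0 + p1 * t1) * hre + (-(p1 * t0) + p0 * t1) * him -
      (q0 * t0 + q1 * t1) * hp + (p0 * s0 + p1 * s1) * ht
  have him2 : (q 0 - c 0) * (t 1 - c 1) - (q 1 - c 1) * (t 0 - c 0) =
      (p 0 - c 0) * (s 1 - c 1) - (p 1 - c 1) * (s 0 - c 0) := by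
    apply mul_left_cancel₀ hr.ne'
    generalize p 0 - c 0 = p0 at *
    generalize p 1 - c 1 = p1 at *
    generalize q 0 - c 0 = q0 at *
    generalize q 1 - c 1 = q1 at *
    generalize s 0 - c 0 = s0 at *
    generalize s 1 - c 1 = s1 at *
    generalize t 0 - c 0 = t0 at *
    generalize t 1 - c 1 = t1 at *
    linear_combination (p0 * t1 - p1 * t0) * hre - (p0 * t0 + p1 * t1) * him -
      (q0 * t1 - q1 * t0) * hp + (p0 * s1 - p1 * s0) * ht
  have b := hsw q s (by nlinarith only [hre, hre2]) (by nlinarith only [him, him2])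
  exact ⟨φ, hφ, a.1, a.2, b.1, b.2⟩

theorem image_swap_set {α : Type*} (f : α → α) {p q s t : α} (h1 : f p = t) (h2 : f t = p)
    (h3 : f q = s) (h4 : f s = q) {Q : Set α} (hQ : ∀ x, x ∈ Q ↔ x = p ∨ x = q ∨ x = s ∨ x = t) :
    f '' Q = Q := by
  ext x
  rw [hQ x]
  constructor
  · rintro ⟨y, hy, rfl⟩
    rcases (hQ y).1 hy with rfl | rfl | rfl | rfl <;> simp [*]
  · rintro (rfl | rfl | rfl | rfl)
    · exact ⟨t, (hQ t).2 (by simp), h2⟩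
    · exact ⟨s, (hQ s).2 (by simp), h4⟩
    · exact ⟨q, (hQ q).2 (by simp), h3⟩
    · exact ⟨p, (hQ p).2 (by simp), h1⟩

theorem symm_of_eq {c p q s t : E2} {r : ℝ} (hr : 0 < r)
    (hp : (p 0 - c 0) ^ 2 + (p 1 - c 1) ^ 2 = r) (hq : (q 0 - c 0) ^ 2 + (q 1 - c 1) ^ 2 = r)
    (hs : (s 0 - c 0) ^ 2 + (s 1 - c 1) ^ 2 = r) (ht : (t 0 - c 0) ^ 2 + (t 1 - c 1) ^ 2 = r)
    (hpt : p ≠ t) (hps : p ≠ s)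
    (he : (p 0 - q 0) ^ 2 + (p 1 - q 1) ^ 2 = (s 0 - t 0) ^ 2 + (s 1 - t 1) ^ 2)
    {Q : Set E2} (hQ : ∀ x, x ∈ Q ↔ x = p ∨ x = q ∨ x = s ∨ x = t) : IsSymmetricSet Q := by
  have hre : (p 0 - c 0) * (q 0 - c 0) + (p 1 - c 1) * (q 1 - c 1) =
      (s 0 - c 0) * (t 0 - c 0) + (s 1 - c 1) * (t 1 - c 1) := by
    linear_combination (hp + hq - hs - ht - he) / 2
  have hsq : ((p 0 - c 0) * (q 1 - c 1) - (p 1 - c 1) * (q 0 - c 0)) ^ 2 =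
      ((s 0 - c 0) * (t 1 - c 1) - (s 1 - c 1) * (t 0 - c 0)) ^ 2 := by
    generalize p 0 - c 0 = p0 at *
    generalize p 1 - c 1 = p1 at *
    generalize q 0 - c 0 = q0 at *
    generalize q 1 - c 1 = q1 at *
    generalize s 0 - c 0 = s0 at *
    generalize s 1 - c 1 = s1 at *
    generalize t 0 - c 0 = t0 at *
    generalize t 1 - c 1 = t1 at *
    linear_combination (q0 ^ 2 + q1 ^ 2) * hp + r * hq - (t0 ^ 2 + t1 ^ 2) * hs - r * ht -
      (p0 * q0 + p1 * q1 + s0 * t0 + s1 * t1) * hre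
  rcases sq_eq_sq_iff_eq_or_eq_neg.1 hsq with him | him
  · obtain ⟨φ, hφ, h1, h2, h3, h4⟩ := exists_refl_swap hr hp hq hs ht hpt hre him
    exact ⟨φ, hφ, image_swap_set φ h1 h2 h3 h4 hQ⟩
  · obtain ⟨φ, hφ, h1, h2, h3, h4⟩ := exists_refl_swap hr hp hq ht hs hps (by linarith) (by linarith)
    refine ⟨φ, hφ, image_swap_set φ h1 h2 h3 h4 (fun x => ?_)⟩
    rw [hQ x]; tauto

/-- the point of the plane given by a Gaussian integer -/
noncomputable def toE (z : GI) : E2 := !₂[(z.re : ℝ), (z.im : ℝ)]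

theorem toE_zero (z : GI) : toE z 0 = z.re := by simp [toE]

theorem toE_one (z : GI) : toE z 1 = z.im := by simp [toE]

theorem toE_inj {z w : GI} (h : toE z = toE w) : z = w := by
  have h0 := congrArg (fun x : E2 => x 0) h
  have h1 := congrArg (fun x : E2 => x 1) h
  simp only [toE_zero, toE_one] at h0 h1
  apply Zsqrtd.ext
  · exact_mod_cast h0
  · exact_mod_cast h1

theorem exists_toE {x : E2} (h : IsIntegerPoint x) : ∃ z : GI, toE z = x := by
  obtain ⟨a, ha⟩ := h 0
  obtain ⟨b, hb⟩ := h 1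
  refine ⟨⟨a, b⟩, ?_⟩
  ext i
  fin_cases i
  · simpa [toE] using ha.symm
  · simpa [toE] using hb.symm

theorem dist_sq (x y : E2) : dist x y ^ 2 = (x 0 - y 0) ^ 2 + (x 1 - y 1) ^ 2 := by
  rw [EuclideanSpace.dist_eq, Real.sq_sqrt (by positivity), Fin.sum_univ_two, Real.dist_eq,
    Real.dist_eq, sq_abs, sq_abs]

theorem dist_toE (z w : GI) : dist (toE z) (toE w) = nrm (w - z) := by
  have h : dist (toE z) (toE w) ^ 2 = nrm (w - z) ^ 2 := by
    rw [dist_sq, nrm_sq, norm_eq]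
    simp only [toE_zero, toE_one, Zsqrtd.re_sub, Zsqrtd.im_sub]
    push_cast
    ring
  have h0 : 0 ≤ nrm (w - z) := norm_nonneg _
  exact (sq_eq_sq₀ dist_nonneg h0).1 h

/-- four Gaussian integers on a common circle -/
theorem good_of_circle {P : Fin 4 → GI} (hne : ∀ i j, i ≠ j → P i ≠ P j) {c : E2} {r : ℝ}
    (hr : 0 < r)
    (hc : ∀ i, ((P i).re - c 0) ^ 2 + ((P i).im - c 1) ^ 2 = r)
    {Q : Set E2} (hQ : ∀ x, x ∈ Q ↔ ∃ i, x = toE (P i)) (hns : ¬ IsSymmetricSet Q) :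
    Good (fun i j => P j - P i) := by
  have hneE : ∀ i j, i ≠ j → toE (P i) ≠ toE (P j) := fun i j hij h => hne i j hij (toE_inj h)
  have hcE : ∀ i, (toE (P i) 0 - c 0) ^ 2 + (toE (P i) 1 - c 1) ^ 2 = r := by
    intro i; rw [toE_zero, toE_one]; exact hc i
  have h1 : (P 1 - P 0).norm ≠ (P 3 - P 2).norm := by
    intro h
    apply hns
    refine symm_of_eq hr (hcE 0) (hcE 1) (hcE 2) (hcE 3) (hneE 0 3 (by decide))
      (hneE 0 2 (by decide)) ?_ (fun x => ?_)
    · rw [← dist_sq, ← dist_sq, dist_toE, dist_toE, nrm_sq, nrm_sq, h]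
    · rw [hQ]
      constructor
      · rintro ⟨i, rfl⟩
        fin_cases i <;> simp
      · rintro (h | h | h | h)
        exacts [⟨0, h⟩, ⟨1, h⟩, ⟨2, h⟩, ⟨3, h⟩]
  have h2 : (P 2 - P 0).norm ≠ (P 3 - P 1).norm := by
    intro h
    apply hns
    refine symm_of_eq hr (hcE 0) (hcE 2) (hcE 1) (hcE 3) (hneE 0 3 (by decide))
      (hneE 0 1 (by decide)) ?_ (fun x => ?_)
    · rw [← dist_sq, ← dist_sq, dist_toE, dist_toE, nrm_sq, nrm_sq, h]
    · rw [hQ]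
      constructor
      · rintro ⟨i, rfl⟩
        fin_cases i <;> simp
      · rintro (h | h | h | h)
        exacts [⟨0, h⟩, ⟨2, h⟩, ⟨1, h⟩, ⟨3, h⟩]
  have hcr : CR (P 0) (P 1) (P 2) (P 3) := by
    have k0 := hc 0
    have k1 := hc 1
    have k2 := hc 2
    have k3 := hc 3
    unfold CR
    have : ((((P 1 - P 0) * (P 3 - P 2) * star ((P 2 - P 0) * (P 1 - P 3))).im : ℤ) : ℝ) = 0 := by
      simp only [star_mul, star_sub, Zsqrtd.im_mul, Zsqrtd.re_mul, Zsqrtd.im_sub, Zsqrtd.re_sub,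
        Zsqrtd.re_star, Zsqrtd.im_star]
      push_cast
      generalize ((P 0).re : ℝ) = x0 at *
      generalize ((P 1).re : ℝ) = x1 at *
      generalize ((P 2).re : ℝ) = x2 at *
      generalize ((P 3).re : ℝ) = x3 at *
      generalize ((P 0).im : ℝ) = y0 at *
      generalize ((P 1).im : ℝ) = y1 at *
      generalize ((P 2).im : ℝ) = y2 at *
      generalize ((P 3).im : ℝ) = y3 at *
      linear_combination -((x2 - x1) * (y3 - y1) - (y2 - y1) * (x3 - x1)) * k0 +
        ((x2 - x0) * (y3 - y0) - (y2 - y0) * (x3 - x0)) * k1 -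
        ((x1 - x0) * (y3 - y0) - (y1 - y0) * (x3 - x0)) * k2 +
        ((x1 - x0) * (y2 - y0) - (y1 - y0) * (x2 - x0)) * k3
    exact_mod_cast this
  refine good_mk hne hcr ?_ h1 h2
  rintro ⟨g1, g2⟩
  -- the first three points are not collinear
  set a := P 1 - P 0 with ha
  set b := P 2 - P 0 with hb
  set d := P 3 - P 0 with hd
  have e1 : P 3 - P 2 = d - b := by rw [hd, hb]; ring
  have e2 : P 3 - P 1 = d - a := by rw [hd, ha]; ring
  have hncol : a.re * b.im - a.im * b.re ≠ 0 := by
    intro h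
    have ha0 : (P 1).re - (P 0).re = a.re := by rw [ha, Zsqrtd.re_sub]
    have ha1 : (P 1).im - (P 0).im = a.im := by rw [ha, Zsqrtd.im_sub]
    have hb0 : (P 2).re - (P 0).re = b.re := by rw [hb, Zsqrtd.re_sub]
    have hb1 : (P 2).im - (P 0).im = b.im := by rw [hb, Zsqrtd.im_sub]
    have k0 := hc 0
    have k1 := hc 1
    have k2 := hc 2
    have hR : (a.re : ℝ) * b.im - a.im * b.re = 0 := by exact_mod_cast h
    have f1 : ((P 1).re : ℝ) = (P 0).re + a.re := by rw [← ha0]; push_cast; ring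
    have f2 : ((P 1).im : ℝ) = (P 0).im + a.im := by rw [← ha1]; push_cast; ring
    have f3 : ((P 2).re : ℝ) = (P 0).re + b.re := by rw [← hb0]; push_cast; ring
    have f4 : ((P 2).im : ℝ) = (P 0).im + b.im := by rw [← hb1]; push_cast; ring
    rw [f1, f2] at k1
    rw [f3, f4] at k2
    have hna : a.norm ≠ 0 := (GaussianInt.norm_pos.2 (sub_ne_zero.2 (hne 1 0 (by decide)))).ne'
    have hnb : b.norm ≠ 0 := (GaussianInt.norm_pos.2 (sub_ne_zero.2 (hne 2 0 (by decide)))).ne'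
    have hnab : (a - b).norm ≠ 0 := by
      refine (GaussianInt.norm_pos.2 ?_).ne'
      have : a - b = P 1 - P 2 := by rw [ha, hb]; ring
      rw [this]
      exact sub_ne_zero.2 (hne 1 2 (by decide))
    have hna' : (a.re : ℝ) ^ 2 + (a.im : ℝ) ^ 2 ≠ 0 := by
      rw [norm_eq] at hna
      have : ((a.re * a.re + a.im * a.im : ℤ) : ℝ) ≠ 0 := by exact_mod_cast hna
      push_cast at this
      intro h0; apply this; linarith
    have hnb' : (b.re : ℝ) ^ 2 + (b.im : ℝ) ^ 2 ≠ 0 := by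
      rw [norm_eq] at hnb
      have : ((b.re * b.re + b.im * b.im : ℤ) : ℝ) ≠ 0 := by exact_mod_cast hnb
      push_cast at this
      intro h0; apply this; linarith
    have hnab' : ((a.re : ℝ) - b.re) ^ 2 + ((a.im : ℝ) - b.im) ^ 2 ≠ 0 := by
      rw [norm_eq] at hnab
      have : (((a - b).re * (a - b).re + (a - b).im * (a - b).im : ℤ) : ℝ) ≠ 0 := by
        exact_mod_cast hnab
      rw [Zsqrtd.re_sub, Zsqrtd.im_sub] at this
      push_cast at this
      intro h0; apply this; linarith
    generalize (a.re : ℝ) = a0 at *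
    generalize (a.im : ℝ) = a1 at *
    generalize (b.re : ℝ) = b0 at *
    generalize (b.im : ℝ) = b1 at *
    have m1 : a0 ^ 2 + a1 ^ 2 = -2 * (((P 0).re - c 0) * a0 + ((P 0).im - c 1) * a1) := by
      linear_combination k1 - k0
    have m2 : b0 ^ 2 + b1 ^ 2 = -2 * (((P 0).re - c 0) * b0 + ((P 0).im - c 1) * b1) := by
      linear_combination k2 - k0
    generalize ((P 0).re : ℝ) - c 0 = u0 at *
    generalize ((P 0).im : ℝ) - c 1 = u1 at *
    have z : (a0 ^ 2 + a1 ^ 2) * (b0 ^ 2 + b1 ^ 2) * ((a0 - b0) ^ 2 + (a1 - b1) ^ 2) = 0 := by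
      have z0 : (a0 ^ 2 + a1 ^ 2) * b0 - (b0 ^ 2 + b1 ^ 2) * a0 = 0 := by
        linear_combination b0 * m1 - a0 * m2 + 2 * u1 * hR
      have z1 : (a0 ^ 2 + a1 ^ 2) * b1 - (b0 ^ 2 + b1 ^ 2) * a1 = 0 := by
        linear_combination b1 * m1 - a1 * m2 - 2 * u0 * hR
      linear_combination ((a0 ^ 2 + a1 ^ 2) * b0 - (b0 ^ 2 + b1 ^ 2) * a0) * z0 +
        ((a0 ^ 2 + a1 ^ 2) * b1 - (b0 ^ 2 + b1 ^ 2) * a1) * z1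
    exact (mul_ne_zero (mul_ne_zero hna' hnb') hnab') z
  rw [e1] at g1 h1
  rw [e2] at g2
  have ga : (a.re * b.im - a.im * b.re) * (d.re - a.re - b.re) = 0 := by
    simp only [Zsqrtd.im_mul, Zsqrtd.re_sub, Zsqrtd.im_sub, Zsqrtd.re_star, Zsqrtd.im_star] at g1 g2
    linear_combination -b.re * g1 + a.re * g2
  have gb : (a.re * b.im - a.im * b.re) * (d.im - a.im - b.im) = 0 := by
    simp only [Zsqrtd.im_mul, Zsqrtd.re_sub, Zsqrtd.im_sub, Zsqrtd.re_star, Zsqrtd.im_star] at g1 g2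
    linear_combination -b.im * g1 + a.im * g2
  have ga' := (mul_eq_zero.1 ga).resolve_left hncol
  have gb' := (mul_eq_zero.1 gb).resolve_left hncol
  apply h1
  clear_value a b d
  have e3 : a = d - b := by
    apply Zsqrtd.ext
    · rw [Zsqrtd.re_sub]; linarith
    · rw [Zsqrtd.im_sub]; linarith
  rw [← e3]

theorem exists_param {A : Set E2} (hA : ∀ x ∈ A, IsIntegerPoint x) {R : ℝ} (hR : 0 ≤ R)
    (hd : EMetric.diam A ≤ ENNReal.ofReal R) {Q : Set E2} (hQA : Q ⊆ A)
    (hQ : IsCyclicQuadrilateral Q) (hns : ¬ IsSymmetricSet Q) :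
    ∃ z : GI, toE z ∈ A ∧ ∃ D ∈ GS R, Q = Set.range (fun j => toE (z + D 0 j)) := by
  obtain ⟨hcard, c, ρ, hρ, hsph⟩ := hQ
  have hfin : Q.Finite := Set.finite_of_ncard_pos (by omega)
  have hc4 : hfin.toFinset.card = 4 := by rw [← Set.ncard_eq_toFinset_card Q hfin]; exact hcard
  let e := hfin.toFinset.equivFinOfCardEq hc4
  have hmem : ∀ i, ((e.symm i : hfin.toFinset) : E2) ∈ Q := fun i =>
    hfin.mem_toFinset.1 (e.symm i).2
  choose P hP using fun i => exists_toE (hA _ (hQA (hmem i)))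
  have hPQ : ∀ i, toE (P i) ∈ Q := fun i => by rw [hP]; exact hmem i
  have hne : ∀ i j, i ≠ j → P i ≠ P j := by
    intro i j hij h
    apply hij
    apply e.symm.injective
    apply Subtype.ext
    rw [← hP i, ← hP j, h]
  have hQ' : ∀ x, x ∈ Q ↔ ∃ i, x = toE (P i) := by
    intro x
    constructor
    · intro hx
      refine ⟨e ⟨x, hfin.mem_toFinset.2 hx⟩, ?_⟩
      rw [hP, Equiv.symm_apply_apply]
    · rintro ⟨i, rfl⟩; exact hPQ i
  have hgood : Good (fun i j => P j - P i) := by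
    refine good_of_circle hne (c := c) (r := ρ ^ 2) (by positivity) (fun i => ?_) hQ' hns
    have h1 : dist (toE (P i)) c = ρ := hsph (hPQ i)
    rw [← toE_zero, ← toE_one, ← dist_sq, h1]
  refine ⟨P 0, hQA (hPQ 0), fun i j => P j - P i, ⟨hgood, fun i j => ?_⟩, ?_⟩
  · rw [← dist_toE]
    have h1 := (EMetric.edist_le_diam_of_mem (hQA (hPQ i)) (hQA (hPQ j))).trans hd
    rw [edist_dist] at h1
    exact (ENNReal.ofReal_le_ofReal_iff hR).1 h1
  · ext x
    rw [hQ' x, Set.mem_range]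
    constructor
    · rintro ⟨i, rfl⟩; exact ⟨i, by congr 1; ring⟩
    · rintro ⟨i, rfl⟩; exact ⟨i, by congr 1; ring⟩

theorem quad_count : ∃ K : ℝ, 1 ≤ K ∧ ∀ R : ℝ, 1 ≤ R → ∀ A : Set E2,
    (∀ x ∈ A, IsIntegerPoint x) → EMetric.diam A ≤ ENNReal.ofReal R →
    Cnt {Q : Set E2 | Q ⊆ A ∧ IsCyclicQuadrilateral Q ∧ ¬ IsSymmetricSet Q}
      (9 * R ^ 2 * (K * R ^ ((262 : ℝ) / 100))) := by
  obtain ⟨K, hK, hb⟩ := gs_bound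
  refine ⟨K, hK, fun R hR A hA hd => ?_⟩
  have hR0 : 0 ≤ R := by linarith
  have hbR := hb R hR
  rcases Set.eq_empty_or_nonempty {z : GI | toE z ∈ A} with h0 | ⟨z0, hz0⟩
  · refine (cnt_empty (mul_nonneg (by positivity) hbR.nonneg)).subset ?_
    rintro Q ⟨h1, h2, h3⟩
    obtain ⟨z, hz, -⟩ := exists_param hA hR0 hd h1 h2 h3
    have : z ∈ {z : GI | toE z ∈ A} := hz
    rw [h0] at this
    exact this
  · have hz0' : toE z0 ∈ A := hz0
    have hdisc : Cnt ((fun w => z0 + w) '' {z : GI | nrm z ≤ R}) (9 * R ^ 2) :=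
      (cnt_disc R hR).image _
    refine ((cnt_prod hdisc hbR).image
      (fun x => Set.range (fun j => toE (x.1 + x.2 0 j)))).subset ?_
    rintro Q ⟨h1, h2, h3⟩
    obtain ⟨z, hz, D, hD, rfl⟩ := exists_param hA hR0 hd h1 h2 h3
    refine ⟨(z, D), ⟨⟨z - z0, ?_, by ring⟩, hD⟩, rfl⟩
    have h4 := (EMetric.edist_le_diam_of_mem hz0' hz).trans hd
    rw [edist_dist, dist_toE] at h4
    exact (ENNReal.ofReal_le_ofReal_iff hR0).1 h4

end ACQ

theorem asymmetric_cyclic_quadrilaterals :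
    ∀ ε : ℝ, 0 < ε → ∃ C : ℝ, 0 < C ∧ ∀ R : ℝ, 2 ≤ R →
      ∀ A : Set (EuclideanSpace ℝ (Fin 2)), (∀ x ∈ A, IsIntegerPoint x) →
        EMetric.diam A ≤ ENNReal.ofReal R →
        ({Q : Set (EuclideanSpace ℝ (Fin 2)) | Q ⊆ A ∧ IsCyclicQuadrilateral Q ∧
            ¬ IsSymmetricSet Q}.ncard : ℝ) ≤ C * R ^ ((4 : ℝ) + 18 / 29 + ε) := by
  intro ε hε
  obtain ⟨K, hK, hb⟩ := ACQ.quad_count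
  refine ⟨9 * K, by linarith, fun R hR A hA hd => ?_⟩
  refine (hb R (by linarith) A hA hd).2.trans ?_
  have hR0 : 0 < R := by linarith
  have e : 9 * R ^ 2 * (K * R ^ ((262 : ℝ) / 100)) = 9 * K * R ^ ((2 : ℝ) + 262 / 100) := by
    rw [Real.rpow_add hR0, Real.rpow_two]; ring
  rw [e]
  refine mul_le_mul_of_nonneg_left ?_ (by linarith)
  exact Real.rpow_le_rpow_of_exponent_le (by linarith) (by linarith)
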